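/- Let G' be a connected signed graph whose positive edges form a spanning tree, whose negative edge set X' satisfies |X'| ≥ 2, let B' be the set of bridges of G' separating two unbalanced subgraphs, and let S' be the set of edges s for which some 2-edge-cut {s,t} of G' has t ∈ X'. Then there is a collection of signed circuits of G' covering all edges of X' ∪ B' ∪ S' with total length at most 2·|E(G')|, which moreover covers every negative loop of G' exactly twice. -/

import Mathlib

open Finset
open scoped Classical

noncomputable section

namespace SignedCircuitCover

variable {V E : Type} [Fintype V] [Fintype E] [DecidableEq V] [DecidableEq E]

/-- `e` is a loop. -/
def IsLoop (ends : E → Sym2 V) (e : E) : Prop := (ends e).IsDiag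

/-- The vertices incident with an edge of `F`. -/
def support (ends : E → Sym2 V) (F : Finset E) : Finset V :=
  Finset.univ.filter fun v => ∃ e ∈ F, v ∈ ends e

/-- Degree of `v` in the subgraph with edge set `F` (a loop counts twice). -/
def degree (ends : E → Sym2 V) (F : Finset E) (v : V) : ℕ :=
  ∑ e ∈ F, (if ends e = Sym2.diag v then 2 else if v ∈ ends e then 1 else 0)

/-- Reachability inside the edge set `F`. -/
def Reach (ends : E → Sym2 V) (F : Finset E) : V → V → Prop :=
  Relation.ReflTransGen fun a b => ∃ e ∈ F, ends e = s(a, b)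

/-- The subgraph with edge set `F` is connected. -/
def ConnectedOn (ends : E → Sym2 V) (F : Finset E) : Prop :=
  ∀ u ∈ support ends F, ∀ v ∈ support ends F, Reach ends F u v

/-- The whole graph is connected. -/
def Connected (ends : E → Sym2 V) : Prop :=
  ∀ u v : V, Reach ends (Finset.univ : Finset E) u v

/-- `F` is the edge set of a circuit (connected, 2-regular; a loop is a circuit). -/
def IsCircuit (ends : E → Sym2 V) (F : Finset E) : Prop :=
  F.Nonempty ∧ ConnectedOn ends F ∧ ∀ v ∈ support ends F, degree ends F v = 2

/-- `F` is the edge set of an Eulerian subgraph (connected, all degrees even). -/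
def IsEulerianOn (ends : E → Sym2 V) (F : Finset E) : Prop :=
  ConnectedOn ends F ∧ ∀ v ∈ support ends F, Even (degree ends F v)

/-- Negative edges of `F` (`sgn e = true` means `e` is negative). -/
def negEdges (sgn : E → Bool) (F : Finset E) : Finset E := F.filter fun e => sgn e = true

def IsBalancedCircuit (ends : E → Sym2 V) (sgn : E → Bool) (F : Finset E) : Prop :=
  IsCircuit ends F ∧ Even (negEdges sgn F).card

def IsUnbalancedCircuit (ends : E → Sym2 V) (sgn : E → Bool) (F : Finset E) : Prop :=
  IsCircuit ends F ∧ Odd (negEdges sgn F).card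

/-- `P` is the edge set of a path with (distinct) end-vertices `u` and `v`. -/
def IsPath (ends : E → Sym2 V) (P : Finset E) (u v : V) : Prop :=
  P.Nonempty ∧ ConnectedOn ends P ∧ u ≠ v ∧
    u ∈ support ends P ∧ v ∈ support ends P ∧
    degree ends P u = 1 ∧ degree ends P v = 1 ∧
    ∀ w ∈ support ends P, w ≠ u → w ≠ v → degree ends P w = 2

/-- A short barbell: two unbalanced circuits meeting at exactly one vertex. -/
def IsShortBarbell (ends : E → Sym2 V) (sgn : E → Bool) (F : Finset E) : Prop :=
  ∃ C₁ C₂ : Finset E, Disjoint C₁ C₂ ∧ F = C₁ ∪ C₂ ∧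
    IsUnbalancedCircuit ends sgn C₁ ∧ IsUnbalancedCircuit ends sgn C₂ ∧
    ∃ v : V, support ends C₁ ∩ support ends C₂ = {v}

/-- A long barbell: two disjoint unbalanced circuits joined by a path meeting
them only at its end-vertices. -/
def IsLongBarbell (ends : E → Sym2 V) (sgn : E → Bool) (F : Finset E) : Prop :=
  ∃ (C₁ C₂ P : Finset E) (u v : V),
    Disjoint C₁ C₂ ∧ Disjoint C₁ P ∧ Disjoint C₂ P ∧ F = C₁ ∪ C₂ ∪ P ∧
    IsUnbalancedCircuit ends sgn C₁ ∧ IsUnbalancedCircuit ends sgn C₂ ∧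
    Disjoint (support ends C₁) (support ends C₂) ∧
    IsPath ends P u v ∧
    support ends P ∩ support ends C₁ = {u} ∧
    support ends P ∩ support ends C₂ = {v}

def IsBarbell (ends : E → Sym2 V) (sgn : E → Bool) (F : Finset E) : Prop :=
  IsShortBarbell ends sgn F ∨ IsLongBarbell ends sgn F

/-- A signed circuit: a balanced circuit, a short barbell or a long barbell. -/
def IsSignedCircuit (ends : E → Sym2 V) (sgn : E → Bool) (F : Finset E) : Prop :=
  IsBalancedCircuit ends sgn F ∨ IsShortBarbell ends sgn F ∨ IsLongBarbell ends sgn F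

/-- `e` is a bridge (cut-edge) of the subgraph with edge set `F`. -/
def IsBridgeIn (ends : E → Sym2 V) (F : Finset E) (e : E) : Prop :=
  e ∈ F ∧ ∀ a b : V, ends e = s(a, b) → ¬ Reach ends (F.erase e) a b

/-- The bridges of the whole graph. -/
def bridges (ends : E → Sym2 V) : Finset E :=
  Finset.univ.filter fun e => IsBridgeIn ends Finset.univ e

/-- The non-bridge edges of the whole graph. -/
def nonbridges (ends : E → Sym2 V) : Finset E := Finset.univ \ bridges ends

/-- Reachability inside `F` avoiding the vertex `x`. -/
def ReachAvoid (ends : E → Sym2 V) (F : Finset E) (x : V) : V → V → Prop :=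
  Relation.ReflTransGen fun a b => a ≠ x ∧ b ≠ x ∧ ∃ e ∈ F, ends e = s(a, b)

/-- `x` is a cut-vertex of the subgraph with edge set `F`. -/
def IsCutVertexOn (ends : E → Sym2 V) (F : Finset E) (x : V) : Prop :=
  ∃ a ∈ support ends F, ∃ b ∈ support ends F,
    a ≠ x ∧ b ≠ x ∧ Reach ends F a b ∧ ¬ ReachAvoid ends F x a b

/-- The subgraph with edge set `F` is 2-connected (connected and without cut-vertices). -/
def TwoConnectedOn (ends : E → Sym2 V) (F : Finset E) : Prop :=
  ConnectedOn ends F ∧ ∀ x : V, ¬ IsCutVertexOn ends F x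

/-- The whole graph is 2-connected. -/
def TwoConnected (ends : E → Sym2 V) : Prop :=
  Connected ends ∧ ∀ x : V, ¬ IsCutVertexOn ends (Finset.univ : Finset E) x

/-- Total length of a collection of subgraphs. -/
def totalLength (𝒞 : List (Finset E)) : ℕ := (𝒞.map Finset.card).sum

/-- The width of the edge `e` with respect to the collection `𝒞`. -/
def widthAt (𝒞 : List (Finset E)) (e : E) : ℕ := (𝒞.filter fun C => e ∈ C).length

/-- `𝒞` covers every edge of the graph. -/
def CoversAll (𝒞 : List (Finset E)) : Prop := ∀ e : E, ∃ C ∈ 𝒞, e ∈ C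

/-- A tree of Eulerian graphs: connected, and after deleting all bridges every
component is Eulerian (equivalently all degrees in the bridgeless part are even). -/
def IsTreeOfEulerian (ends : E → Sym2 V) : Prop :=
  Connected ends ∧ ∀ v : V, Even (degree ends (nonbridges ends) v)

/-- Non-bridge non-loop edges. -/
def nbnl (ends : E → Sym2 V) : Finset E :=
  (nonbridges ends).filter fun e => ¬ IsLoop ends e

/-- A tree of circuits: connected, and after deleting all bridges and loops every
vertex has degree 0 or 2 (each component is an isolated vertex or a circuit). -/
def IsTreeOfCircuits (ends : E → Sym2 V) : Prop :=
  Connected ends ∧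
    ∀ v : V, degree ends (nbnl ends) v = 0 ∨ degree ends (nbnl ends) v = 2

/-- The balloon containing `v`: the edge set of the component of `v` in the
graph of non-bridge non-loop edges. -/
def compBalloon (ends : E → Sym2 V) (v : V) : Finset E :=
  (nbnl ends).filter fun e => ∃ w ∈ ends e, Reach ends (nbnl ends) v w

/-- Valency of the balloon of `v`: the number of bridges and loops incident
with its component. -/
def balloonValency (ends : E → Sym2 V) (v : V) : ℕ :=
  (Finset.univ.filter fun e =>
    (IsBridgeIn ends Finset.univ e ∨ IsLoop ends e) ∧
      ∃ w ∈ ends e, Reach ends (nbnl ends) v w).card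

/-- A balloon consisting of a single negative loop. -/
def IsNegLoopBalloon (ends : E → Sym2 V) (sgn : E → Bool) (B : Finset E) : Prop :=
  ∃ e : E, IsLoop ends e ∧ sgn e = true ∧ B = {e}

/-- A leaf balloon: a negative loop, or a nontrivial balloon of valency 1. -/
def IsLeafBalloon (ends : E → Sym2 V) (sgn : E → Bool) (B : Finset E) : Prop :=
  IsNegLoopBalloon ends sgn B ∨
    ∃ v : V, B = compBalloon ends v ∧ B.Nonempty ∧ balloonValency ends v = 1

/-- A leaf circuit: a negative loop, or a balloon of valency 1 which is a circuit. -/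
def IsLeafCircuit (ends : E → Sym2 V) (sgn : E → Bool) (B : Finset E) : Prop :=
  IsNegLoopBalloon ends sgn B ∨
    ∃ v : V, B = compBalloon ends v ∧ IsCircuit ends B ∧ balloonValency ends v = 1

/-- An inner circuit: a balloon of valency at least 2 which is a circuit. -/
def IsInnerCircuit (ends : E → Sym2 V) (B : Finset E) : Prop :=
  ∃ v : V, B = compBalloon ends v ∧ IsCircuit ends B ∧ 2 ≤ balloonValency ends v

/-- Number of unbalanced circuits of a tree of circuits: negative loops together
with the unbalanced (nontrivial) balloons. -/
def numUnbalancedCircuits (ends : E → Sym2 V) (sgn : E → Bool) : ℕ :=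
  (Finset.univ.filter fun e : E => IsLoop ends e ∧ sgn e = true).card +
    Set.ncard {B : Finset E |
      (∃ v : V, B = compBalloon ends v) ∧ B.Nonempty ∧ Odd (negEdges sgn B).card}

/-- Flow-admissibility: every edge lies in a signed circuit (Bouchet). -/
def FlowAdmissible (ends : E → Sym2 V) (sgn : E → Bool) : Prop :=
  ∀ e : E, ∃ C : Finset E, IsSignedCircuit ends sgn C ∧ e ∈ C

/-- `e` has exactly one end-vertex in `U`. -/
def crosses (ends : E → Sym2 V) (U : Finset V) (e : E) : Prop :=
  ∃ a b : V, ends e = s(a, b) ∧ ((a ∈ U ∧ b ∉ U) ∨ (a ∉ U ∧ b ∈ U))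

/-- Switching the signature at the vertex set `U`. -/
def switch (ends : E → Sym2 V) (U : Finset V) (sgn : E → Bool) : E → Bool :=
  fun e => if crosses ends U e then ! (sgn e) else sgn e

/-- The number of negative edges of a signature. -/
def negCount (sgn : E → Bool) : ℕ := (Finset.univ.filter fun e => sgn e = true).card

/-- `sgn` is a minimum signature: no equivalent (switched) signature has fewer
negative edges. -/
def IsMinSignature (ends : E → Sym2 V) (sgn : E → Bool) : Prop :=
  ∀ U : Finset V, negCount sgn ≤ negCount (switch ends U sgn)

/-- `{e₁, e₂}` is a 2-edge-cut of the subgraph with edge set `F`. -/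
def IsTwoEdgeCut (ends : E → Sym2 V) (F : Finset E) (e₁ e₂ : E) : Prop :=
  e₁ ≠ e₂ ∧ e₁ ∈ F ∧ e₂ ∈ F ∧ ¬ IsBridgeIn ends F e₁ ∧ ¬ IsBridgeIn ends F e₂ ∧
    (∀ a b : V, ends e₁ = s(a, b) → ¬ Reach ends ((F.erase e₁).erase e₂) a b) ∧
    (∀ a b : V, ends e₂ = s(a, b) → ¬ Reach ends ((F.erase e₁).erase e₂) a b)

/-- `b` is a bridge of `F` whose removal leaves two parts which are both unbalanced. -/
def SeparatesUnbalanced (ends : E → Sym2 V) (sgn : E → Bool) (F : Finset E) (b : E) : Prop :=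
  IsBridgeIn ends F b ∧
    ∀ a c : V, ends b = s(a, c) →
      (∃ C ⊆ F.erase b, IsUnbalancedCircuit ends sgn C ∧
        ∃ w ∈ support ends C, Reach ends (F.erase b) a w) ∧
      (∃ C ⊆ F.erase b, IsUnbalancedCircuit ends sgn C ∧
        ∃ w ∈ support ends C, Reach ends (F.erase b) c w)

/-- `T` is a spanning tree of the whole graph: spanning, connected and acyclic. -/
def IsSpanningTree (ends : E → Sym2 V) (T : Finset E) : Prop :=
  (∀ u v : V, Reach ends T u v) ∧ ∀ C ⊆ T, ¬ IsCircuit ends C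

set_option linter.all false

/-! parity basics -/
/-- boundary of an edge between `u` and `v` -/
def del (u v : V) : V → ZMod 2 := Pi.single u 1 + Pi.single v 1

def einc (s : Sym2 V) : V → ZMod 2 :=
  Sym2.lift ⟨fun a b => del a b, fun a b => by simp [del, add_comm]⟩ s

def bd (ends : E → Sym2 V) (A : Finset E) : V → ZMod 2 := ∑ e ∈ A, einc (ends e)

def ng (sgn : E → Bool) (A : Finset E) : ZMod 2 := ∑ e ∈ A, if sgn e = true then 1 else 0

lemma z2 (x : ZMod 2) : x + x = 0 := CharTwo.add_self_eq_zero x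

lemma z2c (x : ZMod 2) : x = 0 ∨ x = 1 := by
  revert x; decide

lemma f2 (f : V → ZMod 2) : f + f = 0 := by
  funext x; exact z2 _

@[simp] lemma einc_mk (a b : V) : einc s(a, b) = del a b := rfl

lemma del_comm (a b : V) : del a b = del b a := by simp [del, add_comm]

@[simp] lemma del_self (a : V) : del a a = 0 := f2 _

lemma del_add (a b c : V) : del a b + del b c = del a c := by
  have := f2 (Pi.single b (1 : ZMod 2) : V → ZMod 2)
  unfold del
  calc _ = Pi.single a 1 + (Pi.single b 1 + Pi.single b 1) + Pi.single c 1 := by abel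
    _ = _ := by rw [this, add_zero]

lemma sum_sdiff2 {M : Type} [AddCommGroup M] (h2 : ∀ x : M, x + x = 0) (f : E → M)
    (A B : Finset E) : ∑ e ∈ symmDiff A B, f e = ∑ e ∈ A, f e + ∑ e ∈ B, f e := by
  have h1 : symmDiff A B = (A \ B) ∪ (B \ A) := rfl
  have hd : Disjoint (A \ B) (B \ A) := by
    rw [Finset.disjoint_left]; intro x hx hy; simp at hx hy; exact hx.2 hy.1
  rw [h1, Finset.sum_union hd, ← Finset.sum_inter_add_sum_sdiff A B f,
    ← Finset.sum_inter_add_sum_sdiff B A f, Finset.inter_comm B A]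
  have := h2 (∑ x ∈ A ∩ B, f x)
  calc _ = (∑ x ∈ A ∩ B, f x + ∑ x ∈ A ∩ B, f x) + (∑ x ∈ A \ B, f x + ∑ x ∈ B \ A, f x) := by
        rw [this, zero_add]
    _ = _ := by abel

lemma bd_symm (ends : E → Sym2 V) (A B : Finset E) :
    bd ends (symmDiff A B) = bd ends A + bd ends B := sum_sdiff2 f2 _ A B

lemma ng_symm (sgn : E → Bool) (A B : Finset E) :
    ng sgn (symmDiff A B) = ng sgn A + ng sgn B := sum_sdiff2 z2 _ A B

lemma bd_union (ends : E → Sym2 V) {A B : Finset E} (h : Disjoint A B) :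
    bd ends (A ∪ B) = bd ends A + bd ends B := Finset.sum_union h

lemma ng_union (sgn : E → Bool) {A B : Finset E} (h : Disjoint A B) :
    ng sgn (A ∪ B) = ng sgn A + ng sgn B := Finset.sum_union h

lemma bd_sdiff (ends : E → Sym2 V) {A B : Finset E} (h : B ⊆ A) :
    bd ends (A \ B) = bd ends A + bd ends B := by
  rw [← bd_symm]; congr 1
  ext x; simp only [mem_symmDiff, mem_sdiff]; have := @h x; tauto

lemma ng_sdiff (sgn : E → Bool) {A B : Finset E} (h : B ⊆ A) :
    ng sgn (A \ B) = ng sgn A + ng sgn B := by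
  rw [← ng_symm]; congr 1
  ext x; simp only [mem_symmDiff, mem_sdiff]; have := @h x; tauto

@[simp] lemma bd_empty (ends : E → Sym2 V) : bd ends ∅ = 0 := rfl
@[simp] lemma ng_empty (sgn : E → Bool) : ng sgn ∅ = 0 := rfl

lemma bd_insert (ends : E → Sym2 V) {A : Finset E} {e : E} (h : e ∉ A) :
    bd ends (insert e A) = einc (ends e) + bd ends A := Finset.sum_insert h

lemma ng_insert (sgn : E → Bool) {A : Finset E} {e : E} (h : e ∉ A) :
    ng sgn (insert e A) = (if sgn e = true then 1 else 0) + ng sgn A := Finset.sum_insert h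

lemma bd_single (ends : E → Sym2 V) (e : E) : bd ends {e} = einc (ends e) :=
  Finset.sum_singleton _ _

lemma ng_eq_card (sgn : E → Bool) (A : Finset E) : ng sgn A = ((negEdges sgn A).card : ZMod 2) := by
  unfold ng negEdges
  rw [Finset.sum_boole]

lemma ng_odd (sgn : E → Bool) (A : Finset E) : ng sgn A = 1 ↔ Odd (negEdges sgn A).card := by
  rw [ng_eq_card, ZMod.natCast_eq_one_iff_odd]

lemma ng_even (sgn : E → Bool) (A : Finset E) : ng sgn A = 0 ↔ Even (negEdges sgn A).card := by
  rw [ng_eq_card, ZMod.natCast_eq_zero_iff_even]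

lemma degree_parity (ends : E → Sym2 V) (A : Finset E) (v : V) :
    ((degree ends A v : ℕ) : ZMod 2) = bd ends A v := by
  unfold degree bd
  rw [Finset.sum_apply]
  push_cast
  apply Finset.sum_congr rfl
  intro e _
  induction h : ends e with
  | _ a b =>
    simp only [einc_mk, del, Pi.add_apply, Pi.single_apply, Sym2.mem_iff, Sym2.diag,
      Sym2.eq_iff]
    by_cases h1 : v = a <;> by_cases h2 : v = b
    · subst h1; subst h2; simp; rfl
    · subst h1; simp [h2]; intro h; exact absurd h.symm h2
    · subst h2; simp [h1]; intro h; exact absurd h.symm h1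
    · simp [h1, h2]; intro h; exact absurd h.symm h1

/-! reach -/

lemma mem_support {ends : E → Sym2 V} {F : Finset E} {v : V} :
    v ∈ support ends F ↔ ∃ e ∈ F, v ∈ ends e := by simp [support]

lemma support_mono {ends : E → Sym2 V} {F G : Finset E} (h : F ⊆ G) :
    support ends F ⊆ support ends G := by
  intro v; simp only [mem_support]; rintro ⟨e, he, hv⟩; exact ⟨e, h he, hv⟩

lemma support_union {ends : E → Sym2 V} {F G : Finset E} :
    support ends (F ∪ G) = support ends F ∪ support ends G := by
  ext v; simp only [mem_support, mem_union]
  constructor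
  · rintro ⟨e, he | he, hv⟩
    · exact Or.inl ⟨e, he, hv⟩
    · exact Or.inr ⟨e, he, hv⟩
  · rintro (⟨e, he, hv⟩ | ⟨e, he, hv⟩)
    · exact ⟨e, Or.inl he, hv⟩
    · exact ⟨e, Or.inr he, hv⟩

lemma Reach.mono {ends : E → Sym2 V} {F G : Finset E} (h : F ⊆ G) {u v : V}
    (hr : Reach ends F u v) : Reach ends G u v := by
  induction hr with
  | refl => exact Relation.ReflTransGen.refl
  | tail _ hs ih =>
    obtain ⟨e, he, h'⟩ := hs
    exact ih.tail ⟨e, h he, h'⟩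

lemma Reach.rfl' {ends : E → Sym2 V} {F : Finset E} {u : V} : Reach ends F u u :=
  Relation.ReflTransGen.refl

lemma Reach.tr {ends : E → Sym2 V} {F : Finset E} {u v w : V}
    (h : Reach ends F u v) (h' : Reach ends F v w) : Reach ends F u w :=
  Relation.ReflTransGen.trans h h'

lemma Reach.sy {ends : E → Sym2 V} {F : Finset E} {u v : V}
    (h : Reach ends F u v) : Reach ends F v u := by
  induction h with
  | refl => exact Reach.rfl'
  | tail _ hs ih =>
    obtain ⟨e, he, h'⟩ := hs
    exact (Relation.ReflTransGen.single ⟨e, he, by rw [h', Sym2.eq_swap]⟩).trans ih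

lemma Reach.edge {ends : E → Sym2 V} {F : Finset E} {u v : V} {e : E} (he : e ∈ F)
    (h : ends e = s(u, v)) : Reach ends F u v := Relation.ReflTransGen.single ⟨e, he, h⟩

lemma Reach.mem {ends : E → Sym2 V} {F : Finset E} {u v : V} {e : E} (he : e ∈ F)
    (hu : u ∈ ends e) (hv : v ∈ ends e) : Reach ends F u v := by
  induction h : ends e with
  | _ a b =>
    rw [h, Sym2.mem_iff] at hu hv
    have hab : Reach ends F a b := Reach.edge he h
    rcases hu with rfl | rfl <;> rcases hv with rfl | rfl
    · exact Reach.rfl'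
    · exact hab
    · exact hab.sy
    · exact Reach.rfl'

/-- sum of boundary over a set closed under `J` vanishes -/
lemma sum_bd_closed {ends : E → Sym2 V} {J : Finset E} (W : Finset V)
    (hW : ∀ e ∈ J, ∀ a b, ends e = s(a, b) → (a ∈ W ↔ b ∈ W)) : ∑ v ∈ W, bd ends J v = 0 := by
  unfold bd
  simp only [Finset.sum_apply]
  rw [Finset.sum_comm]
  apply Finset.sum_eq_zero
  intro e he
  induction h : ends e with
  | _ a b =>
    have := hW e he a b h
    simp only [einc_mk, del, Pi.add_apply, Finset.sum_add_distrib, Finset.sum_pi_single]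
    by_cases ha : a ∈ W
    · simp [ha, this.1 ha]; rfl
    · have hb : b ∉ W := fun h => ha (this.2 h)
      simp [ha, hb]

lemma comp_closed {ends : E → Sym2 V} {J : Finset E} (u : V) :
    ∀ e ∈ J, ∀ a b, ends e = s(a, b) →
      (a ∈ Finset.univ.filter (fun x => Reach ends J u x) ↔
        b ∈ Finset.univ.filter (fun x => Reach ends J u x)) := by
  intro e he a b h
  simp only [mem_filter, mem_univ, true_and]
  exact ⟨fun h' => h'.tr (Reach.edge he h), fun h' => h'.tr (Reach.edge he h).sy⟩

/-- terminals in the same component pair up -/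
lemma pair_exists {ι : Type} {ends : E → Sym2 V} {J : Finset E} (S : Finset ι) (t : ι → V)
    (hb : bd ends J = ∑ i ∈ S, Pi.single (t i) 1) {i : ι} (hi : i ∈ S) :
    ∃ j ∈ S, j ≠ i ∧ Reach ends J (t i) (t j) := by
  by_contra hcon
  push Not at hcon
  have h0 := sum_bd_closed _ (comp_closed (ends := ends) (J := J) (t i))
  rw [hb] at h0
  simp only [Finset.sum_apply] at h0
  rw [Finset.sum_comm] at h0
  simp only [Pi.single_apply, Finset.sum_ite_eq', Finset.sum_ite_eq] at h0
  rw [Finset.sum_eq_single i] at h0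
  · simp [Reach.rfl'] at h0
  · intro j hj hji
    simp [hcon j hj hji]
  · intro h; exact absurd hi h

lemma reach_of_bd {ends : E → Sym2 V} {J : Finset E} {u v : V} (hb : bd ends J = del u v) :
    Reach ends J u v := by
  have h0 := sum_bd_closed _ (comp_closed (ends := ends) (J := J) u)
  rw [hb] at h0
  simp only [del, Pi.add_apply, Finset.sum_add_distrib, Finset.sum_pi_single] at h0
  by_contra h
  simp [h, Reach.rfl'] at h0

/-- an even set stays connected across the removal of an edge -/
lemma reach_even_erase {ends : E → Sym2 V} {A : Finset E} (hA : bd ends A = 0) {e : E}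
    (he : e ∈ A) {u v : V} (h : ends e = s(u, v)) : Reach ends (A.erase e) u v := by
  apply reach_of_bd
  have h1 := bd_insert ends (notMem_erase e A)
  rw [insert_erase he, hA, h, einc_mk] at h1
  have := f2 (del u v)
  calc _ = (del u v + del u v) + bd ends (A.erase e) := by rw [this, zero_add]
    _ = del u v + (del u v + bd ends (A.erase e)) := by abel
    _ = _ := by rw [← h1, add_zero]

lemma support_bd {ends : E → Sym2 V} {A : Finset E} {v : V} (h : bd ends A v ≠ 0) :
    v ∈ support ends A := by
  by_contra hv
  apply h
  unfold bd
  rw [Finset.sum_apply]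
  apply Finset.sum_eq_zero
  intro e he
  have hve : v ∉ ends e := fun h' => hv (mem_support.2 ⟨e, he, h'⟩)
  induction h : ends e with
  | _ a b =>
    rw [h, Sym2.mem_iff] at hve
    push Not at hve
    simp [del, Pi.single_apply, hve.1, hve.2]


/-! simple paths -/
inductive Pth (ends : E → Sym2 V) : V → V → Finset E → Finset V → Prop
  | nil (v : V) : Pth ends v v ∅ {v}
  | cons {u w v : V} {e : E} {A : Finset E} {S : Finset V} (he : ends e = s(u, w)) (hu : u ∉ S)
      (hp : Pth ends w v A S) : Pth ends u v (insert e A) (insert u S)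

namespace Pth

variable {ends : E → Sym2 V}

lemma start_mem {u v : V} {A : Finset E} {S : Finset V} (h : Pth ends u v A S) : u ∈ S := by
  cases h <;> simp

lemma end_mem {u v : V} {A : Finset E} {S : Finset V} (h : Pth ends u v A S) : v ∈ S := by
  induction h with
  | nil v => simp
  | cons he hu hp ih => exact mem_insert_of_mem ih

lemma ends_mem {u v : V} {A : Finset E} {S : Finset V} (h : Pth ends u v A S) :
    ∀ e ∈ A, ∀ x ∈ ends e, x ∈ S := by
  induction h with
  | nil v => simp
  | @cons u w v e A S he hu hp ih =>
    intro f hf x hx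
    rcases mem_insert.1 hf with rfl | hf
    · rw [he, Sym2.mem_iff] at hx
      rcases hx with rfl | rfl
      · simp
      · exact mem_insert_of_mem hp.start_mem
    · exact mem_insert_of_mem (ih f hf x hx)

lemma fresh {u w v : V} {e : E} {A : Finset E} {S : Finset V} (he : ends e = s(u, w)) (hu : u ∉ S)
    (hp : Pth ends w v A S) : e ∉ A := fun h => hu (hp.ends_mem e h u (by rw [he]; simp))

lemma notloop {u v : V} {A : Finset E} {S : Finset V} (h : Pth ends u v A S) :
    ∀ e ∈ A, ∀ a b, ends e = s(a, b) → a ≠ b := by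
  induction h with
  | nil v => simp
  | @cons u w v e A S he hu hp ih =>
    intro f hf a b hab
    rcases mem_insert.1 hf with rfl | hf
    · rw [he, Sym2.eq_iff] at hab
      have : u ≠ w := fun h => hu (h ▸ hp.start_mem)
      rcases hab with ⟨rfl, rfl⟩ | ⟨rfl, rfl⟩
      · exact this
      · exact this.symm
    · exact ih f hf a b hab

lemma bd_eq {u v : V} {A : Finset E} {S : Finset V} (h : Pth ends u v A S) :
    bd ends A = del u v := by
  induction h with
  | nil v => simp
  | @cons u w v e A S he hu hp ih =>
    rw [bd_insert ends (fresh he hu hp), he, einc_mk, ih, del_add]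

lemma nil_of {u : V} {A : Finset E} {S : Finset V} (h : Pth ends u u A S) : A = ∅ ∧ S = {u} := by
  generalize hv : u = v at h
  cases h with
  | nil => exact ⟨rfl, rfl⟩
  | cons he hu hp => exact absurd (hv ▸ hp.end_mem) (by simpa [hv] using hu)

lemma subset_supp {u v : V} {A : Finset E} {S : Finset V} (h : Pth ends u v A S) :
    S = insert u (support ends A) := by
  induction h with
  | nil v => ext x; simp [mem_support]
  | @cons u w v e A S he hu hp ih =>
    ext x
    simp only [mem_insert, mem_support]
    constructor
    · rintro (rfl | hx)
      · exact Or.inl rfl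
      · right
        rw [ih, mem_insert, mem_support] at hx
        rcases hx with rfl | ⟨f, hf, hx⟩
        · exact ⟨e, Or.inl rfl, by rw [he]; simp⟩
        · exact ⟨f, Or.inr hf, hx⟩
    · rintro (rfl | ⟨f, rfl | hf, hx⟩)
      · exact Or.inl rfl
      · rw [he, Sym2.mem_iff] at hx
        rcases hx with rfl | rfl
        · exact Or.inl rfl
        · exact Or.inr hp.start_mem
      · exact Or.inr (hp.ends_mem f hf x hx)

lemma nonempty_of_ne {u v : V} {A : Finset E} {S : Finset V} (h : Pth ends u v A S) (huv : u ≠ v) :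
    A.Nonempty := by
  cases h with
  | nil => exact absurd rfl huv
  | cons he hu hp => exact Finset.insert_nonempty _ _

lemma supp_eq {u v : V} {A : Finset E} {S : Finset V} (h : Pth ends u v A S) (hA : A.Nonempty) :
    support ends A = S := by
  have := h.subset_supp
  rw [this, Finset.insert_eq_self.2]
  cases h with
  | nil => simp at hA
  | cons he hu hp => exact mem_support.2 ⟨_, mem_insert_self _ _, by rw [he]; simp⟩

lemma reach {u v : V} {A : Finset E} {S : Finset V} (h : Pth ends u v A S) :
    ∀ x ∈ S, Reach ends A u x := by
  induction h with
  | nil v => intro x hx; rw [mem_singleton] at hx; subst hx; exact Reach.rfl'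
  | @cons u w v e A S he hu hp ih =>
    intro x hx
    rcases mem_insert.1 hx with rfl | hx
    · exact Reach.rfl'
    · exact (Reach.edge (mem_insert_self _ _) he).tr
        ((ih x hx).mono (subset_insert _ _))

lemma concat {u v w : V} {A B : Finset E} {S T : Finset V} (h : Pth ends u v A S)
    (h' : Pth ends v w B T) (hd : ∀ x ∈ S, x ∈ T → x = v) : Pth ends u w (A ∪ B) (S ∪ T) := by
  induction h with
  | nil v =>
    have : {v} ∪ T = T := by
      rw [Finset.union_eq_right, Finset.singleton_subset_iff]; exact h'.start_mem
    rw [Finset.empty_union, this]; exact h'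
  | @cons u x v e A S he hu hp ih =>
    rw [Finset.insert_union, Finset.insert_union]
    refine Pth.cons he ?_ (ih h' fun y hy hy' => hd y (mem_insert_of_mem hy) hy')
    rw [mem_union, not_or]
    refine ⟨hu, fun hT => ?_⟩
    have := hd u (mem_insert_self _ _) hT
    exact hu (this ▸ hp.end_mem)

lemma reverse {u v : V} {A : Finset E} {S : Finset V} (h : Pth ends u v A S) :
    Pth ends v u A S := by
  induction h with
  | nil v => exact Pth.nil v
  | @cons u w v e A S he hu hp ih =>
    have h1 : Pth ends w u (insert e ∅) (insert w {u}) :=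
      Pth.cons (by rw [he, Sym2.eq_swap]) (fun h => hu (by
        rw [mem_singleton] at h; exact h ▸ hp.start_mem)) (Pth.nil u)
    have h2 := ih.concat h1 (by
      intro x hx hx'
      rw [mem_insert, mem_singleton] at hx'
      rcases hx' with rfl | rfl
      · rfl
      · exact absurd hx hu)
    have e1 : A ∪ insert e ∅ = insert e A := by ext; simp [or_comm]
    have e2 : S ∪ insert w {u} = insert u S := by
      ext x; simp only [mem_union, mem_insert, mem_singleton]
      have := hp.start_mem
      constructor
      · rintro (h | rfl | h)
        · exact Or.inr h
        · exact Or.inr this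
        · exact Or.inl h
      · rintro (h | h)
        · exact Or.inr (Or.inr h)
        · exact Or.inl h
    rw [e1, e2] at h2
    exact h2

/-- split at the first vertex satisfying `p` -/
lemma first_hit {u v : V} {A : Finset E} {S : Finset V} (h : Pth ends u v A S) (p : V → Prop)
    (hp : ∃ x ∈ S, p x) : ∃ x A1 S1 A2 S2, Pth ends u x A1 S1 ∧ Pth ends x v A2 S2 ∧ p x ∧
      (∀ y ∈ S1, p y → y = x) ∧ A = A1 ∪ A2 ∧ Disjoint A1 A2 ∧ S = S1 ∪ S2 ∧
      (∀ y ∈ S1, y ∈ S2 → y = x) := by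
  induction h with
  | nil v =>
    obtain ⟨x, hx, hpx⟩ := hp
    rw [mem_singleton] at hx; subst hx
    exact ⟨x, ∅, {x}, ∅, {x}, Pth.nil x, Pth.nil x, hpx, by simp, by simp, by simp, by simp,
      by simp⟩
  | @cons u w v e A S he hu hP ih =>
    by_cases hpu : p u
    · exact ⟨u, ∅, {u}, insert e A, insert u S, Pth.nil u, Pth.cons he hu hP, hpu, by simp,
        by simp, by simp, by simp, by simp⟩
    · have : ∃ x ∈ S, p x := by
        obtain ⟨x, hx, hpx⟩ := hp
        rcases mem_insert.1 hx with rfl | hx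
        · exact absurd hpx hpu
        · exact ⟨x, hx, hpx⟩
      obtain ⟨x, A1, S1, A2, S2, h1, h2, h3, h4, rfl, h6, rfl, h8⟩ := ih this
      have hfr := fresh he hu hP
      rw [mem_union, not_or] at hu hfr
      refine ⟨x, insert e A1, insert u S1, A2, S2, Pth.cons he hu.1 h1, h2, h3, ?_, ?_, ?_, ?_, ?_⟩
      · intro y hy hpy
        rcases mem_insert.1 hy with rfl | hy
        · exact absurd hpy hpu
        · exact h4 y hy hpy
      · rw [Finset.insert_union]
      · rw [Finset.disjoint_insert_left]; exact ⟨hfr.2, h6⟩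
      · rw [Finset.insert_union]
      · intro y hy hy2
        rcases mem_insert.1 hy with rfl | hy
        · exact absurd hy2 hu.2
        · exact h8 y hy hy2

lemma split {u v x : V} {A : Finset E} {S : Finset V} (h : Pth ends u v A S) (hx : x ∈ S) :
    ∃ A1 S1 A2 S2, Pth ends u x A1 S1 ∧ Pth ends x v A2 S2 ∧
      A = A1 ∪ A2 ∧ Disjoint A1 A2 ∧ S = S1 ∪ S2 ∧ (∀ y ∈ S1, y ∈ S2 → y = x) := by
  obtain ⟨y, A1, S1, A2, S2, h1, h2, h3, h4, h5, h6, h7, h8⟩ :=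
    h.first_hit (fun y => y = x) ⟨x, hx, rfl⟩
  subst h3
  exact ⟨A1, S1, A2, S2, h1, h2, h5, h6, h7, h8⟩

lemma of_reach {F : Finset E} {u v : V} (h : Reach ends F u v) :
    ∃ A S, A ⊆ F ∧ Pth ends u v A S := by
  induction h using Relation.ReflTransGen.head_induction_on with
  | refl => exact ⟨∅, {v}, by simp, Pth.nil v⟩
  | @head a c hs _ ih =>
    obtain ⟨e, he, hac⟩ := hs
    obtain ⟨A, S, hA, hP⟩ := ih
    by_cases ha : a ∈ S
    · obtain ⟨A1, S1, A2, S2, h1, h2, rfl, _⟩ := hP.split ha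
      exact ⟨A2, S2, (subset_union_right).trans hA, h2⟩
    · exact ⟨insert e A, insert a S, insert_subset he hA, Pth.cons hac ha hP⟩

lemma sub_even {u v : V} {A : Finset E} {S : Finset V} (h : Pth ends u v A S) :
    ∀ B ⊆ A, bd ends B = 0 → B = ∅ := by
  induction h with
  | nil v => intro B hB _; exact Finset.subset_empty.1 hB
  | @cons u w v e A S he hu hp ih =>
    intro B hB h0
    have heB : e ∉ B := by
      intro heB
      have h1 := bd_insert ends (notMem_erase e B)
      rw [insert_erase heB, h0, he, einc_mk] at h1
      have h2 : bd ends (B.erase e) u = 0 := by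
        by_contra hne
        obtain ⟨f, hf, huf⟩ := mem_support.1 (support_bd hne)
        have : f ∈ A := by
          have := hB (mem_of_mem_erase hf)
          rcases mem_insert.1 this with rfl | h
          · simp at hf
          · exact h
        exact hu (hp.ends_mem f this u huf)
      have h3 := congrFun h1 u
      have : u ≠ w := fun h => hu (h ▸ hp.start_mem)
      simp [h2, del, this] at h3
    apply ih B _ h0
    intro f hf
    rcases mem_insert.1 (hB hf) with rfl | h
    · exact absurd hf heB
    · exact h

lemma sub_full {u v : V} {A : Finset E} {S : Finset V} (h : Pth ends u v A S) {B : Finset E}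
    (hB : B ⊆ A) (hb : bd ends B = del u v) : B = A := by
  have := h.sub_even (A \ B) sdiff_subset (by rw [bd_sdiff ends hB, h.bd_eq, hb, f2])
  exact Finset.Subset.antisymm hB (Finset.sdiff_eq_empty_iff_subset.1 this)

lemma deg {u v : V} {A : Finset E} {S : Finset V} (h : Pth ends u v A S) :
    ∀ x ∈ S, degree ends A x + (if x = u then 1 else 0) + (if x = v then 1 else 0) = 2 := by
  induction h with
  | nil v => intro x hx; rw [mem_singleton] at hx; subst hx; simp [degree]
  | @cons u w v e A S he hu hp ih =>
    intro x hx
    have huw : u ≠ w := fun h => hu (h ▸ hp.start_mem)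
    have huv : u ≠ v := fun h => hu (h ▸ hp.end_mem)
    have hdeg : degree ends (insert e A) x = (if x = u then 1 else 0) + (if x = w then 1 else 0)
        + degree ends A x := by
      unfold degree
      rw [Finset.sum_insert (fresh he hu hp), he]
      congr 1
      simp only [Sym2.diag, Sym2.eq_iff, Sym2.mem_iff]
      by_cases h1 : x = u
      · subst h1; simp [huw]; exact fun h => huw h.symm
      · by_cases h2 : x = w
        · subst h2; simp [h1, huw]
        · simp [h1, h2]; exact fun h => absurd h.symm h1
    rcases mem_insert.1 hx with rfl | hxS
    · have : degree ends A x = 0 := by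
        unfold degree
        apply Finset.sum_eq_zero
        intro f hf
        have : x ∉ ends f := fun h => hu (hp.ends_mem f hf x h)
        have h2 : ends f ≠ Sym2.diag x := fun h => this (by rw [h]; simp [Sym2.diag])
        simp [this, h2]
      rw [hdeg, this]; simp [huw, huv]
    · have hxu : x ≠ u := fun h => hu (h ▸ hxS)
      have := ih x hxS
      rw [hdeg]
      simp only [hxu, if_false]
      omega

lemma isPath {u v : V} {A : Finset E} {S : Finset V} (h : Pth ends u v A S) (huv : u ≠ v) :
    IsPath ends A u v := by
  have hne := h.nonempty_of_ne huv
  have hs := h.supp_eq hne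
  refine ⟨hne, ?_, huv, hs ▸ h.start_mem, hs ▸ h.end_mem, ?_, ?_, ?_⟩
  · intro x hx y hy
    rw [hs] at hx hy
    exact (h.reach x hx).sy.tr (h.reach y hy)
  · have := h.deg u h.start_mem; simp [huv] at this; exact this
  · have := h.deg v h.end_mem; simp [huv.symm] at this; exact this
  · intro w hw h1 h2
    rw [hs] at hw
    have := h.deg w hw; simp [h1, h2] at this; exact this

end Pth


/-! circuits as minimal even sets -/
def Cyc (ends : E → Sym2 V) (C : Finset E) : Prop :=
  C.Nonempty ∧ bd ends C = 0 ∧ ∀ B ⊆ C, B.Nonempty → bd ends B = 0 → B = C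

def UC (ends : E → Sym2 V) (sgn : E → Bool) (C : Finset E) : Prop := Cyc ends C ∧ ng sgn C = 1

section
variable {ends : E → Sym2 V} {sgn : E → Bool}

lemma cyc_through {A : Finset E} (hA : bd ends A = 0) {e : E} (he : e ∈ A) :
    ∃ C ⊆ A, Cyc ends C ∧ e ∈ C := by
  induction h : A.card using Nat.strong_induction_on generalizing A with
  | _ n ih =>
    subst h
    by_cases hc : Cyc ends A
    · exact ⟨A, Finset.Subset.refl _, hc, he⟩
    · unfold Cyc at hc
      push Not at hc
      obtain ⟨B, hB, hBn, hb, hne⟩ := hc ⟨e, he⟩ hA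
      have hlt : B ⊂ A := lt_of_le_of_ne hB hne
      by_cases heB : e ∈ B
      · obtain ⟨C, hC, h1, h2⟩ := ih _ (card_lt_card hlt) hb heB rfl
        exact ⟨C, hC.trans hB, h1, h2⟩
      · have h3 : (A \ B).card < A.card := by
          apply card_lt_card
          refine ⟨sdiff_subset, fun h => ?_⟩
          obtain ⟨f, hf⟩ := hBn
          exact (mem_sdiff.1 (h (hB hf))).2 hf
        obtain ⟨C, hC, h1, h2⟩ := ih _ h3 (A := A \ B) (by rw [bd_sdiff ends hB, hA, hb, add_zero])
          (mem_sdiff.2 ⟨he, heB⟩) rfl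
        exact ⟨C, hC.trans sdiff_subset, h1, h2⟩

lemma uc_exists {A : Finset E} (hA : bd ends A = 0) (hn : ng sgn A = 1) :
    ∃ C ⊆ A, UC ends sgn C := by
  induction h : A.card using Nat.strong_induction_on generalizing A with
  | _ n ih =>
    subst h
    have hne : A.Nonempty := by
      rw [Finset.nonempty_iff_ne_empty]; rintro rfl; simp at hn
    obtain ⟨e, he⟩ := hne
    obtain ⟨C, hC, h1, h2⟩ := cyc_through hA he
    rcases z2c (ng sgn C) with h0 | h0
    · have h3 : (A \ C).card < A.card := by
        apply card_lt_card
        exact ⟨sdiff_subset, fun h => (mem_sdiff.1 (h he)).2 h2⟩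
      obtain ⟨C', hC', h4⟩ := ih _ h3 (A := A \ C) (by rw [bd_sdiff ends hC, hA, h1.2.1, add_zero])
        (by rw [ng_sdiff sgn hC, hn, h0, add_zero]) rfl
      exact ⟨C', hC'.trans sdiff_subset, h4⟩
    · exact ⟨C, hC, h1, h0⟩

lemma cyc_loop {e : E} {a : V} (h : ends e = s(a, a)) : Cyc ends {e} := by
  refine ⟨by simp, by rw [bd_single, h]; simp, ?_⟩
  intro B hB hn _
  exact (Finset.subset_singleton_iff.1 hB).resolve_left hn.ne_empty

lemma Cyc.loop {C : Finset E} (hC : Cyc ends C) {e : E} (he : e ∈ C) {a : V}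
    (h : ends e = s(a, a)) : C = {e} :=
  (hC.2.2 {e} (by simpa using he) (by simp) (cyc_loop h).2.1).symm

lemma cyc_of_pth {e : E} {u v : V} {A : Finset E} {S : Finset V} (he : ends e = s(u, v))
    (h : Pth ends u v A S) (heA : e ∉ A) : Cyc ends (insert e A) := by
  refine ⟨by simp, by rw [bd_insert ends heA, he, einc_mk, h.bd_eq, f2], ?_⟩
  intro B hB hn hb
  have heB : e ∈ B := by
    by_contra heB
    have : B ⊆ A := fun f hf => (mem_insert.1 (hB hf)).resolve_left (fun h => heB (h ▸ hf))
    exact hn.ne_empty (h.sub_even B this hb)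
  have h1 : B.erase e ⊆ A := fun f hf =>
    (mem_insert.1 (hB (mem_of_mem_erase hf))).resolve_left (ne_of_mem_erase hf)
  have h2 : bd ends (B.erase e) = del u v := by
    have h3 := bd_insert ends (notMem_erase e B)
    rw [insert_erase heB, hb, he, einc_mk] at h3
    calc bd ends (B.erase e) = (del u v + del u v) + bd ends (B.erase e) := by rw [f2, zero_add]
      _ = del u v + (del u v + bd ends (B.erase e)) := by abel
      _ = _ := by rw [← h3, add_zero]
  rw [← h.sub_full h1 h2, insert_erase heB]

lemma Cyc.path {C : Finset E} (hC : Cyc ends C) {e : E} (he : e ∈ C) {u v : V}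
    (h : ends e = s(u, v)) : Pth ends u v (C.erase e) (support ends C) := by
  obtain ⟨A, S, hA, hP⟩ := Pth.of_reach (reach_even_erase hC.2.1 he h)
  have heA : e ∉ A := fun h => by simpa using hA h
  have h1 : insert e A = C := hC.2.2 _ (insert_subset he (hA.trans (erase_subset _ _)))
    (by simp) (cyc_of_pth h hP heA).2.1
  have h2 : C.erase e = A := by rw [← h1, Finset.erase_insert heA]
  have h3 : support ends C = S := by
    rw [hP.subset_supp, ← h1]
    ext x
    simp only [mem_support, mem_insert]
    constructor
    · rintro ⟨f, rfl | hf, hx⟩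
      · rw [h, Sym2.mem_iff] at hx
        rcases hx with rfl | rfl
        · exact Or.inl rfl
        · by_cases hxu : x = u
          · exact Or.inl hxu
          · right
            have := hP.end_mem
            rw [hP.subset_supp, mem_insert, mem_support] at this
            exact this.resolve_left hxu
      · exact Or.inr ⟨f, hf, hx⟩
    · rintro (rfl | ⟨f, hf, hx⟩)
      · exact ⟨e, Or.inl rfl, by rw [h]; simp⟩
      · exact ⟨f, Or.inr hf, hx⟩
  rw [h2, h3]; exact hP

lemma Cyc.reach {C : Finset E} (hC : Cyc ends C) {u v : V} (hu : u ∈ support ends C)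
    (hv : v ∈ support ends C) : Reach ends C u v := by
  obtain ⟨e, he⟩ := hC.1
  induction h : ends e with
  | _ a b =>
    have := hC.path he h
    exact ((this.reach u hu).sy.tr (this.reach v hv)).mono (erase_subset _ _)

lemma Cyc.isCircuit {C : Finset E} (hC : Cyc ends C) : IsCircuit ends C := by
  refine ⟨hC.1, fun u hu v hv => hC.reach hu hv, ?_⟩
  obtain ⟨e, he⟩ := hC.1
  induction h : ends e with
  | _ a b =>
    have hP := hC.path he h
    intro x hx
    have h1 := hP.deg x hx
    have h2 : degree ends C x = (if x = a then 1 else 0) + (if x = b then 1 else 0)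
        + degree ends (C.erase e) x := by
      conv_lhs => rw [← insert_erase he]
      unfold degree
      rw [Finset.sum_insert (notMem_erase _ _), h]
      congr 1
      simp only [Sym2.diag, Sym2.eq_iff, Sym2.mem_iff]
      clear h1
      by_cases q1 : x = a
      · by_cases q2 : x = b
        · subst q1; subst q2; simp
        · subst q1; simp [q2]; exact fun h => absurd h.symm q2
      · by_cases q2 : x = b
        · have q3 : ¬ a = x := fun h => q1 h.symm
          subst q2; simp [q1, q3]
        · simp [q1, q2]; exact fun h => absurd h.symm q1
    omega

lemma two_paths {x y : V} {A B : Finset E} {S T : Finset V} (hA : Pth ends x y A S)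
    (hB : Pth ends x y B T) (hxy : x ≠ y) (hd : Disjoint A B)
    (hS : ∀ z ∈ S, z ∈ T → z = x ∨ z = y) : Cyc ends (A ∪ B) := by
  cases hA with
  | nil => exact absurd rfl hxy
  | @cons _ w _ e A S he hu hp =>
    have h1 := hp.concat hB.reverse (by
      intro z hz hzT
      rcases hS z (mem_insert_of_mem hz) hzT with rfl | rfl
      · exact absurd hz hu
      · rfl)
    rw [Finset.disjoint_insert_left] at hd
    have h2 := cyc_of_pth he h1.reverse (by
      rw [mem_union, not_or]; exact ⟨Pth.fresh he hu hp, hd.1⟩)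
    rw [Finset.insert_union]; exact h2

lemma Cyc.arcs {C : Finset E} (hC : Cyc ends C) {x y : V} (hx : x ∈ support ends C)
    (hy : y ∈ support ends C) (hxy : x ≠ y) :
    ∃ A S B T, Pth ends x y A S ∧ Pth ends x y B T ∧ Disjoint A B ∧ C = A ∪ B ∧
      (∀ z ∈ S, z ∈ T → z = x ∨ z = y) ∧ support ends C = S ∪ T := by
  obtain ⟨e, he, hxe⟩ := mem_support.1 hx
  obtain ⟨v, hv⟩ := Sym2.mem_iff_exists.1 hxe
  have hP := hC.path he hv
  obtain ⟨A1, S1, A2, S2, h1, h2, h3, h4, h5, h6⟩ := hP.split hy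
  have hxS2 : x ∉ S2 := fun h => hxy (h6 x h1.start_mem h)
  have h7 := Pth.cons hv hxS2 h2.reverse
  refine ⟨A1, S1, _, _, h1, h7, ?_, ?_, ?_, ?_⟩
  · rw [Finset.disjoint_insert_right]
    refine ⟨fun h => ?_, h4⟩
    have : e ∈ C.erase e := by rw [h3]; exact mem_union_left _ h
    simp at this
  · rw [Finset.union_insert, ← h3, insert_erase he]
  · intro z hz hz'
    rcases mem_insert.1 hz' with rfl | hz'
    · exact Or.inl rfl
    · exact Or.inr (h6 z hz hz')
  · rw [h5, Finset.union_insert, Finset.insert_eq_self.2]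
    exact mem_union_left _ h1.start_mem

/-- decompositions into circuits -/
def IsDec (ends : E → Sym2 V) (A : Finset E) (P : Finset (Finset E)) : Prop :=
  (∀ C ∈ P, Cyc ends C) ∧ (∀ C ∈ P, ∀ C' ∈ P, C ≠ C' → Disjoint C C') ∧ P.biUnion id = A

lemma dec_exists {A : Finset E} (hA : bd ends A = 0) : ∃ P, IsDec ends A P := by
  induction h : A.card using Nat.strong_induction_on generalizing A with
  | _ n ih =>
    subst h
    by_cases hne : A = ∅
    · subst hne; exact ⟨∅, by simp [IsDec]⟩
    · obtain ⟨e, he⟩ := Finset.nonempty_iff_ne_empty.2 hne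
      obtain ⟨C, hC, h1, h2⟩ := cyc_through hA he
      have h3 : (A \ C).card < A.card := by
        apply card_lt_card
        exact ⟨sdiff_subset, fun h => (mem_sdiff.1 (h he)).2 h2⟩
      obtain ⟨P, hP1, hP2, hP3⟩ := ih _ h3 (A := A \ C)
        (by rw [bd_sdiff ends hC, hA, h1.2.1, add_zero]) rfl
      have hd : ∀ C' ∈ P, Disjoint C C' := by
        intro C' hC'
        have : C' ⊆ A \ C := by rw [← hP3]; exact subset_biUnion_of_mem id hC'
        exact (disjoint_of_subset_left this Finset.sdiff_disjoint).symm
      refine ⟨insert C P, ?_, ?_, ?_⟩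
      · intro C' hC'
        rcases mem_insert.1 hC' with rfl | h
        · exact h1
        · exact hP1 _ h
      · intro C1 hC1 C2 hC2 hne
        rcases mem_insert.1 hC1 with rfl | h <;> rcases mem_insert.1 hC2 with rfl | h'
        · exact absurd rfl hne
        · exact hd _ h'
        · exact (hd _ h).symm
        · exact hP2 _ h _ h' hne
      · rw [Finset.biUnion_insert, hP3]
        exact Finset.union_sdiff_of_subset hC

/-- chords -/
def Chord (ends : E → Sym2 V) (D Q : Finset E) : Prop :=
  ∃ x y S, Pth ends x y Q S ∧ x ≠ y ∧ x ∈ support ends D ∧ y ∈ support ends D ∧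
    (∀ z ∈ S, z ∈ support ends D → z = x ∨ z = y) ∧ Disjoint Q D

lemma Chord.even_side {D Q : Finset E} (hQ : Chord ends D Q) (hD : UC ends sgn D) :
    ∃ I ⊆ D, bd ends I = bd ends Q ∧ ng sgn I = ng sgn Q ∧ Cyc ends (Q ∪ I) ∧
      ng sgn (Q ∪ I) = 0 ∧ ∃ x y T, Pth ends x y (D \ I) T := by
  obtain ⟨x, y, S, hP, hxy, hx, hy, hS, hdis⟩ := hQ
  have key : ∀ A T B T', Pth ends x y A T → Pth ends x y B T' → Disjoint A B → D = A ∪ B →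
      support ends D = T ∪ T' → ng sgn A = ng sgn Q →
      ∃ I ⊆ D, bd ends I = bd ends Q ∧ ng sgn I = ng sgn Q ∧ Cyc ends (Q ∪ I) ∧
      ng sgn (Q ∪ I) = 0 ∧ ∃ x y T, Pth ends x y (D \ I) T := by
    intro A T B T' h1 h2 h3 h4 h5 h6
    have hAD : A ⊆ D := by rw [h4]; exact subset_union_left
    have hQA : Disjoint Q A := Finset.disjoint_of_subset_right hAD hdis
    refine ⟨A, hAD, by rw [h1.bd_eq, hP.bd_eq], h6,
      two_paths hP h1 hxy hQA ?_, by rw [ng_union sgn hQA, h6, z2], x, y, T', ?_⟩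
    · intro z hz hzT
      exact hS z hz (by rw [h5]; exact mem_union_left _ hzT)
    · have : D \ A = B := by
        rw [h4, Finset.union_sdiff_left, Finset.sdiff_eq_self_of_disjoint h3.symm]
      rw [this]; exact h2
  obtain ⟨A, T, B, T', h1, h2, h3, h4, _, h5⟩ := hD.1.arcs hx hy hxy
  have hs : ng sgn A + ng sgn B = 1 := by rw [← ng_union sgn h3, ← h4]; exact hD.2
  by_cases hn : ng sgn A = ng sgn Q
  · exact key A T B T' h1 h2 h3 h4 h5 hn
  · refine key B T' A T h2 h1 h3.symm (by rw [h4, Finset.union_comm])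
      (by rw [h5, Finset.union_comm]) ?_
    have q : ∀ a b q : ZMod 2, a + b = 1 → a ≠ q → b = q := by decide
    exact q _ _ _ hs hn

lemma chords {D : Finset E} {u v : V} {A : Finset E} {S : Finset V} (h : Pth ends u v A S)
    (hu : u ∈ support ends D) (hv : v ∈ support ends D) (hd : Disjoint A D) :
    ∃ L : List (Finset E), (∀ Q ∈ L, Chord ends D Q ∧ Q ⊆ A) ∧ (L.map Finset.card).sum = A.card ∧
      (L.map (bd ends)).sum = bd ends A ∧ (L.map (ng sgn)).sum = ng sgn A := by
  induction hn : A.card using Nat.strong_induction_on generalizing A u S with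
  | _ n ih =>
    subst hn
    by_cases huv : u = v
    · subst huv
      obtain ⟨rfl, rfl⟩ := h.nil_of
      exact ⟨[], by simp⟩
    · obtain ⟨x, A1, S1, A2, S2, h1, h2, ⟨hx, hxu⟩, h4, rfl, h6, rfl, h8⟩ :=
        h.first_hit (fun z => z ∈ support ends D ∧ z ≠ u) ⟨v, h.end_mem, hv, fun h => huv h.symm⟩
      have hne := h1.nonempty_of_ne hxu.symm
      have hc := card_union_of_disjoint h6
      have hpos := hne.card_pos
      rw [Finset.disjoint_union_left] at hd
      obtain ⟨L, hL1, hL2, hL3, hL4⟩ := ih A2.card (by omega) h2 hx hd.2 rfl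
      refine ⟨A1 :: L, ?_, ?_, ?_, ?_⟩
      · intro Q hQ
        rcases List.mem_cons.1 hQ with rfl | hQ
        · refine ⟨⟨u, x, S1, h1, hxu.symm, hu, hx, ?_, hd.1⟩, subset_union_left⟩
          intro z hz hzD
          by_cases hzu : z = u
          · exact Or.inl hzu
          · exact Or.inr (h4 z hz ⟨hzD, hzu⟩)
        · exact ⟨(hL1 Q hQ).1, (hL1 Q hQ).2.trans subset_union_right⟩
      · simp [hL2, hc]
      · simp [hL3, bd_union ends h6]
      · simp [hL4, ng_union sgn h6]

/-- two edge-disjoint unbalanced circuits with two common vertices span a balanced one -/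
lemma theta {D D' : Finset E} (hD : UC ends sgn D) (hD' : UC ends sgn D') (hd : Disjoint D D')
    {x y : V} (hxy : x ≠ y) (hx : x ∈ support ends D) (hy : y ∈ support ends D)
    (hx' : x ∈ support ends D') (hy' : y ∈ support ends D') :
    ∃ B ⊆ D ∪ D', Cyc ends B ∧ ng sgn B = 0 := by
  obtain ⟨A, S, B, T, h1, h2, h3, h4, _, h5⟩ := hD'.1.arcs hx' hy' hxy
  have hA : A ⊆ D' := by rw [h4]; exact subset_union_left
  obtain ⟨L, hL1, hL2, hL3, hL4⟩ := chords (sgn := sgn) h1 hx hy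
    (disjoint_of_subset_left hA hd.symm)
  cases L with
  | nil =>
    simp at hL2
    have := (h1.nonempty_of_ne hxy).card_pos
    simp [← hL2] at this
  | cons Q L =>
    obtain ⟨hQ, hQA⟩ := hL1 Q (by simp)
    obtain ⟨I, hI, _, _, hc, hn, _⟩ := hQ.even_side hD
    refine ⟨Q ∪ I, ?_, hc, hn⟩
    exact union_subset ((hQA.trans hA).trans subset_union_right)
      (hI.trans subset_union_left)

end


/-! barbells -/
structure Barb (ends : E → Sym2 V) (sgn : E → Bool) (C₁ C₂ P : Finset E) (u v : V) (S : Finset V) :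
    Prop where
  c1 : UC ends sgn C₁
  c2 : UC ends sgn C₂
  dj : Disjoint C₁ C₂
  pt : Pth ends u v P S
  hu : u ∈ support ends C₁
  hv : v ∈ support ends C₂
  s1 : ∀ x ∈ S, x ∈ support ends C₁ → x = u
  s2 : ∀ x ∈ S, x ∈ support ends C₂ → x = v
  s3 : ∀ x ∈ support ends C₁, x ∈ support ends C₂ → x = u ∧ x = v

def SC (ends : E → Sym2 V) (sgn : E → Bool) (F : Finset E) : Prop :=
  (Cyc ends F ∧ ng sgn F = 0) ∨
    ∃ C₁ C₂ P u v S, Barb ends sgn C₁ C₂ P u v S ∧ F = C₁ ∪ C₂ ∪ P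

section
variable {ends : E → Sym2 V} {sgn : E → Bool}

lemma ng_single {b : E} (hn : sgn b = true) : ng sgn {b} = 1 := by
  unfold ng; rw [Finset.sum_singleton, if_pos hn]

lemma UC.isU {C : Finset E} (h : UC ends sgn C) : IsUnbalancedCircuit ends sgn C :=
  ⟨h.1.isCircuit, (ng_odd sgn C).1 h.2⟩

lemma Pth.dj_of {u v : V} {P C : Finset E} {S : Finset V} (h : Pth ends u v P S) {w : V}
    (hs : ∀ x ∈ S, x ∈ support ends C → x = w) : Disjoint C P := by
  rw [Finset.disjoint_left]
  intro e he heP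
  induction hab : ends e with
  | _ a b =>
    have h1 := hs a (h.ends_mem e heP a (by simp [hab])) (mem_support.2 ⟨e, he, by simp [hab]⟩)
    have h2 := hs b (h.ends_mem e heP b (by simp [hab])) (mem_support.2 ⟨e, he, by simp [hab]⟩)
    exact h.notloop e heP a b hab (h1.trans h2.symm)

lemma Barb.isSigned {C₁ C₂ P : Finset E} {u v : V} {S : Finset V}
    (h : Barb ends sgn C₁ C₂ P u v S) : IsSignedCircuit ends sgn (C₁ ∪ C₂ ∪ P) := by
  by_cases huv : u = v
  · obtain rfl := huv
    obtain ⟨rfl, rfl⟩ := h.pt.nil_of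
    refine Or.inr (Or.inl ⟨C₁, C₂, h.dj, by simp, h.c1.isU, h.c2.isU, u, ?_⟩)
    ext x
    simp only [mem_inter, mem_singleton]
    exact ⟨fun hx => (h.s3 x hx.1 hx.2).1, fun hx => by rw [hx]; exact ⟨h.hu, h.hv⟩⟩
  · refine Or.inr (Or.inr ⟨C₁, C₂, P, u, v, h.dj, h.pt.dj_of h.s1, h.pt.dj_of h.s2, rfl, h.c1.isU,
      h.c2.isU, ?_, h.pt.isPath huv, ?_, ?_⟩)
    · rw [Finset.disjoint_left]
      intro x hx hx'
      obtain ⟨a, b⟩ := h.s3 x hx hx'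
      exact huv (a.symm.trans b)
    · rw [h.pt.supp_eq (h.pt.nonempty_of_ne huv)]
      ext x
      simp only [mem_inter, mem_singleton]
      exact ⟨fun hx => h.s1 x hx.1 hx.2, fun hx => by rw [hx]; exact ⟨h.pt.start_mem, h.hu⟩⟩
    · rw [h.pt.supp_eq (h.pt.nonempty_of_ne huv)]
      ext x
      simp only [mem_inter, mem_singleton]
      exact ⟨fun hx => h.s2 x hx.1 hx.2, fun hx => by rw [hx]; exact ⟨h.pt.end_mem, h.hv⟩⟩

lemma SC.isSigned {F : Finset E} (h : SC ends sgn F) : IsSignedCircuit ends sgn F := by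
  rcases h with ⟨h, h0⟩ | ⟨C₁, C₂, P, u, v, S, h, rfl⟩
  · exact Or.inl ⟨h.isCircuit, (ng_even sgn F).1 h0⟩
  · exact h.isSigned

lemma Barb.symm {C₁ C₂ P : Finset E} {u v : V} {S : Finset V}
    (h : Barb ends sgn C₁ C₂ P u v S) : Barb ends sgn C₂ C₁ P v u S :=
  ⟨h.c2, h.c1, h.dj.symm, h.pt.reverse, h.hv, h.hu, h.s2, h.s1,
    fun x hx hx' => (h.s3 x hx' hx).symm⟩

lemma BB {O₁ O₂ K : Finset E} (h1 : UC ends sgn O₁) (h2 : UC ends sgn O₂) (hd : Disjoint O₁ O₂)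
    (hs : ∀ x y, x ∈ support ends O₁ → x ∈ support ends O₂ → y ∈ support ends O₁ →
      y ∈ support ends O₂ → x = y) {a b : V} (ha : a ∈ support ends O₁) (hb : b ∈ support ends O₂)
    (hK : Reach ends K a b) : ∃ F, SC ends sgn F ∧ O₁ ∪ O₂ ⊆ F ∧ F ⊆ O₁ ∪ O₂ ∪ K := by
  by_cases hx : ∃ x, x ∈ support ends O₁ ∧ x ∈ support ends O₂
  · obtain ⟨x, hx1, hx2⟩ := hx
    refine ⟨O₁ ∪ O₂ ∪ ∅, Or.inr ⟨O₁, O₂, ∅, x, x, {x}, ⟨h1, h2, hd, Pth.nil x, hx1, hx2, ?_, ?_, ?_⟩,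
      rfl⟩, by simp, by rw [Finset.union_empty]; exact subset_union_left⟩
    · intro y hy _; simpa using hy
    · intro y hy _; simpa using hy
    · intro y hy hy'
      have := hs y x hy hy' hx1 hx2
      exact ⟨this, this⟩
  · push Not at hx
    obtain ⟨A, S, hA, hP⟩ := Pth.of_reach hK
    obtain ⟨u, A1, S1, A2, S2, p1, p2, p3, p4, rfl, p6, rfl, p8⟩ :=
      hP.reverse.first_hit (fun z => z ∈ support ends O₁) ⟨a, hP.start_mem, ha⟩
    obtain ⟨v, B1, T1, B2, T2, q1, q2, q3, q4, rfl, q6, rfl, q8⟩ :=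
      p1.reverse.first_hit (fun z => z ∈ support ends O₂) ⟨b, p1.start_mem, hb⟩
    refine ⟨O₁ ∪ O₂ ∪ B1, Or.inr ⟨O₁, O₂, B1, u, v, T1, ⟨h1, h2, hd, q1, p3, q3, ?_, q4, ?_⟩, rfl⟩,
      subset_union_left, ?_⟩
    · intro x hx; exact p4 x (mem_union_left _ hx)
    · intro x hx1 hx2; exact absurd hx2 (hx x hx1)
    · apply Finset.union_subset_union_right
      exact (Finset.subset_union_left.trans subset_union_left).trans hA

/-- a signed circuit through an unbalanced loop is a barbell at that loop -/
lemma SC.at_loop {F : Finset E} (h : SC ends sgn F) {b : E} (hb : b ∈ F) {a : V}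
    (hl : ends b = s(a, a)) (hn : sgn b = true) :
    ∃ C P v S, Barb ends sgn {b} C P a v S ∧ F = {b} ∪ C ∪ P := by
  have hsup : support ends {b} = {a} := by
    ext x; simp [mem_support, hl]
  rcases h with ⟨h, h0⟩ | ⟨C₁, C₂, P, u, v, S, h, rfl⟩
  · rw [h.loop hb hl] at h0
    rw [ng_single hn] at h0; exact absurd h0 (by decide)
  · rw [mem_union, mem_union] at hb
    rcases hb with (hb | hb) | hb
    · obtain rfl := h.c1.1.loop hb hl
      have := h.hu
      rw [hsup, mem_singleton] at this
      subst this
      exact ⟨C₂, P, v, S, h, rfl⟩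
    · obtain rfl := h.c2.1.loop hb hl
      have := h.hv
      rw [hsup, mem_singleton] at this
      subst this
      exact ⟨C₁, P, u, S, h.symm, by rw [Finset.union_comm C₁]⟩
    · exact absurd rfl (h.pt.notloop b hb a a hl)

lemma supp_loop {b : E} {a : V} (hl : ends b = s(a, a)) : support ends {b} = {a} := by
  ext x; simp [mem_support, hl]

end

/-! links -/
section
variable {ι : Type} [DecidableEq ι] {ends : E → Sym2 V}

def cnt {α : Type} (L : List (ι × ι × α)) (i : ι) : ℕ :=
  (L.map (fun p => (if p.1 = i then 1 else 0) + (if p.2.1 = i then 1 else 0))).sum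

def siz (L : List (ι × ι × Finset E)) : ℕ := (L.map (fun p => p.2.2.card)).sum

def Good (ends : E → Sym2 V) (H : Finset E) (t : ι → V) (L : List (ι × ι × Finset E)) : Prop :=
  ∀ p ∈ L, p.1 ≠ p.2.1 ∧ p.2.2 ⊆ H ∧ Reach ends p.2.2 (t p.1) (t p.2.1)

lemma cnt_app {α : Type} (L L' : List (ι × ι × α)) (i : ι) : cnt (L ++ L') i = cnt L i + cnt L' i := by
  simp [cnt]

lemma siz_app (L L' : List (ι × ι × Finset E)) : siz (L ++ L') = siz L + siz L' := by
  simp [siz]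

lemma Good.app {H : Finset E} {t : ι → V} {L L' : List (ι × ι × Finset E)} (h : Good ends H t L)
    (h' : Good ends H t L') : Good ends H t (L ++ L') := by
  intro p hp
  rcases List.mem_append.1 hp with hp | hp
  · exact h p hp
  · exact h' p hp

lemma Good.mono {H H' : Finset E} {t : ι → V} {L : List (ι × ι × Finset E)} (h : Good ends H t L)
    (hH : H ⊆ H') : Good ends H' t L := fun p hp => ⟨(h p hp).1, (h p hp).2.1.trans hH, (h p hp).2.2⟩

lemma cnt_pos {α : Type} {L : List (ι × ι × α)} {p} (hp : p ∈ L) : 0 < cnt L p.1 ∧ 0 < cnt L p.2.1 := by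
  unfold cnt
  constructor
  · refine lt_of_lt_of_le ?_ (List.le_sum_of_mem (List.mem_map_of_mem hp)); simp
  · refine lt_of_lt_of_le ?_ (List.le_sum_of_mem (List.mem_map_of_mem hp)); simp

lemma cnt_mem {L : List (ι × ι × Finset E)} {i : ι} (h : 0 < cnt L i) :
    ∃ p ∈ L, p.1 = i ∨ p.2.1 = i := by
  by_contra hc
  push Not at hc
  have : cnt L i = 0 := by
    unfold cnt
    rw [List.sum_eq_zero]
    intro x hx
    obtain ⟨p, hp, rfl⟩ := List.mem_map.1 hx
    simp [hc p hp]
  omega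

lemma bdS_erase (S : Finset ι) (t : ι → V) {i j : ι} (hi : i ∈ S) (hj : j ∈ S) (hij : j ≠ i) :
    (∑ k ∈ S, Pi.single (t k) (1 : ZMod 2) : V → ZMod 2) =
      del (t i) (t j) + ∑ k ∈ (S.erase i).erase j, Pi.single (t k) 1 := by
  rw [← Finset.add_sum_erase S _ hi, ← Finset.add_sum_erase (S.erase i) _
    (mem_erase.2 ⟨hij, hj⟩), del, add_assoc]

lemma tj_links (t : ι → V) (S : Finset ι) (J : Finset E)
    (hb : bd ends J = ∑ i ∈ S, Pi.single (t i) 1) :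
    ∃ L, Good ends J t L ∧ (∀ i, cnt L i = if i ∈ S then 1 else 0) ∧ siz L ≤ J.card := by
  induction h : S.card using Nat.strong_induction_on generalizing S J with
  | _ n ih =>
    subst h
    rcases S.eq_empty_or_nonempty with rfl | ⟨i, hi⟩
    · exact ⟨[], by simp [Good], by simp [cnt], by simp [siz]⟩
    · obtain ⟨j, hj, hij, hr⟩ := pair_exists S t hb hi
      obtain ⟨A, T, hA, hP⟩ := Pth.of_reach hr
      have hj' : j ∈ S.erase i := mem_erase.2 ⟨hij, hj⟩
      have hb' : bd ends (J \ A) = ∑ k ∈ (S.erase i).erase j, Pi.single (t k) 1 := by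
        rw [bd_sdiff ends hA, hP.bd_eq, hb, bdS_erase S t hi hj hij, add_comm, ← add_assoc, f2,
          zero_add]
      have hc : ((S.erase i).erase j).card < S.card :=
        (Finset.card_erase_lt_of_mem hj').trans (Finset.card_erase_lt_of_mem hi)
      obtain ⟨L, h1, h2, h3⟩ := ih _ hc _ _ hb' rfl
      refine ⟨(i, j, A) :: L, ?_, ?_, ?_⟩
      · intro p hp
        rcases List.mem_cons.1 hp with rfl | hp
        · exact ⟨hij.symm, hA, hP.reach _ hP.end_mem⟩
        · exact h1.mono sdiff_subset p hp
      · intro k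
        have := h2 k
        unfold cnt at this ⊢
        rw [List.map_cons, List.sum_cons, this]
        by_cases hki : i = k
        · subst hki; simp [hi, hij]
        · by_cases hkj : j = k
          · subst hkj; simp [hj, hki]
          · have e1 : ¬ k = i := fun h => hki h.symm
            have e2 : ¬ k = j := fun h => hkj h.symm
            simp [hki, hkj, e1, e2, mem_erase]
      · unfold siz at h3 ⊢
        rw [List.map_cons, List.sum_cons]
        have := card_sdiff_add_card_eq_card hA
        show A.card + _ ≤ _
        omega

lemma tj_flip {H U J : Finset E} (hU : U ⊆ H) (hUb : bd ends U = 0) (hJ : J ⊆ H) :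
    ∃ J' ⊆ H, bd ends J' = bd ends J ∧ 2 * J'.card + U.card ≤ 2 * H.card := by
  have key : ∀ J' ⊆ H, 2 * (J' ∩ U).card ≤ U.card → 2 * J'.card + U.card ≤ 2 * H.card := by
    intro J' h1 h2
    have e1 := Finset.card_inter_add_card_sdiff J' U
    have e2 := card_le_card (sdiff_subset_sdiff h1 (Finset.Subset.refl U))
    have e3 := card_sdiff_add_card_eq_card hU
    omega
  by_cases h : 2 * (J ∩ U).card ≤ U.card
  · exact ⟨J, hJ, rfl, key J hJ h⟩
  · have hs : symmDiff J U ⊆ H := by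
      intro x hx
      rcases mem_symmDiff.1 hx with hx | hx
      · exact hJ hx.1
      · exact hU hx.1
    refine ⟨symmDiff J U, hs, by rw [bd_symm, hUb, add_zero], key _ hs ?_⟩
    have e1 : symmDiff J U ∩ U = U \ (J ∩ U) := by
      ext x; simp only [mem_inter, mem_symmDiff, mem_sdiff]; tauto
    have e2 := card_sdiff_add_card_eq_card (s := J ∩ U) (t := U) inter_subset_right
    rw [e1]; omega

lemma tj_exists {H : Finset E} (t : ι → V) (S : Finset ι) (hS : Even S.card)
    (hr : ∀ i ∈ S, ∀ j ∈ S, Reach ends H (t i) (t j)) :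
    ∃ J ⊆ H, bd ends J = ∑ i ∈ S, Pi.single (t i) 1 := by
  induction h : S.card using Nat.strong_induction_on generalizing S with
  | _ n ih =>
    subst h
    rcases S.eq_empty_or_nonempty with rfl | ⟨i, hi⟩
    · exact ⟨∅, by simp, by simp⟩
    · have h1 := Finset.card_erase_of_mem hi
      have hpos := Finset.card_pos.2 ⟨i, hi⟩
      obtain ⟨m, hm⟩ := hS
      obtain ⟨j, hj'⟩ : (S.erase i).Nonempty := Finset.card_pos.1 (by omega)
      have h2 := Finset.card_erase_of_mem hj'
      obtain ⟨hij, hj⟩ := mem_erase.1 hj'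
      have hsub : ∀ k ∈ (S.erase i).erase j, k ∈ S := fun k hk =>
        mem_of_mem_erase (mem_of_mem_erase hk)
      obtain ⟨J, hJ, hb⟩ := ih _ (by omega) ((S.erase i).erase j) ⟨m - 1, by omega⟩
        (fun a ha b hb => hr a (hsub a ha) b (hsub b hb)) rfl
      obtain ⟨A, T, hA, hP⟩ := Pth.of_reach (hr i hi j hj)
      refine ⟨symmDiff A J, ?_, by rw [bd_symm, hP.bd_eq, hb, ← bdS_erase S t hi hj hij]⟩
      intro x hx
      rcases mem_symmDiff.1 hx with hx | hx
      · exact hA hx.1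
      · exact hJ hx.1

lemma TJ {H U : Finset E} (hU : U ⊆ H) (hUb : bd ends U = 0) (t : ι → V) (S : Finset ι)
    (hS : Even S.card) (hr : ∀ i ∈ S, ∀ j ∈ S, Reach ends H (t i) (t j)) :
    ∃ L, Good ends H t L ∧ (∀ i, cnt L i = if i ∈ S then 1 else 0) ∧
      2 * siz L + U.card ≤ 2 * H.card := by
  obtain ⟨J0, hJ0, hb0⟩ := tj_exists t S hS hr
  obtain ⟨J, hJ, hb, hc⟩ := tj_flip hU hUb hJ0
  obtain ⟨L, h1, h2, h3⟩ := tj_links t S J (hb.trans hb0)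
  exact ⟨L, h1.mono hJ, h2, by omega⟩

end

/-! closed walks -/
inductive Wk (ends : E → Sym2 V) : V → V → List E → Finset V → Prop
  | nil (v : V) : Wk ends v v [] {v}
  | cons {u w v : V} {e : E} {l : List E} {S : Finset V} (he : ends e = s(u, w))
      (hp : Wk ends w v l S) : Wk ends u v (e :: l) (insert u S)

section
variable {ends : E → Sym2 V}

lemma Wk.start_mem {u v : V} {l : List E} {S : Finset V} (h : Wk ends u v l S) : u ∈ S := by
  cases h <;> simp

lemma Wk.ends_mem {u v : V} {l : List E} {S : Finset V} (h : Wk ends u v l S) :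
    ∀ e ∈ l, ∀ x ∈ ends e, x ∈ S := by
  induction h with
  | nil v => simp
  | @cons u w v e l S he hp ih =>
    intro f hf x hx
    rcases List.mem_cons.1 hf with rfl | hf
    · rw [he, Sym2.mem_iff] at hx
      rcases hx with rfl | rfl
      · simp
      · exact mem_insert_of_mem hp.start_mem
    · exact mem_insert_of_mem (ih f hf x hx)

lemma Wk.app {u v w : V} {l l' : List E} {S S' : Finset V} (h : Wk ends u v l S)
    (h' : Wk ends v w l' S') : Wk ends u w (l ++ l') (S ∪ S') := by
  induction h with
  | nil v => rw [List.nil_append, ← Finset.insert_eq, Finset.insert_eq_of_mem h'.start_mem]; exact h'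
  | cons he hp ih => rw [Finset.insert_union]; exact Wk.cons he (ih h')

lemma Wk.split {u v x : V} {l : List E} {S : Finset V} (h : Wk ends u v l S) (hx : x ∈ S) :
    ∃ l1 S1 l2 S2, Wk ends u x l1 S1 ∧ Wk ends x v l2 S2 ∧ l = l1 ++ l2 ∧ S = S1 ∪ S2 := by
  induction h with
  | nil v =>
    rw [mem_singleton] at hx; subst hx
    exact ⟨[], _, [], _, Wk.nil x, Wk.nil x, rfl, by simp⟩
  | @cons u w v e l S he hp ih =>
    by_cases hxS : x ∈ S
    · obtain ⟨l1, S1, l2, S2, h1, h2, h3, h4⟩ := ih hxS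
      exact ⟨_, _, l2, S2, Wk.cons he h1, h2, by rw [h3]; rfl, by rw [h4, Finset.insert_union]⟩
    · rcases mem_insert.1 hx with rfl | h
      · exact ⟨[], {x}, _, _, Wk.nil x, Wk.cons he hp, rfl, by simp⟩
      · exact absurd h hxS

lemma Wk.reach {u v : V} {l : List E} {S : Finset V} (h : Wk ends u v l S) :
    Reach ends l.toFinset u v := by
  induction h with
  | nil v => exact Reach.rfl'
  | @cons u w v e l S he hp ih =>
    rw [List.toFinset_cons]
    exact (Reach.edge (mem_insert_self _ _) he).tr (ih.mono (subset_insert _ _))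

lemma Pth.wk {u v : V} {A : Finset E} {S : Finset V} (h : Pth ends u v A S) :
    ∃ l, Wk ends u v l S ∧ l.toFinset = A ∧ l.length = A.card := by
  induction h with
  | nil v => exact ⟨[], Wk.nil v, rfl, rfl⟩
  | @cons u w v e A S he hu hp ih =>
    obtain ⟨l, h1, h2, h3⟩ := ih
    exact ⟨e :: l, Wk.cons he h1, by rw [List.toFinset_cons, h2],
      by rw [List.length_cons, card_insert_of_notMem (Pth.fresh he hu hp), h3]⟩

lemma crossing {H : Finset E} {r z : V} (h : Reach ends H r z) {T : Finset V} (hr : r ∈ T)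
    (hz : z ∉ T) : ∃ e ∈ H, ∃ x y, ends e = s(x, y) ∧ x ∈ T ∧ y ∉ T := by
  induction h with
  | refl => exact absurd hr hz
  | @tail b c _ hs ih =>
    by_cases hb : b ∈ T
    · obtain ⟨e, he, h⟩ := hs
      exact ⟨e, he, b, c, h, hb, hz⟩
    · exact ih hb

lemma cw_step {H U : Finset E} (hU : U ⊆ H) (r : V) : ∀ (n : ℕ) (l : List E) (T : Finset V),
    Wk ends r r l T → l.toFinset ⊆ H → bd ends (U \ l.toFinset) = 0 →
    l.length ≤ (l.toFinset ∩ U).card + 2 * (l.toFinset \ U).card → (H \ l.toFinset).card = n →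
    ∃ l T, Wk ends r r l T ∧ l.toFinset ⊆ H ∧ (∀ x, Reach ends H r x → x ∈ T) ∧
      l.length + U.card ≤ 2 * H.card := by
  intro n
  induction n using Nat.strong_induction_on with
  | _ n ih =>
    intro l T hw hl hb hlen hn
    by_cases hall : ∀ x, Reach ends H r x → x ∈ T
    · refine ⟨l, T, hw, hl, hall, ?_⟩
      have e1 := card_le_card (inter_subset_right (s₁ := l.toFinset) (s₂ := U))
      have e2 := card_le_card (sdiff_subset_sdiff hl (Finset.Subset.refl U))
      have e3 := card_sdiff_add_card_eq_card hU
      omega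
    · push Not at hall
      obtain ⟨z, hz, hzT⟩ := hall
      obtain ⟨e, he, x, y, hxy, hx, hy⟩ := crossing hz hw.start_mem hzT
      have hel : e ∉ l.toFinset := fun h =>
        hy (hw.ends_mem e (List.mem_toFinset.1 h) y (by rw [hxy]; simp))
      obtain ⟨l1, S1, l2, S2, w1, w2, rfl, rfl⟩ := hw.split hx
      -- general insertion
      have key : ∀ (c : List E) (S' : Finset V) (C : Finset E), Wk ends x x c S' → c.toFinset = C →
          e ∈ C → C ⊆ H → Disjoint C (l1 ++ l2).toFinset → bd ends (C ∩ U) = 0 →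
          c.length ≤ (C ∩ U).card + 2 * (C \ U).card →
          ∃ l T, Wk ends r r l T ∧ l.toFinset ⊆ H ∧ (∀ x, Reach ends H r x → x ∈ T) ∧
            l.length + U.card ≤ 2 * H.card := by
        intro c S' C hc hcC heC hCH hCd hCb hCl
        have ht : (l1 ++ (c ++ l2)).toFinset = C ∪ (l1 ++ l2).toFinset := by
          ext f; rw [← hcC]; simp only [List.toFinset_append, mem_union]; tauto
        set M := (l1 ++ l2).toFinset with hM
        refine ih (H \ (l1 ++ (c ++ l2)).toFinset).card ?_ _ _ (w1.app (hc.app w2)) ?_ ?_ ?_ rfl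
        · rw [← hn, ht]
          apply card_lt_card
          refine ⟨sdiff_subset_sdiff (Finset.Subset.refl _) subset_union_right, ?_⟩
          intro h
          have := h (mem_sdiff.2 ⟨he, hel⟩)
          exact (mem_sdiff.1 this).2 (mem_union_left _ heC)
        · rw [ht]; exact union_subset hCH hl
        · rw [ht]
          have : U \ (C ∪ M) = (U \ M) \ (C ∩ U) := by
            ext f; simp only [mem_sdiff, mem_union, mem_inter]; tauto
          rw [this, bd_sdiff, hb, hCb, add_zero]
          intro f hf
          rw [mem_inter] at hf
          exact mem_sdiff.2 ⟨hf.2, fun h => Finset.disjoint_left.1 hCd hf.1 h⟩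
        · rw [ht, Finset.union_inter_distrib_right, Finset.union_sdiff_distrib,
            card_union_of_disjoint (disjoint_of_subset_left Finset.inter_subset_left
              (Finset.disjoint_of_subset_right Finset.inter_subset_left hCd)),
            card_union_of_disjoint (disjoint_of_subset_left sdiff_subset
              (Finset.disjoint_of_subset_right sdiff_subset hCd))]
          rw [List.length_append] at hlen
          rw [List.length_append, List.length_append]
          omega
      by_cases heU : e ∈ U
      · have heM : e ∈ U \ (l1 ++ l2).toFinset := mem_sdiff.2 ⟨heU, hel⟩
        obtain ⟨A, S, hA, hP⟩ := Pth.of_reach (reach_even_erase hb heM hxy)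
        have heA : e ∉ A := fun h => by simpa using hA h
        have hA' : A ⊆ U \ (l1 ++ l2).toFinset := hA.trans (erase_subset _ _)
        obtain ⟨c, hc, hcA, hcl⟩ := hP.reverse.wk
        have hCs : insert e A ⊆ U \ (l1 ++ l2).toFinset := insert_subset heM hA'
        have hCU : insert e A ∩ U = insert e A :=
          Finset.inter_eq_left.2 (hCs.trans sdiff_subset)
        refine key (e :: c) _ (insert e A) (Wk.cons hxy hc) (by rw [List.toFinset_cons, hcA])
          (mem_insert_self _ _) ((hCs.trans sdiff_subset).trans hU)
          (disjoint_of_subset_left hCs Finset.sdiff_disjoint) ?_ ?_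
        · rw [hCU]; exact (cyc_of_pth hxy hP heA).2.1
        · rw [hCU, List.length_cons, hcl, card_insert_of_notMem heA]; omega
      · refine key [e, e] _ {e} (Wk.cons hxy (Wk.cons (by rw [hxy, Sym2.eq_swap]) (Wk.nil x)))
          (by simp) (by simp) (by simpa using he) (by simpa using hel) ?_ ?_
        · rw [Finset.singleton_inter_of_notMem heU]; simp
        · have : ({e} : Finset E) \ U = {e} := by
            ext f; simp only [mem_sdiff, mem_singleton]
            exact ⟨fun h => h.1, fun h => ⟨h, h ▸ heU⟩⟩
          rw [this]; simp

variable {ι : Type} [DecidableEq ι]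

lemma chain (Seg : V → V → List E → Finset V → Prop)
    (hsp : ∀ u v x l S, Seg u v l S → x ∈ S → ∃ l1 S1 l2 S2, Seg u x l1 S1 ∧ Seg x v l2 S2 ∧
      l = l1 ++ l2 ∧ S = S1 ∪ S2) (t : ι → V) (S : Finset ι) : ∀ (a b : ι) (l : List E) (T : Finset V),
    a ≠ b → a ∉ S → b ∉ S → Seg (t a) (t b) l T → (∀ i ∈ S, t i ∈ T) →
    ∃ L : List (ι × ι × List E), (∀ p ∈ L, p.1 ≠ p.2.1 ∧ ∃ T', Seg (t p.1) (t p.2.1) p.2.2 T') ∧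
      (∀ i, cnt L i = (if i ∈ S then 2 else 0) + (if a = i then 1 else 0) + (if b = i then 1 else 0)) ∧
      (L.map (fun p => p.2.2)).flatten = l := by
  induction h : S.card using Nat.strong_induction_on generalizing S with
  | _ n ih =>
    subst h
    intro a b l T hab ha hb hseg hT
    rcases S.eq_empty_or_nonempty with rfl | ⟨i, hi⟩
    · refine ⟨[(a, b, l)], ?_, ?_, by simp⟩
      · intro p hp
        rw [List.mem_singleton] at hp; subst hp; exact ⟨hab, T, hseg⟩
      · intro k; simp [cnt]
    · obtain ⟨l1, S1, l2, S2, h1, h2, rfl, rfl⟩ := hsp _ _ _ _ _ hseg (hT i hi)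
      have hai : a ≠ i := fun h => ha (h ▸ hi)
      have hib : i ≠ b := fun h => hb (h ▸ hi)
      set P := (S.erase i).filter (fun k => t k ∈ S1) with hP
      set Q := (S.erase i).filter (fun k => t k ∉ S1) with hQ
      have hPc : P.card < S.card := lt_of_le_of_lt (Finset.card_filter_le _ _)
        (Finset.card_erase_lt_of_mem hi)
      have hQc : Q.card < S.card := lt_of_le_of_lt (Finset.card_filter_le _ _)
        (Finset.card_erase_lt_of_mem hi)
      obtain ⟨L1, g1, g2, g3⟩ := ih _ hPc P rfl a i l1 S1 hai (by simp [P, ha]) (by simp [P]) h1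
        (fun k hk => (mem_filter.1 hk).2)
      obtain ⟨L2, g4, g5, g6⟩ := ih _ hQc Q rfl i b l2 S2 hib (by simp [Q]) (by simp [Q, hb]) h2
        (fun k hk => by
          have hk' := mem_filter.1 hk
          exact (mem_union.1 (hT k (mem_of_mem_erase hk'.1))).resolve_left hk'.2)
      refine ⟨L1 ++ L2, ?_, ?_, by rw [List.map_append, List.flatten_append, g3, g6]⟩
      · intro p hp
        rcases List.mem_append.1 hp with hp | hp
        · exact g1 p hp
        · exact g4 p hp
      · intro k
        rw [cnt_app, g2, g5]
        by_cases hki : k = i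
        · subst hki; simp [P, Q, hi]; omega
        · have : ¬ i = k := fun h => hki h.symm
          by_cases hkS : k ∈ S <;> by_cases hk1 : t k ∈ S1 <;> simp [P, Q, hki, this, hkS, hk1] <;> omega

lemma flat_len {α β : Type} (L : List β) (f : β → List α) (l : List α)
    (h : (L.map f).flatten = l) : (L.map (fun p => (f p).length)).sum = l.length := by
  rw [← h, List.length_flatten, List.map_map]; rfl

lemma EUC {H U : Finset E} (hU : U ⊆ H) (hUb : bd ends U = 0) (t : ι → V) (S : Finset ι)
    (hS : 2 ≤ S.card) (hr : ∀ i ∈ S, ∀ j ∈ S, Reach ends H (t i) (t j)) :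
    ∃ L, Good ends H t L ∧ (∀ i, cnt L i = if i ∈ S then 2 else 0) ∧
      siz L + U.card ≤ 2 * H.card := by
  obtain ⟨a, ha, b, hb, hab⟩ := Finset.one_lt_card.1 hS
  obtain ⟨l, T, hw, hl, hT, hlen⟩ := cw_step hU (t a) _ [] {t a} (Wk.nil _) (by simp)
    (by simpa using hUb) (by simp) rfl
  obtain ⟨l1, S1, l2, S2, h1, h2, rfl, rfl⟩ := hw.split (hT _ (hr a ha b hb))
  set R := (S.erase a).erase b with hR
  obtain ⟨L1, g1, g2, g3⟩ := chain (Wk ends) (fun u v x l S h hx => h.split hx) t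
    (R.filter (fun k => t k ∈ S1)) a b l1 S1 hab (by simp [R]) (by simp [R]) h1
    (fun k hk => (mem_filter.1 hk).2)
  obtain ⟨L2, g4, g5, g6⟩ := chain (Wk ends) (fun u v x l S h hx => h.split hx) t
    (R.filter (fun k => t k ∉ S1)) b a l2 S2 hab.symm (by simp [R]) (by simp [R]) h2
    (fun k hk => by
      have hk' := mem_filter.1 hk
      exact (mem_union.1 (hT _ (hr a ha k (mem_of_mem_erase
        (mem_of_mem_erase hk'.1))))).resolve_left hk'.2)
  have hfl : ((L1 ++ L2).map (fun p => p.2.2)).flatten = l1 ++ l2 := by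
    rw [List.map_append, List.flatten_append, g3, g6]
  refine ⟨(L1 ++ L2).map (fun p => (p.1, p.2.1, p.2.2.toFinset)), ?_, ?_, ?_⟩
  · intro p hp
    obtain ⟨q, hq, rfl⟩ := List.mem_map.1 hp
    have hq' : q.1 ≠ q.2.1 ∧ ∃ T', Wk ends (t q.1) (t q.2.1) q.2.2 T' := by
      rcases List.mem_append.1 hq with h | h
      · exact g1 q h
      · exact g4 q h
    obtain ⟨hne, T', hW⟩ := hq'
    refine ⟨hne, ?_, hW.reach⟩
    intro e he
    apply hl
    rw [List.mem_toFinset, ← hfl, List.mem_flatten]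
    exact ⟨q.2.2, List.mem_map.2 ⟨q, hq, rfl⟩, List.mem_toFinset.1 he⟩
  · intro i
    have : cnt ((L1 ++ L2).map (fun p => (p.1, p.2.1, p.2.2.toFinset))) i = cnt (L1 ++ L2) i := by
      unfold cnt; rw [List.map_map]; rfl
    rw [this, cnt_app, g2, g5]
    by_cases hia : a = i
    · subst hia
      simp [R, ha, hab.symm]
    · have hia' : ¬ i = a := fun h => hia h.symm
      by_cases hib : b = i
      · subst hib; simp [R, hb, hia]
      · have hib' : ¬ i = b := fun h => hib h.symm
        by_cases hiS : i ∈ S <;> by_cases hi1 : t i ∈ S1 <;> simp [R, hia, hib, hia', hib', hiS, hi1]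
  · have h3 := flat_len (L1 ++ L2) (fun p => p.2.2) _ hfl
    have h4 : siz ((L1 ++ L2).map (fun p => (p.1, p.2.1, p.2.2.toFinset))) ≤
        ((L1 ++ L2).map (fun p => p.2.2.length)).sum := by
      unfold siz
      rw [List.map_map]
      apply List.sum_le_sum
      intro p _
      exact List.toFinset_card_le _
    omega

end

/-! link systems with weights -/
def cE (ends : E → Sym2 V) (H : Finset E) (x : V) : Finset E :=
  H.filter (fun e => ∃ y ∈ ends e, Reach ends H x y)

section
variable {ends : E → Sym2 V} {ι : Type} [DecidableEq ι]

lemma cE_reach {H : Finset E} {x y : V} {e : E} (he : e ∈ cE ends H x) (hy : y ∈ ends e) :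
    Reach ends H x y := by
  obtain ⟨he, z, hz, hr⟩ := mem_filter.1 he
  exact hr.tr (Reach.mem he hz hy)

lemma reach_cE {H : Finset E} {x y : V} (h : Reach ends H x y) : Reach ends (cE ends H x) x y := by
  induction h with
  | refl => exact Reach.rfl'
  | @tail b c hb hs ih =>
    obtain ⟨e, he, h⟩ := hs
    exact ih.tr (Reach.edge (mem_filter.2 ⟨he, b, by rw [h]; simp, hb⟩) h)

lemma reach_out {H : Finset E} {x u v : V} (hn : ¬ Reach ends H x u) (h : Reach ends H u v) :
    Reach ends (H \ cE ends H x) u v := by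
  induction h with
  | refl => exact Reach.rfl'
  | @tail b c hb hs ih =>
    obtain ⟨e, he, h⟩ := hs
    refine ih.tr (Reach.edge (mem_sdiff.2 ⟨he, fun hc => hn ?_⟩) h)
    exact (cE_reach hc (by rw [h]; simp)).tr (Reach.sy hb)

lemma bd_congr {A B : Finset E} {v : V} (h : ∀ e, v ∈ ends e → (e ∈ A ↔ e ∈ B)) :
    bd ends A v = bd ends B v := by
  have key : ∀ A : Finset E, bd ends A v = bd ends (A.filter (fun e => v ∈ ends e)) v := by
    intro A
    have h1 := Finset.filter_union_filter_not_eq (fun e => v ∈ ends e) A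
    have h2 : Disjoint (A.filter (fun e => v ∈ ends e)) (A.filter (fun e => ¬ v ∈ ends e)) :=
      Finset.disjoint_filter_filter_not _ _ _
    conv_lhs => rw [← h1, bd_union ends h2]
    have : bd ends (A.filter (fun e => ¬ v ∈ ends e)) v = 0 := by
      by_contra hc
      obtain ⟨e, he, hv⟩ := mem_support.1 (support_bd hc)
      exact (mem_filter.1 he).2 hv
    rw [Pi.add_apply, this, add_zero]
  rw [key A, key B]
  have : A.filter (fun e => v ∈ ends e) = B.filter (fun e => v ∈ ends e) := by
    ext e
    simp only [mem_filter]
    constructor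
    · rintro ⟨h1, h2⟩; exact ⟨(h e h2).1 h1, h2⟩
    · rintro ⟨h1, h2⟩; exact ⟨(h e h2).2 h1, h2⟩
  rw [this]

lemma bd_cE {H U : Finset E} (hU : U ⊆ H) (hb : bd ends U = 0) (x : V) :
    bd ends (U ∩ cE ends H x) = 0 := by
  funext v
  by_cases hv : Reach ends H x v
  · rw [← congrFun hb v]
    apply bd_congr
    intro e hve
    rw [mem_inter]
    exact ⟨fun h => h.1, fun h => ⟨h, mem_filter.2 ⟨hU h, v, hve, hv⟩⟩⟩
  · by_contra hc
    obtain ⟨e, he, hve⟩ := mem_support.1 (support_bd hc)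
    exact hv (cE_reach (mem_inter.1 he).2 hve)

lemma GP {H U : Finset E} (hU : U ⊆ H) (hUb : bd ends U = 0) (t : ι → V) (S1 S2 : Finset ι)
    (hd : Disjoint S1 S2) (he : Even S1.card) (hne : S1 = ∅ → S2.card ≠ 1)
    (hr : ∀ i ∈ S1 ∪ S2, ∀ j ∈ S1 ∪ S2, Reach ends H (t i) (t j)) :
    ∃ L, Good ends H t L ∧
      (∀ i, cnt L i = (if i ∈ S1 then 1 else 0) + (if i ∈ S2 then 2 else 0)) ∧
      siz L + U.card ≤ 2 * H.card ∧
      (S1.card = 2 → Odd S2.card → ∀ p ∈ L, ¬ (p.1 ∈ S1 ∧ p.2.1 ∈ S1)) := by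
  have hUH := card_le_card hU
  have hd' : ∀ i ∈ S1, i ∉ S2 := fun i hi => Finset.disjoint_left.1 hd hi
  rcases S1.eq_empty_or_nonempty with rfl | ⟨a, ha⟩
  · have h1 := hne rfl
    by_cases h0 : S2.card = 0
    · rw [Finset.card_eq_zero] at h0; subst h0
      exact ⟨[], by simp [Good], by simp [cnt], by simp [siz]; omega, by simp⟩
    · obtain ⟨L, g1, g2, g3⟩ := EUC hU hUb t S2 (by omega) (by simpa using hr)
      exact ⟨L, g1, by simpa using g2, g3, by simp⟩
  · by_cases h2 : Even S2.card
    · obtain ⟨L, g1, g2, g3⟩ := TJ hU hUb t (S1 ∪ S2)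
        (by rw [card_union_of_disjoint hd]; exact he.add h2) hr
      obtain ⟨L', g1', g2', g3'⟩ := TJ hU hUb t S2 h2
        (fun i hi j hj => hr i (mem_union_right _ hi) j (mem_union_right _ hj))
      refine ⟨L ++ L', g1.app g1', ?_, by rw [siz_app]; omega,
        fun _ h => absurd h2 (Nat.not_even_iff_odd.2 h)⟩
      intro i
      rw [cnt_app, g2, g2']
      have := hd' i
      by_cases hi1 : i ∈ S1 <;> by_cases hi2 : i ∈ S2 <;> simp_all
    · have h2 := Nat.not_even_iff_odd.1 h2
      have hd2 : Disjoint (S1.erase a) S2 :=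
        disjoint_of_subset_left (erase_subset _ _) hd
      have hc := Finset.card_erase_add_one ha
      obtain ⟨L, g1, g2, g3⟩ := TJ hU hUb t (insert a S2)
        (by rw [card_insert_of_notMem (hd' a ha)]; exact h2.add_one)
        (fun i hi j hj => hr i (by
          rcases mem_insert.1 hi with rfl | h
          · exact mem_union_left _ ha
          · exact mem_union_right _ h) j (by
          rcases mem_insert.1 hj with rfl | h
          · exact mem_union_left _ ha
          · exact mem_union_right _ h))
      have hss : S1.erase a ∪ S2 ⊆ S1 ∪ S2 :=
        Finset.union_subset_union_left (erase_subset _ _)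
      obtain ⟨L', g1', g2', g3'⟩ := TJ hU hUb t (S1.erase a ∪ S2)
        (by
          rw [card_union_of_disjoint hd2]
          refine Odd.add_odd ?_ h2
          rw [← hc] at he
          exact (Nat.even_add_one.1 he) |> Nat.not_even_iff_odd.1)
        (fun i hi j hj => hr i (hss hi) j (hss hj))
      refine ⟨L ++ L', g1.app g1', ?_, by rw [siz_app]; omega, ?_⟩
      · intro i
        rw [cnt_app, g2, g2']
        have := hd' i
        by_cases hia : i = a
        · subst hia; have := this ha; simp_all
        · by_cases hi1 : i ∈ S1 <;> by_cases hi2 : i ∈ S2 <;> simp_all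
      · rintro hc2 _ p hp ⟨hp1, hp2⟩
        rcases List.mem_append.1 hp with hp | hp
        · obtain ⟨q1, q2⟩ := cnt_pos hp
          rw [g2] at q1 q2
          have e1 : p.1 = a := by
            by_contra h; simp [h, hd' _ hp1] at q1
          have e2 : p.2.1 = a := by
            by_contra h; simp [h, hd' _ hp2] at q2
          exact (g1 p hp).1 (e1.trans e2.symm)
        · obtain ⟨q1, q2⟩ := cnt_pos hp
          rw [g2'] at q1 q2
          have e1 : p.1 ∈ S1.erase a := by
            by_contra h; simp [h, hd' _ hp1] at q1
          have e2 : p.2.1 ∈ S1.erase a := by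
            by_contra h; simp [h, hd' _ hp2] at q2
          exact (g1' p hp).1 (Finset.card_le_one.1 (by omega) _ e1 _ e2)

/-- several components -/
lemma GPglob (t : ι → V) : ∀ (n : ℕ) (H U : Finset E) (S1 S2 : Finset ι), (S1 ∪ S2).card = n →
    U ⊆ H → bd ends U = 0 → Disjoint S1 S2 →
    (∀ i ∈ S1 ∪ S2, Even (S1.filter (fun j => Reach ends H (t i) (t j))).card ∧
      (S1.filter (fun j => Reach ends H (t i) (t j)) = ∅ →
        (S2.filter (fun j => Reach ends H (t i) (t j))).card ≠ 1)) →
    ∃ L, Good ends H t L ∧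
      (∀ i, cnt L i = (if i ∈ S1 then 1 else 0) + (if i ∈ S2 then 2 else 0)) ∧
      siz L + U.card ≤ 2 * H.card := by
  intro n
  induction n using Nat.strong_induction_on with
  | _ n ih =>
    intro H U S1 S2 hn hU hUb hd hcl
    rcases (S1 ∪ S2).eq_empty_or_nonempty with h0 | ⟨i, hi⟩
    · obtain ⟨rfl, rfl⟩ := Finset.union_eq_empty.1 h0
      have hUH := card_le_card hU
      exact ⟨[], by simp [Good], by simp [cnt], by simp [siz]; omega⟩
    · set p : ι → Prop := fun j => Reach ends H (t i) (t j) with hp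
      set C := cE ends H (t i) with hC
      have hCH : C ⊆ H := filter_subset _ _
      obtain ⟨L, g1, g2, g3, _⟩ := GP (H := C) (U := U ∩ C) inter_subset_right
        (bd_cE hU hUb (t i)) t (S1.filter p) (S2.filter p)
        (Finset.disjoint_filter_filter hd) (hcl i hi).1 (hcl i hi).2 (by
          have hh : ∀ j ∈ S1.filter p ∪ S2.filter p, Reach ends C (t i) (t j) := by
            intro j hj
            rw [← Finset.filter_union] at hj
            exact reach_cE (mem_filter.1 hj).2
          exact fun j hj k hk => (hh j hj).sy.tr (hh k hk))
      have hsub : S1.filter (fun j => ¬ p j) ∪ S2.filter (fun j => ¬ p j) ⊂ S1 ∪ S2 := by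
        rw [← Finset.filter_union]
        refine ⟨filter_subset _ _, fun h => ?_⟩
        exact (mem_filter.1 (h hi)).2 Reach.rfl'
      obtain ⟨L', g1', g2', g3'⟩ := ih _ (hn ▸ card_lt_card hsub) (H \ C) (U \ C)
        (S1.filter (fun j => ¬ p j)) (S2.filter (fun j => ¬ p j)) rfl
        (sdiff_subset_sdiff hU (Finset.Subset.refl _))
        (by
          have : U \ C = U \ (U ∩ C) := by
            ext f; simp only [mem_sdiff, mem_inter]; tauto
          rw [this, bd_sdiff ends Finset.inter_subset_left, hUb, bd_cE hU hUb, add_zero])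
        (Finset.disjoint_filter_filter hd)
        (by
          intro k hk
          rw [← Finset.filter_union] at hk
          obtain ⟨hk, hkp⟩ := mem_filter.1 hk
          have hf : ∀ S : Finset ι, (S.filter (fun j => ¬ p j)).filter
              (fun j => Reach ends (H \ C) (t k) (t j)) =
              S.filter (fun j => Reach ends H (t k) (t j)) := by
            intro S
            ext j
            simp only [mem_filter]
            constructor
            · rintro ⟨⟨h1, h2⟩, h3⟩; exact ⟨h1, h3.mono sdiff_subset⟩
            · rintro ⟨h1, h2⟩
              exact ⟨⟨h1, fun h => hkp (Reach.tr h h2.sy)⟩, reach_out hkp h2⟩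
          rw [hf, hf]
          exact hcl k hk)
      refine ⟨L ++ L', (g1.mono hCH).app (g1'.mono sdiff_subset), ?_, ?_⟩
      · intro j
        rw [cnt_app, g2, g2']
        by_cases hj : p j <;> simp [mem_filter, hj]
      · have e1 := card_sdiff_add_card_eq_card hCH
        have e2 := Finset.card_inter_add_card_sdiff U C
        rw [siz_app]; omega

end

/-! from links to signed circuits; decompositions -/
def Sh (ends : E → Sym2 V) (A B : Finset E) : Prop :=
  ∀ x y, x ∈ support ends A → x ∈ support ends B → y ∈ support ends A → y ∈ support ends B → x = y

def ub (sgn : E → Bool) (P : Finset (Finset E)) : Finset (Finset E) :=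
  P.filter (fun C => ng sgn C = 1)

section
variable {ends : E → Sym2 V} {sgn : E → Bool}

lemma tl_app (A B : List (Finset E)) : totalLength (A ++ B) = totalLength A + totalLength B := by
  simp [totalLength]

lemma tl_cons (A : Finset E) (B : List (Finset E)) :
    totalLength (A :: B) = A.card + totalLength B := by
  simp [totalLength]

lemma wd_app (A B : List (Finset E)) (e : E) : widthAt (A ++ B) e = widthAt A e + widthAt B e := by
  simp [widthAt]

lemma wd_cons (A : Finset E) (B : List (Finset E)) (e : E) :
    widthAt (A :: B) e = (if e ∈ A then 1 else 0) + widthAt B e := by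
  unfold widthAt
  rw [List.filter_cons]
  by_cases h : e ∈ A <;> simp [h]; omega

lemma wd_zero {A : List (Finset E)} {e : E} (h : ∀ C ∈ A, e ∉ C) : widthAt A e = 0 := by
  unfold widthAt
  rw [List.length_eq_zero_iff, List.filter_eq_nil_iff]
  intro C hC; simpa using h C hC

lemma cnt_sum {ι α : Type} [DecidableEq ι] {L : List (ι × ι × α)} {S : Finset ι}
    (hS : ∀ p ∈ L, p.1 ∈ S ∧ p.2.1 ∈ S) (f : ι → ℕ) :
    (L.map (fun p => f p.1 + f p.2.1)).sum = ∑ i ∈ S, cnt L i * f i := by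
  induction L with
  | nil => simp [cnt]
  | cons p L ih =>
    rw [List.map_cons, List.sum_cons, ih (fun q hq => hS q (List.mem_cons_of_mem _ hq))]
    have h1 : ∀ i, cnt (p :: L) i = ((if p.1 = i then 1 else 0) + (if p.2.1 = i then 1 else 0)) +
        cnt L i := by intro i; unfold cnt; rw [List.map_cons, List.sum_cons]
    simp only [h1, add_mul, Finset.sum_add_distrib, ite_mul, one_mul, zero_mul]
    rw [Finset.sum_ite_eq, Finset.sum_ite_eq, if_pos (hS p (by simp)).1, if_pos (hS p (by simp)).2]

lemma mkSC {H : Finset E} {t : Finset E → V} {L : List (Finset E × Finset E × Finset E)}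
    (hG : Good ends H t L) (S : Finset (Finset E)) (w : Finset E → ℕ) (hc : ∀ i, cnt L i = w i)
    (hS : ∀ i, w i ≠ 0 → i ∈ S) (hU : ∀ i ∈ S, UC ends sgn i ∧ t i ∈ support ends i)
    (hdj : ∀ i ∈ S, ∀ j ∈ S, i ≠ j → Disjoint i j) (hsh : ∀ p ∈ L, Sh ends p.1 p.2.1) :
    ∃ 𝒞 : List (Finset E), (∀ C ∈ 𝒞, SC ends sgn C ∧ C ⊆ H ∪ S.biUnion id) ∧
      totalLength 𝒞 ≤ siz L + ∑ i ∈ S, w i * i.card ∧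
      (∀ i, w i ≠ 0 → ∃ C ∈ 𝒞, i ⊆ C) ∧
      (∀ l, l ∉ H → ∀ i ∈ S, l ∈ i → widthAt 𝒞 l = w i) := by
  have hp : ∀ p ∈ L, p.1 ∈ S ∧ p.2.1 ∈ S := by
    intro p hp
    obtain ⟨h1, h2⟩ := cnt_pos hp
    rw [hc] at h1 h2
    exact ⟨hS _ (by omega), hS _ (by omega)⟩
  have hex : ∀ p : Finset E × Finset E × Finset E, ∃ F, p ∈ L → (SC ends sgn F ∧ p.1 ∪ p.2.1 ⊆ F ∧
      F ⊆ p.1 ∪ p.2.1 ∪ p.2.2) := by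
    intro p
    by_cases h : p ∈ L
    · obtain ⟨h1, h2⟩ := hp p h
      obtain ⟨F, hF⟩ := BB (hU _ h1).1 (hU _ h2).1 (hdj _ h1 _ h2 (hG p h).1) (hsh p h) (hU _ h1).2
        (hU _ h2).2 (hG p h).2.2
      exact ⟨F, fun _ => hF⟩
    · exact ⟨∅, fun h' => absurd h' h⟩
  choose f hf using hex
  refine ⟨L.map f, ?_, ?_, ?_, ?_⟩
  · intro C hC
    obtain ⟨p, hpL, rfl⟩ := List.mem_map.1 hC
    obtain ⟨h1, h2⟩ := hp p hpL
    refine ⟨(hf p hpL).1, (hf p hpL).2.2.trans ?_⟩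
    refine union_subset (union_subset ?_ ?_) ?_
    · exact (subset_biUnion_of_mem id h1).trans subset_union_right
    · exact (subset_biUnion_of_mem id h2).trans subset_union_right
    · exact (hG p hpL).2.1.trans subset_union_left
  · have h1 := cnt_sum hp (fun i => i.card)
    simp only [hc] at h1
    rw [← h1]
    unfold totalLength siz
    rw [← List.sum_map_add, List.map_map]
    apply List.sum_le_sum
    intro p hpL
    have h2 := card_le_card (hf p hpL).2.2
    have h3 := card_union_le (p.1 ∪ p.2.1) p.2.2
    have h4 := card_union_le p.1 p.2.1
    show (f p).card ≤ _
    omega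
  · intro i hi
    obtain ⟨p, hpL, h⟩ := cnt_mem (L := L) (i := i) (by rw [hc]; omega)
    refine ⟨f p, List.mem_map_of_mem hpL, ?_⟩
    have := (hf p hpL).2.1
    rcases h with rfl | rfl
    · exact Finset.subset_union_left.trans this
    · exact Finset.subset_union_right.trans this
  · intro l hl i hi hli
    rw [← hc]
    have hmem : ∀ j ∈ S, l ∈ j → j = i := by
      intro j hj hlj
      by_contra h
      exact Finset.disjoint_left.1 (hdj _ hj _ hi h) hlj hli
    clear hc
    induction L with
    | nil => simp [widthAt, cnt]
    | cons p L ih =>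
      have hpL : p ∈ p :: L := by simp
      rw [List.map_cons, wd_cons, ih (fun q hq => hG q (List.mem_cons_of_mem _ hq))
        (fun q hq => hsh q (List.mem_cons_of_mem _ hq)) (fun q hq => hp q (List.mem_cons_of_mem _ hq))
        (fun q hq => hf q (List.mem_cons_of_mem _ hq))]
      unfold cnt
      rw [List.map_cons, List.sum_cons]
      congr 1
      obtain ⟨h1, h2⟩ := hp p hpL
      obtain ⟨hne, hK, _⟩ := hG p hpL
      have hiff : l ∈ f p ↔ p.1 = i ∨ p.2.1 = i := by
        constructor
        · intro h
          have := (hf p hpL).2.2 h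
          simp only [mem_union] at this
          rcases this with (h | h) | h
          · exact Or.inl (hmem _ h1 h)
          · exact Or.inr (hmem _ h2 h)
          · exact absurd (hK h) hl
        · rintro (h | h)
          · exact (hf p hpL).2.1 (mem_union_left _ (h ▸ hli))
          · exact (hf p hpL).2.1 (mem_union_right _ (h ▸ hli))
      by_cases q1 : p.1 = i
      · have q2 : ¬ p.2.1 = i := fun h => hne (q1.trans h.symm)
        simp [hiff, q1, q2]
      · by_cases q2 : p.2.1 = i <;> simp [hiff, q1, q2]

lemma IsDec.sub {A : Finset E} {P : Finset (Finset E)} (h : IsDec ends A P) {C} (hC : C ∈ P) : C ⊆ A := by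
  rw [← h.2.2]; exact subset_biUnion_of_mem id hC

lemma IsDec.union {A A' : Finset E} {P P' : Finset (Finset E)} (h : IsDec ends A P)
    (h' : IsDec ends A' P') (hd : Disjoint A A') : IsDec ends (A ∪ A') (P ∪ P') := by
  refine ⟨?_, ?_, by rw [Finset.union_biUnion, h.2.2, h'.2.2]⟩
  · intro C hC
    rcases mem_union.1 hC with hC | hC
    · exact h.1 C hC
    · exact h'.1 C hC
  · intro C hC D hD hne
    rcases mem_union.1 hC with hC | hC <;> rcases mem_union.1 hD with hD | hD
    · exact h.2.1 C hC D hD hne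
    · exact disjoint_of_subset_left (h.sub hC) (Finset.disjoint_of_subset_right (h'.sub hD) hd)
    · exact disjoint_of_subset_left (h'.sub hC)
        (Finset.disjoint_of_subset_right (h.sub hD) hd.symm)
    · exact h'.2.1 C hC D hD hne

lemma IsDec.single {C : Finset E} (h : Cyc ends C) : IsDec ends C {C} := by
  refine ⟨by simpa using h, ?_, by simp⟩
  intro A hA B hB hne
  simp only [mem_singleton] at hA hB
  exact absurd (hA.trans hB.symm) hne

lemma IsDec.subset {A : Finset E} {P Q : Finset (Finset E)} (h : IsDec ends A P) (hQ : Q ⊆ P) :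
    IsDec ends (Q.biUnion id) Q :=
  ⟨fun C hC => h.1 C (hQ hC), fun C hC D hD => h.2.1 C (hQ hC) D (hQ hD), rfl⟩

lemma IsDec.sum {A : Finset E} {P : Finset (Finset E)} (h : IsDec ends A P) {M : Type}
    [AddCommMonoid M] (f : E → M) : ∑ e ∈ A, f e = ∑ C ∈ P, ∑ e ∈ C, f e := by
  rw [← h.2.2]
  exact Finset.sum_biUnion (fun C hC D hD hne => h.2.1 C hC D hD hne)

lemma IsDec.card {A : Finset E} {P : Finset (Finset E)} (h : IsDec ends A P) :
    A.card = ∑ C ∈ P, C.card := by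
  have := h.sum (fun _ => (1 : ℕ))
  simpa using this

lemma IsDec.even {A : Finset E} {P : Finset (Finset E)} (h : IsDec ends A P) : bd ends A = 0 := by
  unfold bd
  rw [h.sum]
  exact Finset.sum_eq_zero (fun C hC => (h.1 C hC).2.1)

lemma IsDec.parity {A : Finset E} {P : Finset (Finset E)} (h : IsDec ends A P) :
    ng sgn A = ((ub sgn P).card : ZMod 2) := by
  have h1 : ng sgn A = ∑ C ∈ P, ng sgn C := h.sum _
  rw [h1, ub, ← Finset.sum_boole]
  apply Finset.sum_congr rfl
  intro C _
  rcases z2c (ng sgn C) with h | h <;> simp [h]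

lemma sigma_min {A : Finset E} (k : ℕ) (hex : ∃ P, IsDec ends A P ∧ k ≤ (ub sgn P).card) :
    ∃ P, IsDec ends A P ∧ k ≤ (ub sgn P).card ∧ (k + 2 ≤ (ub sgn P).card →
      ∀ D ∈ ub sgn P, ∀ D' ∈ ub sgn P, D ≠ D' → Sh ends D D') := by
  set X : Finset (Finset (Finset E)) :=
    Finset.univ.filter (fun P => IsDec ends A P ∧ k ≤ (ub sgn P).card) with hX
  obtain ⟨P0, hP0⟩ := hex
  obtain ⟨P, hP, hmin⟩ := Finset.exists_min_image X (fun P => ∑ D ∈ ub sgn P, D.card)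
    ⟨P0, by simpa [hX] using hP0⟩
  obtain ⟨-, hP1, hP2⟩ := mem_filter.1 hP
  refine ⟨P, hP1, hP2, ?_⟩
  intro hk D hD D' hD' hne x y hx hx' hy hy'
  by_contra hxy
  obtain ⟨hDP, hDn⟩ := mem_filter.1 hD
  obtain ⟨hDP', hDn'⟩ := mem_filter.1 hD'
  have hdj := hP1.2.1 D hDP D' hDP' hne
  obtain ⟨B, hB, hBc, hBn⟩ := theta ⟨hP1.1 D hDP, hDn⟩ ⟨hP1.1 D' hDP', hDn'⟩ hdj hxy hx hy hx' hy'
  have hM : bd ends ((D ∪ D') \ B) = 0 := by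
    rw [bd_sdiff ends hB, bd_union ends hdj, (hP1.1 D hDP).2.1, (hP1.1 D' hDP').2.1, hBc.2.1]; simp
  obtain ⟨Q, hQ⟩ := dec_exists hM
  have hR := hP1.subset (Q := (P.erase D).erase D')
    ((erase_subset _ _).trans (erase_subset _ _))
  have hPe : insert D (insert D' ((P.erase D).erase D')) = P := by
    rw [insert_erase (mem_erase.2 ⟨hne.symm, hDP'⟩), insert_erase hDP]
  have hd1 : Disjoint (((P.erase D).erase D').biUnion id) (D ∪ D') := by
    rw [Finset.disjoint_biUnion_left]
    intro C hC
    obtain ⟨c1, hC⟩ := mem_erase.1 hC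
    obtain ⟨c2, hC⟩ := mem_erase.1 hC
    exact Finset.disjoint_union_right.2 ⟨hP1.2.1 C hC D hDP c2, hP1.2.1 C hC D' hDP' c1⟩
  have hN := hR.union ((hQ.union (IsDec.single hBc) Finset.sdiff_disjoint)) (by
    rw [Finset.sdiff_union_of_subset hB]; exact hd1)
  rw [Finset.sdiff_union_of_subset hB] at hN
  have hA : ((P.erase D).erase D').biUnion id ∪ (D ∪ D') = A := by
    conv_rhs => rw [← hP1.2.2, ← hPe]
    rw [Finset.biUnion_insert, Finset.biUnion_insert]
    simp only [id]
    ext e; simp only [mem_union]; tauto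
  rw [hA] at hN
  have hub : ub sgn ((P.erase D).erase D') = ((ub sgn P).erase D).erase D' := by
    unfold ub; rw [Finset.filter_erase, Finset.filter_erase]
  have hD2 : D' ∈ (ub sgn P).erase D := mem_erase.2 ⟨hne.symm, hD'⟩
  have c1 := Finset.card_erase_add_one hD
  have c2 := Finset.card_erase_add_one hD2
  have hub2 : ub sgn ((P.erase D).erase D' ∪ (Q ∪ {B})) = ((ub sgn P).erase D).erase D' ∪ ub sgn Q := by
    rw [← hub]
    unfold ub
    rw [Finset.filter_union, Finset.filter_union, Finset.filter_singleton, if_neg (by rw [hBn]; decide),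
      Finset.union_empty]
  have h1 := hmin _ (mem_filter.2 ⟨mem_univ _, hN, by
    rw [hub2]
    have := card_le_card (subset_union_left (s₁ := ((ub sgn P).erase D).erase D')
      (s₂ := ub sgn Q))
    omega⟩)
  simp only [hub2] at h1
  have h2 := Finset.add_sum_erase (ub sgn P) (fun D => D.card) hD
  have h3 := Finset.add_sum_erase ((ub sgn P).erase D) (fun D => D.card) hD2
  have h4 : ∑ C ∈ ((ub sgn P).erase D).erase D' ∪ ub sgn Q, C.card ≤
      ∑ C ∈ ((ub sgn P).erase D).erase D', C.card + ∑ C ∈ ub sgn Q, C.card := by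
    rw [← Finset.sum_union_inter]; omega
  have h5 : ∑ C ∈ ub sgn Q, C.card ≤ ∑ C ∈ Q, C.card :=
    Finset.sum_le_sum_of_subset (filter_subset _ _)
  rw [← hQ.card] at h5
  have h6 := card_sdiff_add_card_eq_card hB
  rw [card_union_of_disjoint hdj] at h6
  have h7 := hBc.1.card_pos
  omega

end

/-! common finishing lemma, case E -/
def CovM (ends : E → Sym2 V) (sgn : E → Bool) (F N Λ : Finset E) (M : ℕ) : Prop :=
  ∃ 𝒞 : List (Finset E), (∀ C ∈ 𝒞, SC ends sgn C ∧ C ⊆ F) ∧ (∀ e ∈ N, ∃ C ∈ 𝒞, e ∈ C) ∧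
    totalLength 𝒞 ≤ M ∧ ∀ l ∈ Λ, widthAt 𝒞 l = 2

abbrev Cov (ends : E → Sym2 V) (sgn : E → Bool) (F N Λ : Finset E) : Prop :=
  CovM ends sgn F N Λ (2 * F.card)

def lp (Λ : Finset E) : Finset (Finset E) := Λ.image (fun l => {l})

section
variable {ends : E → Sym2 V} {sgn : E → Bool}

lemma mem_lp {Λ : Finset E} {i : Finset E} : i ∈ lp Λ ↔ ∃ l ∈ Λ, {l} = i := by simp [lp]

lemma lp_card (Λ : Finset E) : (lp Λ).card = Λ.card :=
  Finset.card_image_of_injective _ (fun a b h => by simpa using h)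

lemma lp_sum (Λ : Finset E) : ∑ i ∈ lp Λ, i.card = Λ.card := by
  unfold lp
  rw [Finset.sum_image (fun a _ b _ h => by simpa using h)]; simp

lemma dec_bal {A : Finset E} {P : Finset (Finset E)} (h : IsDec ends A P) :
    (∀ C ∈ (P \ ub sgn P).toList, SC ends sgn C ∧ C ⊆ A) ∧
    totalLength (P \ ub sgn P).toList + ∑ i ∈ ub sgn P, i.card = A.card := by
  constructor
  · intro C hC
    rw [Finset.mem_toList, mem_sdiff] at hC
    refine ⟨Or.inl ⟨h.1 C hC.1, ?_⟩, h.sub hC.1⟩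
    rcases z2c (ng sgn C) with h0 | h0
    · exact h0
    · exact absurd (mem_filter.2 ⟨hC.1, h0⟩) hC.2
  · unfold totalLength
    rw [Finset.sum_map_toList, h.card]
    exact Finset.sum_sdiff (filter_subset _ _)

lemma FIN {M : ℕ} {F H Z' Λ : Finset E} {P S1 S2 : Finset (Finset E)} {t : Finset E → V}
    {L : List (Finset E × Finset E × Finset E)} (hP : IsDec ends Z' P) (hZ : Z' ⊆ F \ Λ)
    (hH : H ⊆ F \ Λ) (hΛ : Λ ⊆ F) (hG : Good ends H t L)
    (hc : ∀ i, cnt L i = (if i ∈ S1 then 1 else 0) + (if i ∈ S2 then 2 else 0))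
    (hd : Disjoint S1 S2) (hS : S1 ∪ S2 = ub sgn P ∪ lp Λ) (hL2 : lp Λ ⊆ S2)
    (hlp : ∀ l ∈ Λ, UC ends sgn {l})
    (ht : ∀ i ∈ ub sgn P ∪ lp Λ, t i ∈ support ends i)
    (hsh : ∀ p ∈ L, Sh ends p.1 p.2.1)
    (hcost : siz L + ∑ i ∈ S1, i.card + 2 * ∑ i ∈ S2, i.card + Z'.card ≤
      M + ∑ i ∈ ub sgn P, i.card) : CovM ends sgn F (Z' ∪ Λ) Λ M := by
  have hub : ∀ i ∈ ub sgn P, i ∈ P ∧ i ⊆ F \ Λ := fun i hi =>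
    ⟨(mem_filter.1 hi).1, (hP.sub (mem_filter.1 hi).1).trans hZ⟩
  have hw : ∀ i, ((if i ∈ S1 then 1 else 0) + (if i ∈ S2 then 2 else 0) : ℕ) ≠ 0 ↔
      i ∈ ub sgn P ∪ lp Λ := by
    intro i
    rw [← hS, mem_union]
    by_cases h1 : i ∈ S1 <;> by_cases h2 : i ∈ S2 <;> simp [h1, h2]
  obtain ⟨𝒞, c1, c2, c3, c4⟩ := mkSC (sgn := sgn) hG (ub sgn P ∪ lp Λ) _ hc (fun i hi => (hw i).1 hi) (by
    intro i hi
    refine ⟨?_, ht i hi⟩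
    rcases mem_union.1 hi with h | h
    · exact ⟨hP.1 _ (hub i h).1, (mem_filter.1 h).2⟩
    · obtain ⟨l, hl, rfl⟩ := mem_lp.1 h
      exact hlp l hl) (by
    have key : ∀ i ∈ ub sgn P, ∀ l ∈ Λ, Disjoint i {l} := by
      intro i hi l hl
      rw [Finset.disjoint_singleton_right]
      intro h
      exact (mem_sdiff.1 ((hub i hi).2 h)).2 hl
    intro i hi j hj hij
    rcases mem_union.1 hi with h | h <;> rcases mem_union.1 hj with h' | h'
    · exact hP.2.1 _ (hub i h).1 _ (hub j h').1 hij
    · obtain ⟨l, hl, rfl⟩ := mem_lp.1 h'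
      exact key i h l hl
    · obtain ⟨l, hl, rfl⟩ := mem_lp.1 h
      exact (key j h' l hl).symm
    · obtain ⟨l, hl, rfl⟩ := mem_lp.1 h
      obtain ⟨l', hl', rfl⟩ := mem_lp.1 h'
      rw [Finset.disjoint_singleton]
      rintro rfl; exact hij rfl) hsh
  obtain ⟨b1, b2⟩ := dec_bal (sgn := sgn) hP
  have hF0 : F \ Λ ⊆ F := sdiff_subset
  refine ⟨𝒞 ++ (P \ ub sgn P).toList, ?_, ?_, ?_, ?_⟩
  · intro C hC
    rcases List.mem_append.1 hC with h | h
    · refine ⟨(c1 C h).1, (c1 C h).2.trans (union_subset (hH.trans hF0) ?_)⟩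
      rw [Finset.biUnion_subset]
      intro i hi
      rcases mem_union.1 hi with h | h
      · exact (hub i h).2.trans hF0
      · obtain ⟨l, hl, rfl⟩ := mem_lp.1 h
        simpa using hΛ hl
    · exact ⟨(b1 C h).1, (b1 C h).2.trans (hZ.trans hF0)⟩
  · intro e he
    have key : ∀ i ∈ ub sgn P ∪ lp Λ, e ∈ i → ∃ C ∈ 𝒞 ++ (P \ ub sgn P).toList, e ∈ C := by
      intro i hi hei
      obtain ⟨C, hC, hiC⟩ := c3 i ((hw i).2 hi)
      exact ⟨C, List.mem_append_left _ hC, hiC hei⟩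
    rcases mem_union.1 he with he | he
    · rw [← hP.2.2, mem_biUnion] at he
      obtain ⟨C, hC, heC⟩ := he
      by_cases h : C ∈ ub sgn P
      · exact key C (mem_union_left _ h) heC
      · exact ⟨C, List.mem_append_right _ (by simp [hC, h]), heC⟩
    · exact key {e} (mem_union_right _ (mem_lp.2 ⟨e, he, rfl⟩)) (by simp)
  · rw [tl_app]
    have h1 : ∑ i ∈ ub sgn P ∪ lp Λ, ((if i ∈ S1 then 1 else 0) + (if i ∈ S2 then 2 else 0) : ℕ) * i.card
        = ∑ i ∈ S1, i.card + 2 * ∑ i ∈ S2, i.card := by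
      rw [← hS, Finset.sum_union hd, Finset.mul_sum]
      congr 1
      · apply Finset.sum_congr rfl
        intro i hi
        simp [hi, Finset.disjoint_left.1 hd hi]
      · apply Finset.sum_congr rfl
        intro i hi
        simp [hi, Finset.disjoint_right.1 hd hi]
    rw [h1] at c2
    omega
  · intro l hl
    have hm : {l} ∈ lp Λ := mem_lp.2 ⟨l, hl, rfl⟩
    rw [wd_app, c4 l (fun h => (mem_sdiff.1 (hH h)).2 hl) {l} (mem_union_right _ hm)
      (by simp), wd_zero (fun C hC h => (mem_sdiff.1 (hZ ((b1 C hC).2 h))).2 hl)]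
    simp [hL2 hm, Finset.disjoint_right.1 hd (hL2 hm)]

lemma loop_reach {F Λ : Finset E} (hΛ : ∀ l ∈ Λ, ∃ a, ends l = s(a, a)) {u v : V}
    (h : Reach ends F u v) : Reach ends (F \ Λ) u v := by
  induction h with
  | refl => exact Reach.rfl'
  | tail _ h ih =>
    obtain ⟨e, he, hab⟩ := h
    refine ih.tr ?_
    by_cases hl : e ∈ Λ
    · obtain ⟨a, ha⟩ := hΛ e hl
      rw [ha] at hab
      have := Sym2.eq_iff.1 hab
      rcases this with ⟨rfl, rfl⟩ | ⟨rfl, rfl⟩ <;> exact Reach.rfl'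
    · exact Reach.edge (mem_sdiff.2 ⟨he, hl⟩) hab

lemma Cyc.supp_ne {C : Finset E} (h : Cyc ends C) : (support ends C).Nonempty := by
  obtain ⟨e, he⟩ := h.1
  obtain ⟨a, b, hab⟩ : ∃ a b, ends e = s(a, b) := ⟨_, _, (Quot.out_eq (ends e)).symm⟩
  exact ⟨a, mem_support.2 ⟨e, he, by rw [hab]; simp⟩⟩

lemma Sh.sy {A B : Finset E} (h : Sh ends A B) : Sh ends B A :=
  fun x y h1 h2 h3 h4 => h x y h2 h1 h4 h3

lemma Sh.loop {A : Finset E} {l : E} {a : V} (h : ends l = s(a, a)) : Sh ends A {l} := by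
  intro x y _ h2 _ h4
  rw [supp_loop h] at h2 h4
  simp at h2 h4
  rw [h2, h4]

lemma uc_loop {l : E} {a : V} (h : ends l = s(a, a)) (hn : sgn l = true) : UC ends sgn {l} :=
  ⟨cyc_loop h, ng_single hn⟩

/-- chosen vertex of a set -/
lemma exists_t (ends : E → Sym2 V) [Nonempty V] :
    ∃ t : Finset E → V, ∀ C, Cyc ends C → t C ∈ support ends C :=
  ⟨fun C => if h : (support ends C).Nonempty then h.choose else Classical.arbitrary V,
    fun C hC => by simp only [hC.supp_ne, dif_pos]; exact hC.supp_ne.choose_spec⟩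

lemma caseE1 {F Z' Λ : Finset E} {P : Finset (Finset E)} (hconn : ConnectedOn ends F)
    (hΛ : Λ ⊆ F) (hlp : ∀ l ∈ Λ, (∃ a, ends l = s(a, a)) ∧ sgn l = true)
    (hZ : Z' ⊆ F \ Λ) (hP : IsDec ends Z' P) (hev : Even (ub sgn P).card)
    (hne : ub sgn P = ∅ → Λ.card ≠ 1)
    (hsh : (∀ D ∈ ub sgn P, ∀ D' ∈ ub sgn P, D ≠ D' → Sh ends D D') ∨
      ((ub sgn P).card = 2 ∧ Odd Λ.card)) : Cov ends sgn F (Z' ∪ Λ) Λ := by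
  by_cases hV : Nonempty V
  swap
  · have hE : ∀ e : E, False := fun e => hV ⟨(Quot.out (ends e)).1⟩
    exact ⟨[], by simp, fun e => (hE e).elim, by simp [totalLength], fun e => (hE e).elim⟩
  obtain ⟨t, ht⟩ := exists_t ends
  have hlu : ∀ l ∈ Λ, UC ends sgn {l} := fun l hl =>
    uc_loop (hlp l hl).1.choose_spec (hlp l hl).2
  have hcy : ∀ i ∈ ub sgn P ∪ lp Λ, Cyc ends i ∧ i ⊆ F := by
    intro i hi
    rcases mem_union.1 hi with h | h
    · have := (mem_filter.1 h).1
      exact ⟨hP.1 i this, ((hP.sub this).trans hZ).trans sdiff_subset⟩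
    · obtain ⟨l, hl, rfl⟩ := mem_lp.1 h
      exact ⟨(hlu l hl).1, by simpa using hΛ hl⟩
  have hdj : Disjoint (ub sgn P) (lp Λ) := by
    rw [Finset.disjoint_left]
    intro i hi h
    obtain ⟨l, hl, rfl⟩ := mem_lp.1 h
    have := hZ (hP.sub (mem_filter.1 hi).1 (Finset.mem_singleton_self l))
    exact (mem_sdiff.1 this).2 hl
  obtain ⟨L, g1, g2, g3, g4⟩ := GP (H := F \ Λ) (U := Z') hZ hP.even t (ub sgn P) (lp Λ) hdj hev
    (by rwa [lp_card]) (fun i hi j hj => loop_reach (fun l hl => (hlp l hl).1)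
      (hconn _ (support_mono (hcy i hi).2 (ht i (hcy i hi).1))
        _ (support_mono (hcy j hj).2 (ht j (hcy j hj).1))))
  refine FIN hP hZ subset_rfl hΛ g1 g2 hdj rfl subset_rfl hlu (fun i hi => ht i (hcy i hi).1) ?_ ?_
  · intro p hp
    have h0 : ∀ i, 0 < cnt L i → i ∈ ub sgn P ∪ lp Λ := by
      intro i hi
      rw [g2] at hi
      rw [mem_union]
      by_contra h
      push Not at h
      simp [h.1, h.2] at hi
    rcases mem_union.1 (h0 _ (cnt_pos hp).1) with h1 | h1
    · rcases mem_union.1 (h0 _ (cnt_pos hp).2) with h2 | h2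
      · rcases hsh with hsh | ⟨hs1, hs2⟩
        · exact hsh _ h1 _ h2 (g1 p hp).1
        · exact absurd ⟨h1, h2⟩ (g4 hs1 (by rwa [lp_card]) p hp)
      · obtain ⟨l, hl, h⟩ := mem_lp.1 h2
        rw [← h]; exact Sh.loop (hlp l hl).1.choose_spec
    · obtain ⟨l, hl, h⟩ := mem_lp.1 h1
      rw [← h]; exact (Sh.loop (hlp l hl).1.choose_spec).sy
  · rw [lp_sum]
    have := card_sdiff_add_card_eq_card hΛ
    omega
end

section
variable {ends : E → Sym2 V} {sgn : E → Bool}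
lemma tj_flip2 {H U J : Finset E} (hU : U ⊆ H) (hUb : bd ends U = 0) (hJ : J ⊆ H) :
    ∃ J' ⊆ H, bd ends J' = bd ends J ∧ 2 * (J' ∩ U).card ≤ U.card := by
  have h1 := Finset.card_sdiff_add_card_inter U J
  rw [Finset.inter_comm] at h1
  by_cases h : 2 * (J ∩ U).card ≤ U.card
  · exact ⟨J, hJ, rfl, h⟩
  · refine ⟨symmDiff J U, ?_, by rw [bd_symm, hUb, add_zero], ?_⟩
    · intro e he
      rcases mem_symmDiff.1 he with h | h
      · exact hJ h.1
      · exact hU h.1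
    · have : symmDiff J U ∩ U = U \ J := by
        ext e; simp only [mem_inter, mem_symmDiff, mem_sdiff]; tauto
      rw [this]; omega

lemma dec_list {A : Finset E} (hA : bd ends A = 0) (hAB : ∀ B ⊆ A, bd ends B = 0 → ng sgn B = 0) :
    ∃ 𝒞 : List (Finset E), (∀ C ∈ 𝒞, SC ends sgn C ∧ C ⊆ A) ∧ totalLength 𝒞 = A.card ∧
      ∀ e ∈ A, ∃ C ∈ 𝒞, e ∈ C := by
  obtain ⟨P, hP⟩ := dec_exists hA
  refine ⟨P.toList, ?_, ?_, ?_⟩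
  · intro C hC
    rw [Finset.mem_toList] at hC
    exact ⟨Or.inl ⟨hP.1 C hC, hAB C (hP.sub hC) (hP.1 C hC).2.1⟩, hP.sub hC⟩
  · unfold totalLength
    rw [Finset.sum_map_toList, hP.card]
  · intro e he
    rw [← hP.2.2, mem_biUnion] at he
    obtain ⟨C, hC, h⟩ := he
    exact ⟨C, by simpa using hC, h⟩

lemma dec_two {A : Finset E} (hA : bd ends A = 0) (hn : ng sgn A = 0)
    (hno : ¬ ∃ P, IsDec ends A P ∧ 2 ≤ (ub sgn P).card) : ∀ B ⊆ A, bd ends B = 0 → ng sgn B = 0 := by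
  intro B hB hb
  rcases z2c (ng sgn B) with h | h
  · exact h
  exfalso
  apply hno
  obtain ⟨P, hP⟩ := dec_exists hb
  obtain ⟨Q, hQ⟩ := dec_exists (ends := ends) (A := A \ B) (by rw [bd_sdiff _ hB, hA, hb, add_zero])
  have hu := hP.union hQ Finset.disjoint_sdiff
  rw [Finset.union_sdiff_of_subset hB] at hu
  refine ⟨_, hu, ?_⟩
  have h1 := hP.parity (sgn := sgn)
  have h2 := hQ.parity (sgn := sgn)
  rw [h] at h1
  rw [ng_sdiff _ hB, hn, h, zero_add] at h2
  have e1 : (ub sgn P).Nonempty := by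
    rw [Finset.nonempty_iff_ne_empty]; intro h0; rw [h0] at h1; simp at h1
  have e2 : (ub sgn Q).Nonempty := by
    rw [Finset.nonempty_iff_ne_empty]; intro h0; rw [h0] at h2; simp at h2
  obtain ⟨C, hC⟩ := e1
  obtain ⟨D, hD⟩ := e2
  have hC' := mem_filter.1 hC
  have hD' := mem_filter.1 hD
  have hne : C ≠ D := by
    rintro rfl
    obtain ⟨e, he⟩ := (hP.1 C hC'.1).1
    exact (mem_sdiff.1 (hQ.sub hD'.1 he)).2 (hP.sub hC'.1 he)
  have : ({C, D} : Finset (Finset E)) ⊆ ub sgn (P ∪ Q) := by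
    intro X hX
    rcases mem_insert.1 hX with rfl | hX
    · exact mem_filter.2 ⟨mem_union_left _ hC'.1, hC'.2⟩
    · rw [mem_singleton.1 hX]
      exact mem_filter.2 ⟨mem_union_right _ hD'.1, hD'.2⟩
  calc 2 = ({C, D} : Finset (Finset E)).card := (Finset.card_pair hne).symm
    _ ≤ _ := card_le_card this

lemma e2_cost {F U O K R C : Finset E} {l : E} (hR : R ⊆ F) (hRO : R ∩ U ⊆ O) (hK : K ⊆ F)
    (hC : C ⊆ {l} ∪ R ∪ K) : C.card ≤ 1 + (F \ U).card + O.card + (K ∩ (U \ O)).card := by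
  have : C ⊆ {l} ∪ F \ U ∪ O ∪ (K ∩ (U \ O)) := by
    intro x hx
    have h1 := hC hx
    by_cases h0 : x ∈ U
    · by_cases h5 : x ∈ O
      · exact mem_union_left _ (mem_union_right _ h5)
      · have h6 : x ∉ R := fun h => h5 (hRO (mem_inter.2 ⟨h, h0⟩))
        simp only [mem_union, mem_inter, mem_sdiff] at h1 ⊢
        tauto
    · simp only [mem_union, mem_inter, mem_sdiff] at h1 ⊢
      rcases h1 with (h1 | h1) | h1
      · tauto
      · exact Or.inl (Or.inl (Or.inr ⟨hR h1, h0⟩))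
      · exact Or.inl (Or.inl (Or.inr ⟨hK h1, h0⟩))
  refine (card_le_card this).trans ((card_union_le _ _).trans ?_)
  gcongr
  refine (card_union_le _ _).trans ?_
  gcongr
  refine (card_union_le _ _).trans ?_
  simp

lemma caseE2 {F U : Finset E} {l : E} (hconn : ConnectedOn ends F) (hl : l ∈ F) {v : V}
    (hlv : ends l = s(v, v)) (hln : sgn l = true) (hU : U ⊆ F \ {l}) (hUb : bd ends U = 0)
    (hAB : ∀ B ⊆ U, bd ends B = 0 → ng sgn B = 0) (hR : ∃ R ⊆ F \ {l}, UC ends sgn R) :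
    Cov ends sgn F (U ∪ {l}) {l} := by
  obtain ⟨R0, hR0, hR0u⟩ := hR
  obtain ⟨R1, hR1, hmin⟩ := Finset.exists_min_image
    (Finset.univ.filter (fun R => R ⊆ F \ {l} ∧ UC ends sgn R)) (fun R => (R \ U).card)
    ⟨R0, by simp [hR0, hR0u]⟩
  obtain ⟨-, hR1F, hR1u⟩ := mem_filter.1 hR1
  obtain ⟨R2, hR2s, hR2u⟩ := uc_exists (ends := ends) (sgn := sgn) (A := symmDiff R1 U)
    (by rw [bd_symm, hR1u.1.2.1, hUb, add_zero])
    (by rw [ng_symm, hR1u.2, hAB U subset_rfl hUb, add_zero])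
  have hR2F : R2 ⊆ F \ {l} := by
    intro e he
    rcases mem_symmDiff.1 (hR2s he) with h | h
    · exact hR1F h.1
    · exact hU h.1
  have hsub : R2 \ U ⊆ R1 \ U := by
    intro e he
    obtain ⟨h1, h2⟩ := mem_sdiff.1 he
    rcases mem_symmDiff.1 (hR2s h1) with h | h
    · exact mem_sdiff.2 h
    · exact absurd h.1 h2
  have heq : R2 \ U = R1 \ U := Finset.eq_of_subset_of_card_le hsub
    (hmin R2 (by simp [hR2F, hR2u]))
  set O := (R1 ∪ R2) ∩ U with hO
  have hOU : O ⊆ U := inter_subset_right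
  have hOs : O = symmDiff R1 R2 := by
    ext e
    have h1 := Finset.ext_iff.1 heq e
    have h2 : e ∈ R2 → _ := fun h => mem_symmDiff.1 (hR2s h)
    simp only [hO, mem_inter, mem_union, mem_symmDiff, mem_sdiff] at *
    tauto
  have hOb : bd ends O = 0 := by rw [hOs, bd_symm, hR1u.1.2.1, hR2u.1.2.1, add_zero]
  obtain ⟨e, he⟩ : (R1 \ U).Nonempty := by
    rw [Finset.nonempty_iff_ne_empty]
    intro h
    rw [Finset.sdiff_eq_empty_iff_subset] at h
    have := hAB R1 h hR1u.1.2.1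
    rw [hR1u.2] at this; exact one_ne_zero this
  obtain ⟨y, hy⟩ : ∃ y, y ∈ ends e := ⟨_, Sym2.out_fst_mem (ends e)⟩
  have hy1 : y ∈ support ends R1 := mem_support.2 ⟨e, (mem_sdiff.1 he).1, hy⟩
  have hy2 : y ∈ support ends R2 := by
    rw [← heq] at he; exact mem_support.2 ⟨e, (mem_sdiff.1 he).1, hy⟩
  have hvl : v ∈ support ends {l} := by rw [supp_loop hlv]; simp
  have hreach : Reach ends (F \ {l}) v y :=
    loop_reach (by simpa using ⟨v, hlv⟩) (hconn v (support_mono (by simpa using hl) hvl) y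
      (support_mono (hR1F.trans sdiff_subset) hy1))
  obtain ⟨J0, S0, hJ0, hp⟩ := Pth.of_reach hreach
  have hU2b : bd ends (U \ O) = 0 := by rw [bd_sdiff _ hOU, hUb, hOb, add_zero]
  obtain ⟨K, hKF, hKb, hKc⟩ := tj_flip2 (ends := ends) (U := U \ O)
    (Finset.sdiff_subset.trans hU) hU2b hJ0
  rw [hp.bd_eq] at hKb
  have hKr := reach_of_bd hKb
  have hlF : ∀ {A : Finset E}, A ⊆ F \ {l} → l ∉ A := fun h h' => by simpa using h h'
  have hlu := uc_loop (sgn := sgn) hlv hln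
  have key : ∀ R, UC ends sgn R → R ⊆ F \ {l} → y ∈ support ends R → ∃ C, SC ends sgn C ∧
      {l} ∪ R ⊆ C ∧ C ⊆ {l} ∪ R ∪ K := fun R h1 h2 h3 =>
    BB hlu h1 (by rw [Finset.disjoint_singleton_left]; exact hlF h2)
      (Sh.loop hlv).sy hvl h3 hKr
  obtain ⟨C1, a1, a2, a3⟩ := key R1 hR1u hR1F hy1
  obtain ⟨C2, b1, b2, b3⟩ := key R2 hR2u hR2F hy2
  obtain ⟨𝒞, d1, d2, d3⟩ := dec_list (sgn := sgn) hU2b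
    (fun B hB => hAB B (hB.trans sdiff_subset))
  have hlF' : {l} ⊆ F := by simpa using hl
  have hFs : F \ {l} ⊆ F := sdiff_subset
  have hcost : ∀ R C, R ⊆ F \ {l} → R ∩ U ⊆ O → C ⊆ {l} ∪ R ∪ K → C.card ≤
      1 + ((F \ {l}) \ U).card + O.card + (K ∩ (U \ O)).card := by
    intro R C hR hRO hC
    exact e2_cost hR hRO hKF hC
  have k1 := hcost R1 C1 hR1F (Finset.inter_subset_inter_right subset_union_left) a3
  have k2 := hcost R2 C2 hR2F (Finset.inter_subset_inter_right subset_union_right) b3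
  have k3 := card_sdiff_add_card_eq_card hU
  have k4 := card_sdiff_add_card_eq_card hOU
  have k5 := card_sdiff_add_card_eq_card hlF'
  simp only [Finset.card_singleton] at k5
  refine ⟨C1 :: C2 :: 𝒞, ?_, ?_, ?_, ?_⟩
  · intro C hC
    simp only [List.mem_cons] at hC
    rcases hC with rfl | rfl | hC
    · exact ⟨a1, a3.trans (union_subset (union_subset hlF' (hR1F.trans hFs)) (hKF.trans hFs))⟩
    · exact ⟨b1, b3.trans (union_subset (union_subset hlF' (hR2F.trans hFs)) (hKF.trans hFs))⟩
    · exact ⟨(d1 C hC).1, (d1 C hC).2.trans (Finset.sdiff_subset.trans (hU.trans hFs))⟩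
  · intro x hx
    by_cases h1 : x ∈ C1
    · exact ⟨C1, by simp, h1⟩
    by_cases h2 : x ∈ C2
    · exact ⟨C2, by simp, h2⟩
    rcases mem_union.1 hx with hx | hx
    · obtain ⟨C, hC, h⟩ := d3 x (mem_sdiff.2 ⟨hx, fun h => by
        rcases mem_union.1 (mem_inter.1 h).1 with h | h
        · exact h1 (a2 (mem_union_right _ h))
        · exact h2 (b2 (mem_union_right _ h))⟩)
      exact ⟨C, by simp [hC], h⟩
    · exact absurd (a2 (mem_union_left _ hx)) h1
  · rw [tl_cons, tl_cons, d2]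
    omega
  · intro x hx
    rw [mem_singleton.1 hx, wd_cons, wd_cons, if_pos (a2 (by simp)), if_pos (b2 (by simp)),
      wd_zero (fun C hC h => hlF hU (sdiff_subset ((d1 C hC).2 h)))]

lemma caseE {F Z' Λ : Finset E} (hconn : ConnectedOn ends F)
    (hΛ : Λ ⊆ F) (hlp : ∀ l ∈ Λ, (∃ a, ends l = s(a, a)) ∧ sgn l = true)
    (hZ : Z' ⊆ F \ Λ) (hZb : bd ends Z' = 0) (hn : ng sgn Z' = 0)
    (hR : ∀ l ∈ Λ, ∃ R ⊆ F.erase l, UC ends sgn R) : Cov ends sgn F (Z' ∪ Λ) Λ := by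
  have hev : ∀ P, IsDec ends Z' P → Even (ub sgn P).card := by
    intro P hP
    have := hP.parity (sgn := sgn)
    rw [hn] at this
    exact (ZMod.natCast_eq_zero_iff_even).1 this.symm
  rcases Nat.even_or_odd Λ.card with hlam | hlam
  · obtain ⟨P0, hP0⟩ := dec_exists hZb
    obtain ⟨P, hP, -, h3⟩ := sigma_min (sgn := sgn) 0 ⟨P0, hP0, Nat.zero_le _⟩
    refine caseE1 hconn hΛ hlp hZ hP (hev P hP) (fun _ h => by rw [h] at hlam; exact absurd hlam (by decide))
      (Or.inl ?_)
    rcases Nat.lt_or_ge (ub sgn P).card 2 with h | h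
    · intro D hD
      have h1 := Finset.card_pos.2 ⟨D, hD⟩
      obtain ⟨k, hk⟩ := hev P hP
      omega
    · exact h3 h
  · by_cases hex : ∃ P, IsDec ends Z' P ∧ 2 ≤ (ub sgn P).card
    · obtain ⟨P, hP, h2, h3⟩ := sigma_min (sgn := sgn) 2 hex
      refine caseE1 hconn hΛ hlp hZ hP (hev P hP) (fun h => by rw [h] at h2; simp at h2) ?_
      by_cases h4 : (ub sgn P).card = 2
      · exact Or.inr ⟨h4, hlam⟩
      · obtain ⟨k, hk⟩ := hev P hP
        exact Or.inl (h3 (by omega))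
    · have hAB := dec_two hZb hn hex
      by_cases h1 : Λ.card = 1
      · obtain ⟨l, rfl⟩ := Finset.card_eq_one.1 h1
        obtain ⟨⟨a, ha⟩, hs⟩ := hlp l (by simp)
        have := hR l (by simp)
        rw [Finset.erase_eq] at this
        exact caseE2 hconn (by simpa using hΛ) ha hs hZ hZb hAB this
      · obtain ⟨P, hP⟩ := dec_exists hZb
        have h0 : ub sgn P = ∅ := by
          rw [← Finset.card_eq_zero]
          obtain ⟨k, hk⟩ := hev P hP
          by_contra h
          exact hex ⟨P, hP, by omega⟩
        exact caseE1 hconn hΛ hlp hZ hP (hev P hP) (fun _ => h1) (Or.inl (by simp [h0]))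
end

section
variable {ends : E → Sym2 V} {sgn : E → Bool}
lemma wd_cnt {ι α : Type} [DecidableEq ι] (L : List (ι × ι × α)) (f : ι × ι × α → Finset E) (l : E)
    (i : ι) (h : ∀ p ∈ L, p.1 ≠ p.2.1 ∧ (l ∈ f p ↔ p.1 = i ∨ p.2.1 = i)) :
    widthAt (L.map f) l = cnt L i := by
  induction L with
  | nil => simp [widthAt, cnt]
  | cons p L ih =>
    rw [List.map_cons, wd_cons, ih (fun q hq => h q (List.mem_cons_of_mem _ hq))]
    unfold cnt
    rw [List.map_cons, List.sum_cons]
    congr 1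
    obtain ⟨h1, h2⟩ := h p (by simp)
    by_cases q1 : p.1 = i
    · have q2 : ¬ p.2.1 = i := fun h => h1 (q1.trans h.symm)
      simp [h2, q1, q2]
    · by_cases q2 : p.2.1 = i <;> simp [h2, q1, q2]

lemma Pth.card {u v : V} {A : Finset E} {S : Finset V} (h : Pth ends u v A S) :
    S.card = A.card + 1 := by
  induction h with
  | nil => simp
  | cons he hu hp ih =>
    rw [card_insert_of_notMem hu, card_insert_of_notMem (Pth.fresh he hu hp), ih]

lemma Wk.card_le {u v : V} {l : List E} {S : Finset V} (h : Wk ends u v l S) :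
    S.card ≤ l.length + 1 := by
  induction h with
  | nil => simp
  | cons he hp ih =>
    refine (Finset.card_insert_le _ _).trans ?_
    simp only [List.length_cons]; omega

lemma Wk.pth {u v : V} {l : List E} {S : Finset V} (h : Wk ends u v l S) :
    S.card = l.length + 1 → Pth ends u v l.toFinset S := by
  induction h with
  | nil => intro _; simpa using Pth.nil _
  | @cons u w v e l S he hp ih =>
    intro hc
    have h1 := hp.card_le
    have h2 := Finset.card_insert_le u S
    simp only [List.length_cons] at hc
    have h3 : u ∉ S := by
      intro h; rw [Finset.insert_eq_of_mem h] at hc; omega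
    rw [List.toFinset_cons]
    exact Pth.cons he h3 (ih (by omega))

lemma seg_split (u v x : V) (l : List E) (S : Finset V)
    (h : Wk ends u v l S ∧ S.card = l.length + 1) (hx : x ∈ S) :
    ∃ l1 S1 l2 S2, (Wk ends u x l1 S1 ∧ S1.card = l1.length + 1) ∧
      (Wk ends x v l2 S2 ∧ S2.card = l2.length + 1) ∧ l = l1 ++ l2 ∧ S = S1 ∪ S2 := by
  obtain ⟨l1, S1, l2, S2, h1, h2, rfl, rfl⟩ := h.1.split hx
  have k1 := h1.card_le
  have k2 := h2.card_le
  have k3 := h.2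
  have hx1 : x ∈ S1 := by
    clear h h2 k1 k2 k3 hx
    induction h1 with
    | nil => simp
    | cons _ _ ih => exact mem_insert_of_mem ih
  have k4 : 0 < (S1 ∩ S2).card := Finset.card_pos.2 ⟨x, mem_inter.2 ⟨hx1, h2.start_mem⟩⟩
  have k5 := Finset.card_union_add_card_inter S1 S2
  rw [List.length_append] at k3
  exact ⟨l1, S1, l2, S2, ⟨h1, by omega⟩, ⟨h2, by omega⟩, rfl, rfl⟩

lemma ARC {D : Finset E} (hD : Cyc ends D) (B : Finset E) (hB : 2 ≤ B.card) (a y : E → V)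
    (p : E → Finset E) (S : E → Finset V) (hl : ∀ l ∈ B, ends l = s(a l, a l) ∧ sgn l = true)
    (hp : ∀ l ∈ B, Pth ends (a l) (y l) (p l) (S l))
    (hy : ∀ l ∈ B, y l ∈ support ends D ∧ ∀ x ∈ S l, x ∈ support ends D → x = y l)
    (hdj : ∀ l ∈ B, ∀ l' ∈ B, l ≠ l' → Disjoint (S l) (S l')) (hBD : Disjoint B D) :
    ∃ 𝒞 : List (Finset E), (∀ C ∈ 𝒞, SC ends sgn C ∧ C ⊆ B ∪ D ∪ B.biUnion p) ∧
      (∀ e ∈ D, ∃ C ∈ 𝒞, e ∈ C) ∧ (∀ l ∈ B, widthAt 𝒞 l = 2) ∧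
      totalLength 𝒞 ≤ D.card + 2 * ∑ l ∈ B, (p l).card + 2 * B.card := by
  obtain ⟨i, hi, j, hj, hij⟩ := Finset.one_lt_card.1 hB
  have hyne : ∀ l ∈ B, ∀ l' ∈ B, l ≠ l' → y l ≠ y l' := fun l h l' h' hne he =>
    Finset.disjoint_left.1 (hdj l h l' h' hne) (hp l h).end_mem (he ▸ (hp l' h').end_mem)
  obtain ⟨A1, S1, A2, S2, q1, q2, qd, qD, -, qS⟩ := hD.arcs (hy i hi).1 (hy j hj).1 (hyne i hi j hj hij)
  set R := (B.erase i).erase j with hR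
  have hRi : i ∉ R := by simp [hR]
  have hRj : j ∉ R := by simp [hR]
  obtain ⟨l1, w1, e1, n1⟩ := q1.wk
  obtain ⟨l2, w2, e2, n2⟩ := q2.wk
  obtain ⟨L1, g1, g2, g3⟩ := chain (fun u v l S => Wk ends u v l S ∧ S.card = l.length + 1)
    seg_split y (R.filter (fun l => y l ∈ S1)) i j l1 S1 hij (by simp [hRi]) (by simp [hRj])
    ⟨w1, by rw [q1.card, n1]⟩ (fun l hl => (mem_filter.1 hl).2)
  obtain ⟨L2, g1', g2', g3'⟩ := chain (fun u v l S => Wk ends u v l S ∧ S.card = l.length + 1)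
    seg_split y (R.filter (fun l => y l ∉ S1)) i j l2 S2 hij (by simp [hRi]) (by simp [hRj])
    ⟨w2, by rw [q2.card, n2]⟩ (fun l hl => by
      obtain ⟨h1, h2⟩ := mem_filter.1 hl
      have h3 := (hy l (mem_of_mem_erase (mem_of_mem_erase h1))).1
      rw [qS] at h3
      exact (mem_union.1 h3).resolve_left h2)
  set L := L1 ++ L2 with hL
  have hcnt : ∀ l, cnt L l = if l ∈ B then 2 else 0 := by
    intro l
    rw [hL, cnt_app, g2, g2']
    simp only [mem_filter, hR, mem_erase]
    by_cases h1 : l = i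
    · subst h1; simp [hi, Ne.symm hij]
    · by_cases h2 : l = j
      · subst h2; simp [hj, hij]
      · by_cases h3 : l ∈ B <;> by_cases h4 : y l ∈ S1 <;> simp [h1, h2, h3, h4, Ne.symm h1, Ne.symm h2]
  have hmem : ∀ q ∈ L, q.1 ∈ B ∧ q.2.1 ∈ B := by
    intro q hq
    obtain ⟨h1, h2⟩ := cnt_pos hq
    rw [hcnt] at h1 h2
    constructor
    · by_contra h; simp [h] at h1
    · by_contra h; simp [h] at h2
  have hflat : (L.map (fun q => q.2.2)).flatten = l1 ++ l2 := by
    rw [hL, List.map_append, List.flatten_append, g3, g3']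
  have hsub : ∀ q ∈ L, q.2.2.toFinset ⊆ D := by
    intro q hq e he
    have : e ∈ l1 ++ l2 := by
      rw [← hflat, List.mem_flatten]
      exact ⟨q.2.2, List.mem_map_of_mem hq, by simpa using he⟩
    rw [qD, ← e1, ← e2]
    simpa using this
  have hseg : ∀ q ∈ L, q.1 ≠ q.2.1 ∧ ∃ T, Pth ends (y q.1) (y q.2.1) q.2.2.toFinset T := by
    intro q hq
    rcases List.mem_append.1 hq with h | h
    · obtain ⟨h1, T, h2, h3⟩ := g1 q h
      exact ⟨h1, T, h2.pth h3⟩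
    · obtain ⟨h1, T, h2, h3⟩ := g1' q h
      exact ⟨h1, T, h2.pth h3⟩
  set f : E × E × List E → Finset E := fun q => {q.1} ∪ {q.2.1} ∪ (p q.1 ∪ q.2.2.toFinset ∪ p q.2.1) with hf
  have hlS : ∀ l ∈ B, ∀ l' ∈ B, l ∉ p l' := by
    intro l h l' h' hm
    exact (hp l' h').notloop l hm _ _ (hl l h).1 rfl
  refine ⟨L.map f, ?_, ?_, ?_, ?_⟩
  · intro C hC
    obtain ⟨q, hq, rfl⟩ := List.mem_map.1 hC
    obtain ⟨m1, m2⟩ := hmem q hq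
    obtain ⟨hne, T, hT⟩ := hseg q hq
    have hTD : ∀ x ∈ T, x ∈ support ends D := by
      intro x hx
      rw [hT.subset_supp] at hx
      rcases mem_insert.1 hx with rfl | hx
      · exact (hy _ m1).1
      · exact support_mono (hsub q hq) hx
    have c1 := (hp _ m1).concat hT (fun x h1 h2 => (hy _ m1).2 x h1 (hTD x h2))
    have c2 := c1.concat (hp _ m2).reverse (by
      intro x h1 h2
      rcases mem_union.1 h1 with h1 | h1
      · exact absurd h2 (Finset.disjoint_left.1 (hdj _ m1 _ m2 hne) h1)
      · exact (hy _ m2).2 x h2 (hTD x h1))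
    have hane : a q.1 ≠ a q.2.1 := fun h =>
      Finset.disjoint_left.1 (hdj _ m1 _ m2 hne) (hp _ m1).start_mem (h ▸ (hp _ m2).start_mem)
    refine ⟨Or.inr ⟨{q.1}, {q.2.1}, _, a q.1, a q.2.1, _, ⟨uc_loop (hl _ m1).1 (hl _ m1).2,
      uc_loop (hl _ m2).1 (hl _ m2).2, by simpa using hne, c2, ?_, ?_, ?_, ?_, ?_⟩, rfl⟩, ?_⟩
    · rw [supp_loop (hl _ m1).1]; simp
    · rw [supp_loop (hl _ m2).1]; simp
    · intro x _ hx; rw [supp_loop (hl _ m1).1] at hx; simpa using hx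
    · intro x _ hx; rw [supp_loop (hl _ m2).1] at hx; simpa using hx
    · intro x h1 h2
      rw [supp_loop (hl _ m1).1] at h1
      rw [supp_loop (hl _ m2).1] at h2
      simp at h1 h2
      exact absurd (h1.symm.trans h2) hane
    · have k1 : p q.1 ⊆ B.biUnion p := subset_biUnion_of_mem p m1
      have k2 : p q.2.1 ⊆ B.biUnion p := subset_biUnion_of_mem p m2
      have k3 := hsub q hq
      simp only [hf]
      intro e he
      simp only [mem_union, mem_singleton] at he ⊢
      rcases he with (rfl | rfl) | (h | h) | h
      · exact Or.inl (Or.inl m1)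
      · exact Or.inl (Or.inl m2)
      · exact Or.inr (k1 h)
      · exact Or.inl (Or.inr (k3 h))
      · exact Or.inr (k2 h)
  · intro e he
    have : e ∈ (L.map (fun q => q.2.2)).flatten := by
      rw [hflat]; rw [qD, ← e1, ← e2] at he; simpa using he
    rw [List.mem_flatten] at this
    obtain ⟨l', hl', hel⟩ := this
    obtain ⟨q, hq, rfl⟩ := List.mem_map.1 hl'
    exact ⟨f q, List.mem_map_of_mem hq, by simp [hf, hel]⟩
  · intro l hlB
    rw [wd_cnt L f l l, hcnt, if_pos hlB]
    intro q hq
    obtain ⟨m1, m2⟩ := hmem q hq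
    refine ⟨(hseg q hq).1, ?_⟩
    have n1 : l ∉ q.2.2 := fun h => Finset.disjoint_left.1 hBD hlB (hsub q hq (by simpa using h))
    simp only [hf, mem_union, mem_singleton, List.mem_toFinset, hlS l hlB _ m1,
      hlS l hlB _ m2, n1, or_false, eq_comm]
  · unfold totalLength
    have h1 := cnt_sum hmem (fun l => 1 + (p l).card)
    have h2 := flat_len L (fun q => q.2.2) _ hflat
    have h3 : ∑ l ∈ B, cnt L l * (1 + (p l).card) = 2 * ∑ l ∈ B, (p l).card + 2 * B.card := by
      rw [Finset.card_eq_sum_ones, ← mul_add, ← Finset.sum_add_distrib, Finset.mul_sum]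
      apply Finset.sum_congr rfl
      intro l hlB
      rw [hcnt, if_pos hlB, add_comm]
    have h4 : (l1 ++ l2).length = D.card := by
      rw [List.length_append, n1, n2, qD, card_union_of_disjoint qd]
    have h5 : ((L.map f).map Finset.card).sum ≤
        (L.map (fun q => (1 + (p q.1).card + (1 + (p q.2.1).card)) + q.2.2.length)).sum := by
      rw [List.map_map]
      apply List.sum_le_sum
      intro q hq
      simp only [Function.comp, hf]
      have k1 := card_union_le ({q.1} ∪ {q.2.1}) (p q.1 ∪ q.2.2.toFinset ∪ p q.2.1)
      have k2 := card_union_le ({q.1} : Finset E) {q.2.1}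
      have k3 := card_union_le (p q.1 ∪ q.2.2.toFinset) (p q.2.1)
      have k4 := card_union_le (p q.1) q.2.2.toFinset
      have k5 := List.toFinset_card_le q.2.2
      simp only [Finset.card_singleton] at k2
      omega
    rw [List.sum_map_add, h1, h3, h2, h4] at h5
    omega

lemma reach_first {F D : Finset E} {u w : V} (h : Reach ends F u w) (hw : w ∈ support ends D) :
    ∃ y ∈ support ends D, Reach ends (F \ D) u y := by
  obtain ⟨A, S, hA, hp⟩ := Pth.of_reach h
  obtain ⟨y, A1, S1, A2, S2, p1, -, hy, hh, hAA, -, -, -⟩ := hp.first_hit (· ∈ support ends D)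
    ⟨w, hp.end_mem, hw⟩
  refine ⟨y, hy, (p1.reach y p1.end_mem).mono ?_⟩
  have := p1.dj_of (C := D) hh
  intro e he
  exact mem_sdiff.2 ⟨hA (hAA ▸ mem_union_left _ he), Finset.disjoint_right.1 this he⟩

lemma leaf {F : Finset E} (S : Finset (Finset E)) (hS : S.Nonempty) (t : Finset E → V)
    (hc : ∀ D ∈ S, Cyc ends D ∧ D ⊆ F ∧ t D ∈ support ends D)
    (hdj : ∀ D ∈ S, ∀ D' ∈ S, D ≠ D' → Disjoint D D')
    (hr : ∀ D ∈ S, ∀ D' ∈ S, Reach ends F (t D) (t D')) :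
    ∃ D0 ∈ S, ∀ D ∈ S.erase D0, ∀ D' ∈ S.erase D0, Reach ends (F \ D0) (t D) (t D') := by
  by_cases h2 : S.card ≤ 1
  · obtain ⟨D0, h0⟩ := hS
    refine ⟨D0, h0, fun D hD D' hD' => ?_⟩
    have := Finset.card_le_one.1 h2 D (mem_of_mem_erase hD) D0 h0
    exact absurd this (ne_of_mem_erase hD)
  push Not at h2
  obtain ⟨i, hi, j, hj, hij⟩ := Finset.one_lt_card.1 h2
  set m : Finset E × Finset E → Finset (Finset E) := fun q =>
    (S.erase q.1).filter (fun D => Reach ends (F \ q.1) (t q.2) (t D)) with hm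
  obtain ⟨⟨D0, x⟩, hq, hmax⟩ := Finset.exists_max_image
    ((S ×ˢ S).filter (fun q => q.1 ≠ q.2)) (fun q => (m q).card) ⟨(i, j), by simp [hi, hj, hij]⟩
  obtain ⟨hq, hne⟩ := mem_filter.1 hq
  obtain ⟨h0, hx⟩ := Finset.mem_product.1 hq
  simp only at h0 hx hne
  suffices h : ∀ D ∈ S.erase D0, Reach ends (F \ D0) (t x) (t D) from
    ⟨D0, h0, fun D hD D' hD' => (h D hD).sy.tr (h D' hD')⟩
  intro D1 hD1
  by_contra hno
  obtain ⟨hD10, hD1S⟩ := mem_erase.1 hD1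
  have hD1F : D1 ⊆ F \ D0 := fun e he => mem_sdiff.2 ⟨(hc D1 hD1S).2.1 he,
    Finset.disjoint_left.1 (hdj D1 hD1S D0 h0 hD10) he⟩
  have hsub : cE ends (F \ D0) (t x) ⊆ F \ D1 := by
    intro e he
    refine mem_sdiff.2 ⟨(mem_sdiff.1 (mem_filter.1 he).1).1, fun h => hno ?_⟩
    obtain ⟨y, hy⟩ : ∃ y, y ∈ ends e := ⟨_, Sym2.out_fst_mem (ends e)⟩
    exact (cE_reach he hy).tr (((hc D1 hD1S).1.reach (mem_support.2 ⟨e, h, hy⟩)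
      (hc D1 hD1S).2.2).mono hD1F)
  have key : ∀ v, Reach ends (F \ D0) (t x) v → Reach ends (F \ D1) (t x) v :=
    fun v h => (reach_cE h).mono hsub
  have hx1 : x ≠ D1 := by rintro rfl; exact hno Reach.rfl'
  obtain ⟨y, hy, hry⟩ := reach_first (hr x hx D0 h0) (hc D0 h0).2.2
  have hD0F : D0 ⊆ F \ D1 := fun e he => mem_sdiff.2 ⟨(hc D0 h0).2.1 he,
    Finset.disjoint_right.1 (hdj D1 hD1S D0 h0 hD10) he⟩
  have h1 := hmax (D1, x) (by simp [hD1S, hx, Ne.symm hx1])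
  have h3 : insert D0 (m (D0, x)) ⊆ m (D1, x) := by
    intro D hD
    rcases mem_insert.1 hD with rfl | hD
    · exact mem_filter.2 ⟨mem_erase.2 ⟨Ne.symm hD10, h0⟩, (key y hry).tr
        (((hc D h0).1.reach hy (hc D h0).2.2).mono hD0F)⟩
    · obtain ⟨k1, k2⟩ := mem_filter.1 hD
      refine mem_filter.2 ⟨mem_erase.2 ⟨?_, mem_of_mem_erase k1⟩, key _ k2⟩
      rintro rfl; exact hno k2
  have h4 := card_le_card h3
  rw [card_insert_of_notMem (by simp [hm])] at h4
  omega
end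

/-! case O -/
section
variable {ends : E → Sym2 V} {sgn : E → Bool}
lemma spoke {H U D : Finset E} (hU : U ⊆ H) (hUb : bd ends U = 0) {a y0 : V}
    (hy0 : y0 ∈ support ends D) (hr : Reach ends H a y0) :
    ∃ y p S, p ⊆ cE ends H a ∧ Pth ends a y p S ∧ y ∈ support ends D ∧
      (∀ x ∈ S, x ∈ support ends D → x = y) ∧ (∀ x ∈ S, Reach ends H a x) ∧
      2 * p.card + (U ∩ cE ends H a).card ≤ 2 * (cE ends H a).card := by
  obtain ⟨A, S, hA, hp⟩ := Pth.of_reach (reach_cE hr)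
  obtain ⟨J, hJ, hb, hc⟩ := tj_flip (U := U ∩ cE ends H a) inter_subset_right
    (bd_cE hU hUb a) hA
  obtain ⟨A', S', hA', hp'⟩ := Pth.of_reach (reach_of_bd (hb.trans hp.bd_eq))
  obtain ⟨y, A1, S1, A2, S2, h1, h2, h3, h4, h5, h6, h7, h8⟩ :=
    hp'.first_hit (fun x => x ∈ support ends D) ⟨y0, hp'.end_mem, hy0⟩
  have hAJ : A1 ⊆ J := (h5 ▸ subset_union_left).trans hA'
  refine ⟨y, A1, S1, hAJ.trans hJ, h1, h3, h4, ?_, ?_⟩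
  · intro x hx
    rw [h1.subset_supp, mem_insert, mem_support] at hx
    rcases hx with rfl | ⟨e, he, hx⟩
    · exact Reach.rfl'
    · exact cE_reach (hJ (hAJ he)) hx
  · have := card_le_card hAJ
    omega

lemma reach_outs {H : Finset E} {B : Finset E} {a : E → V} {u v : V}
    (hn : ∀ l ∈ B, ¬ Reach ends H (a l) u) (h : Reach ends H u v) :
    Reach ends (H \ B.biUnion (fun l => cE ends H (a l))) u v := by
  induction h with
  | refl => exact Reach.rfl'
  | @tail b c h1 h2 ih =>
    obtain ⟨e, he, hbc⟩ := h2
    refine ih.tr (Reach.edge (mem_sdiff.2 ⟨he, ?_⟩) hbc)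
    intro hm
    obtain ⟨l, hl, hel⟩ := mem_biUnion.1 hm
    exact hn l hl ((cE_reach hel (by rw [hbc]; simp : b ∈ ends e)).tr (Reach.sy h1))

lemma bd_outs {H U : Finset E} (hU : U ⊆ H) (hb : bd ends U = 0) (B : Finset E) (a : E → V) :
    bd ends (U \ B.biUnion (fun l => cE ends H (a l))) = 0 := by
  ext v
  by_cases h : ∃ l ∈ B, Reach ends H (a l) v
  · obtain ⟨l, hl, hr⟩ := h
    rw [bd_congr (B := ∅), bd_empty]
    intro e he
    simp only [mem_sdiff, mem_biUnion, Finset.notMem_empty, iff_false]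
    rintro ⟨h1, h2⟩
    exact h2 ⟨l, hl, mem_filter.2 ⟨hU h1, v, he, hr⟩⟩
  · rw [bd_congr (B := U), hb]
    intro e he
    simp only [mem_sdiff, mem_biUnion, and_iff_left_iff_imp]
    rintro h1 ⟨l, hl, hm⟩
    exact h ⟨l, hl, cE_reach hm he⟩

lemma card_outs {H U : Finset E} (hU : U ⊆ H) (B : Finset E) (a : E → V)
    (hd : ∀ l ∈ B, ∀ l' ∈ B, l ≠ l' → ¬ Reach ends H (a l) (a l')) :
    (U \ B.biUnion (fun l => cE ends H (a l))).card + ∑ l ∈ B, (U ∩ cE ends H (a l)).card = U.card := by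
  rw [← Finset.card_biUnion, ← Finset.inter_biUnion]
  · exact Finset.card_sdiff_add_card_inter _ _
  · intro l hl l' hl' hne
    rw [Function.onFun, Finset.disjoint_left]
    intro e he he'
    have h1 := (mem_inter.1 he).2
    have h2 := (mem_inter.1 he').2
    obtain ⟨x, y, hxy⟩ : ∃ x y, ends e = s(x, y) := ⟨_, _, (Quot.out_eq (ends e)).symm⟩
    have hx : x ∈ ends e := by rw [hxy]; simp
    exact hd l hl l' hl' hne ((cE_reach h1 hx).tr (cE_reach h2 hx).sy)

lemma IsDec.erase {A D : Finset E} {P : Finset (Finset E)} (h : IsDec ends A P) (hD : D ∈ P) :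
    IsDec ends (A \ D) (P.erase D) := by
  have h1 := h.subset (erase_subset D P)
  have : (P.erase D).biUnion id = A \ D := by
    ext e
    rw [← h.2.2]
    simp only [mem_biUnion, mem_erase, id, mem_sdiff]
    constructor
    · rintro ⟨C, ⟨h1, h2⟩, h3⟩
      exact ⟨⟨C, h2, h3⟩, Finset.disjoint_left.1 (h.2.1 C h2 D hD h1) h3⟩
    · rintro ⟨⟨C, h2, h3⟩, h4⟩
      exact ⟨C, ⟨fun h => h4 (h ▸ h3), h2⟩, h3⟩
  rwa [this] at h1

lemma caseO {F Z' Λ : Finset E} {P : Finset (Finset E)} (hconn : ConnectedOn ends F)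
    (hΛ : Λ ⊆ F) (hlp : ∀ l ∈ Λ, (∃ a, ends l = s(a, a)) ∧ sgn l = true)
    (hZ : Z' ⊆ F \ Λ) (hP : IsDec ends Z' P) (hodd : Odd (ub sgn P).card)
    (hsh : ∀ D ∈ ub sgn P, ∀ D' ∈ ub sgn P, D ≠ D' → Sh ends D D')
    (hne : Λ.Nonempty ∨ 1 < (ub sgn P).card) : Cov ends sgn F (Z' ∪ Λ) Λ := by
  have hune : (ub sgn P).Nonempty := Finset.card_pos.1 hodd.pos
  haveI hV : Nonempty V := by
    obtain ⟨D, hD⟩ := hune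
    exact ⟨(hP.1 D (mem_filter.1 hD).1).supp_ne.choose⟩
  obtain ⟨t, ht⟩ := exists_t ends
  have hlu : ∀ l ∈ Λ, UC ends sgn {l} := fun l hl =>
    uc_loop (hlp l hl).1.choose_spec (hlp l hl).2
  have hcy : ∀ i ∈ ub sgn P ∪ lp Λ, Cyc ends i ∧ i ⊆ F := by
    intro i hi
    rcases mem_union.1 hi with h | h
    · have := (mem_filter.1 h).1
      exact ⟨hP.1 i this, ((hP.sub this).trans hZ).trans sdiff_subset⟩
    · obtain ⟨l, hl, rfl⟩ := mem_lp.1 h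
      exact ⟨(hlu l hl).1, by simpa using hΛ hl⟩
  have hdj : Disjoint (ub sgn P) (lp Λ) := by
    rw [Finset.disjoint_left]
    intro i hi h
    obtain ⟨l, hl, rfl⟩ := mem_lp.1 h
    have := hZ (hP.sub (mem_filter.1 hi).1 (Finset.mem_singleton_self l))
    exact (mem_sdiff.1 this).2 hl
  have hShAll : ∀ i ∈ ub sgn P ∪ lp Λ, ∀ j ∈ ub sgn P ∪ lp Λ, i ≠ j → Sh ends i j := by
    intro i hi j hj hij
    rcases mem_union.1 hi with h1 | h1
    · rcases mem_union.1 hj with h2 | h2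
      · exact hsh _ h1 _ h2 hij
      · obtain ⟨l, hl, h⟩ := mem_lp.1 h2
        rw [← h]; exact Sh.loop (hlp l hl).1.choose_spec
    · obtain ⟨l, hl, h⟩ := mem_lp.1 h1
      rw [← h]; exact (Sh.loop (hlp l hl).1.choose_spec).sy
  have hr0 : ∀ i ∈ ub sgn P ∪ lp Λ, ∀ j ∈ ub sgn P ∪ lp Λ, Reach ends (F \ Λ) (t i) (t j) :=
    fun i hi j hj => loop_reach (fun l hl => (hlp l hl).1)
      (hconn _ (support_mono (hcy i hi).2 (ht i (hcy i hi).1))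
        _ (support_mono (hcy j hj).2 (ht j (hcy j hj).1)))
  have hubF : ∀ i ∈ ub sgn P, i ⊆ Z' := fun i hi => hP.sub (mem_filter.1 hi).1
  obtain ⟨D0, hD0, hleaf⟩ := leaf (F := F \ Λ) (ub sgn P) hune t
    (fun D hD => ⟨(hcy D (mem_union_left _ hD)).1, (hubF D hD).trans hZ,
      ht _ (hcy D (mem_union_left _ hD)).1⟩)
    (fun D hD D' hD' h => hP.2.1 _ (mem_filter.1 hD).1 _ (mem_filter.1 hD').1 h)
    (fun D hD D' hD' => hr0 D (mem_union_left _ hD) D' (mem_union_left _ hD'))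
  set S1 := (ub sgn P).erase D0 with hS1
  set H := (F \ Λ) \ D0 with hH
  set U := Z' \ D0 with hU
  have hD0P := (mem_filter.1 hD0).1
  have hPe : IsDec ends U (P.erase D0) := hP.erase hD0P
  have hUb := hPe.even
  have hUH : U ⊆ H := sdiff_subset_sdiff hZ subset_rfl
  have hS1e : Even S1.card := by
    rw [hS1, Finset.card_erase_of_mem hD0]
    obtain ⟨k, hk⟩ := hodd
    exact ⟨k, by omega⟩
  have hS1d : Disjoint S1 (lp Λ) := hdj.mono_left (erase_subset _ _)
  have hD0l : D0 ∉ lp Λ := Finset.disjoint_left.1 hdj hD0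
  have hD0c := (hcy D0 (mem_union_left _ hD0)).1
  have hSsub : S1 ∪ lp Λ ⊆ ub sgn P ∪ lp Λ :=
    Finset.union_subset_union (erase_subset _ _) subset_rfl
  have hc1 : (F \ Λ).card + Λ.card = F.card := card_sdiff_add_card_eq_card hΛ
  have hc2 : H.card + D0.card = (F \ Λ).card :=
    card_sdiff_add_card_eq_card ((hubF D0 hD0).trans hZ)
  have hc3 : U.card + D0.card = Z'.card := card_sdiff_add_card_eq_card (hubF D0 hD0)
  have hsum : ∑ i ∈ ub sgn P, i.card = ∑ i ∈ S1, i.card + D0.card :=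
    (Finset.sum_erase_add _ _ hD0).symm
  -- S1 filters are even
  have hfe : ∀ (K : Finset E) (t' : Finset E → V) (x : V),
      (∀ i ∈ S1, ∀ j ∈ S1, Reach ends K (t' i) (t' j)) →
      Even (S1.filter (fun j => Reach ends K x (t' j))).card := by
    intro K t' x hK
    rcases (S1.filter (fun j => Reach ends K x (t' j))).eq_empty_or_nonempty with h | ⟨i, hi⟩
    · rw [h]; simp
    · rw [Finset.filter_true_of_mem]
      · exact hS1e
      · intro j hj
        exact (mem_filter.1 hi).2.tr (hK i (mem_filter.1 hi).1 j hj)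
  -- two elements
  have two : ∀ {S : Finset (Finset E)} {i j : Finset E}, i ∈ S → j ∈ S → i ≠ j → S.card ≠ 1 := by
    intro S i j hi hj hij h
    exact hij (Finset.card_le_one.1 h.le i hi j hj)
  set Bb := Λ.filter (fun l => ∀ j ∈ S1 ∪ lp Λ, Reach ends H (t {l}) (t j) → j = {l}) with hBb
  have hBΛ : Bb ⊆ Λ := filter_subset _ _
  have hspk : ∀ i ∈ ub sgn P ∪ lp Λ, ∃ y ∈ support ends D0, Reach ends H (t i) y := by
    intro i hi
    exact reach_first (hr0 i hi D0 (mem_union_left _ hD0)) (ht _ hD0c)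
  by_cases hB : Bb.card ≤ 1
  · obtain ⟨i0, hi0, hi0b⟩ : ∃ i0 ∈ S1 ∪ lp Λ, ∀ l ∈ Bb, {l} = i0 := by
      rcases Bb.eq_empty_or_nonempty with h | ⟨l, hl⟩
      · have : (S1 ∪ lp Λ).Nonempty := by
          rcases hne with ⟨l, hl⟩ | h1
          · exact ⟨{l}, mem_union_right _ (mem_lp.2 ⟨l, hl, rfl⟩)⟩
          · have : 0 < S1.card := by rw [hS1, Finset.card_erase_of_mem hD0]; omega
            obtain ⟨i, hi⟩ := Finset.card_pos.1 this
            exact ⟨i, mem_union_left _ hi⟩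
        obtain ⟨i, hi⟩ := this
        exact ⟨i, hi, by simp [h]⟩
      · refine ⟨{l}, mem_union_right _ (mem_lp.2 ⟨l, hBΛ hl, rfl⟩), fun l' hl' => ?_⟩
        rw [Finset.card_le_one.1 hB l' hl' l hl]
    obtain ⟨y, hy, hry⟩ := hspk i0 (hSsub hi0)
    set t' := Function.update t D0 y with ht'
    have htn : ∀ i ∈ S1 ∪ lp Λ, t' i = t i := by
      intro i hi
      rw [ht', Function.update_of_ne]
      rintro rfl
      rcases mem_union.1 hi with h | h
      · simp [hS1] at h
      · exact hD0l h
    have htD : t' D0 = y := by simp [ht']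
    have hi0n : i0 ≠ D0 := by
      rintro rfl
      rcases mem_union.1 hi0 with h | h
      · simp [hS1] at h
      · exact hD0l h
    have hd' : Disjoint S1 (insert D0 (lp Λ)) := by
      rw [Finset.disjoint_insert_right]
      exact ⟨by simp [hS1], hS1d⟩
    have hS' : S1 ∪ insert D0 (lp Λ) = ub sgn P ∪ lp Λ := by
      rw [Finset.union_insert, ← Finset.insert_union, hS1, insert_erase hD0]
    have hK : ∀ i ∈ S1, ∀ j ∈ S1, Reach ends H (t' i) (t' j) := by
      intro i hi j hj
      rw [htn i (mem_union_left _ hi), htn j (mem_union_left _ hj)]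
      exact hleaf i hi j hj
    obtain ⟨L, g1, g2, g3⟩ := GPglob t' _ H U S1 (insert D0 (lp Λ)) rfl hUH hUb hd' (by
      intro i hi
      refine ⟨hfe H t' _ hK, fun he => ?_⟩
      have hS1n : ∀ j ∈ S1, ¬ Reach ends H (t' i) (t' j) := by
        intro j hj hr
        exact Finset.eq_empty_iff_forall_notMem.1 he j (mem_filter.2 ⟨hj, hr⟩)
      have hi2 : i ∈ insert D0 (lp Λ) := by
        rcases mem_union.1 hi with h | h
        · exact absurd Reach.rfl' (hS1n i h)
        · exact h
      have hii : i ∈ (insert D0 (lp Λ)).filter (fun j => Reach ends H (t' i) (t' j)) :=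
        mem_filter.2 ⟨hi2, Reach.rfl'⟩
      have fin : ∀ j ∈ S1 ∪ lp Λ, j ≠ i → Reach ends H (t' i) (t' j) →
          ((insert D0 (lp Λ)).filter (fun j => Reach ends H (t' i) (t' j))).card ≠ 1 := by
        intro j hj hji hr
        rcases mem_union.1 hj with h | h
        · exact absurd hr (hS1n j h)
        · exact two hii (mem_filter.2 ⟨mem_insert_of_mem h, hr⟩) hji.symm
      rcases mem_insert.1 hi2 with rfl | hl
      · refine fin i0 hi0 hi0n ?_
        rw [htD, htn i0 hi0]; exact hry.sy
      · obtain ⟨l, hlΛ, rfl⟩ := mem_lp.1 hl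
        have hl' : {l} ∈ S1 ∪ lp Λ := mem_union_right _ hl
        by_cases hb : l ∈ Bb
        · have := hi0b l hb
          refine two hii (j := D0) (mem_filter.2 ⟨mem_insert_self _ _, ?_⟩) (this ▸ hi0n)
          rw [htD, htn _ hl', this]; exact hry
        · have : ∃ j ∈ S1 ∪ lp Λ, Reach ends H (t {l}) (t j) ∧ j ≠ {l} := by
            by_contra hcon
            push Not at hcon
            exact hb (mem_filter.2 ⟨hlΛ, hcon⟩)
          obtain ⟨j, hj, hr, hjl⟩ := this
          exact fin j hj hjl (by rw [htn _ hl', htn j hj]; exact hr))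
    refine FIN hP hZ sdiff_subset hΛ g1 g2 hd' hS' (subset_insert _ _) hlu ?_ ?_ ?_
    · intro i hi
      by_cases h : i = D0
      · rw [h, htD]; exact hy
      · rw [ht', Function.update_of_ne h]; exact ht i (hcy i hi).1
    · intro p hp
      have h0 : ∀ i, 0 < cnt L i → i ∈ ub sgn P ∪ lp Λ := by
        intro i hi
        rw [g2] at hi
        rw [← hS', mem_union]
        by_contra h
        push Not at h
        simp only [h.1, h.2, if_false] at hi
        omega
      exact hShAll _ (h0 _ (cnt_pos hp).1) _ (h0 _ (cnt_pos hp).2) (g1 p hp).1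
    · rw [Finset.sum_insert hD0l, lp_sum, hsum]
      omega
  · -- many bad loops
    have hbad : ∀ l ∈ Bb, ∀ j ∈ S1 ∪ lp Λ, Reach ends H (t {l}) (t j) → j = {l} :=
      fun l hl => (mem_filter.1 hl).2
    have hlpB : ∀ l ∈ Bb, {l} ∈ lp Λ := fun l hl => mem_lp.2 ⟨l, hBΛ hl, rfl⟩
    have hsp : ∀ l : E, ∃ y p S, l ∈ Bb → p ⊆ cE ends H (t {l}) ∧ Pth ends (t {l}) y p S ∧
        y ∈ support ends D0 ∧
        (∀ x ∈ S, x ∈ support ends D0 → x = y) ∧ (∀ x ∈ S, Reach ends H (t {l}) x) ∧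
        2 * p.card + (U ∩ cE ends H (t {l})).card ≤ 2 * (cE ends H (t {l})).card := by
      intro l
      by_cases hl : l ∈ Bb
      · obtain ⟨y0, hy0, hr⟩ := hspk {l} (mem_union_right _ (hlpB l hl))
        obtain ⟨y, p, S, h⟩ := spoke hUH hUb hy0 hr
        exact ⟨y, p, S, fun _ => h⟩
      · exact ⟨Classical.arbitrary V, ∅, ∅, fun h => absurd h hl⟩
    choose y p S hsp using hsp
    have hnr : ∀ l ∈ Bb, ∀ l' ∈ Bb, l ≠ l' → ¬ Reach ends H (t {l}) (t {l'}) := by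
      intro l hl l' hl' hne hr
      have := hbad l hl {l'} (mem_union_right _ (hlpB l' hl')) hr
      exact hne (by simpa using this.symm)
    have hBD : Disjoint Bb D0 := by
      rw [Finset.disjoint_left]
      intro l hl h
      exact (mem_sdiff.1 (hZ (hubF D0 hD0 h))).2 (hBΛ hl)
    have hends : ∀ l ∈ Λ, ends l = s(t {l}, t {l}) := by
      intro l hl
      obtain ⟨a, ha⟩ := (hlp l hl).1
      have := ht {l} (hlu l hl).1
      rw [supp_loop ha, mem_singleton] at this
      rw [this, ha]
    obtain ⟨𝒜, a1, a2, a3, a4⟩ := ARC (sgn := sgn) hD0c Bb (by omega) (fun l => t {l}) y p S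
      (fun l hl => ⟨hends l (hBΛ hl), (hlp l (hBΛ hl)).2⟩) (fun l hl => (hsp l hl).2.1)
      (fun l hl => ⟨(hsp l hl).2.2.1, (hsp l hl).2.2.2.1⟩) (by
        intro l hl l' hl' hne
        rw [Finset.disjoint_left]
        intro x hx hx'
        exact hnr l hl l' hl' hne (((hsp l hl).2.2.2.2.1 x hx).tr ((hsp l' hl').2.2.2.2.1 x hx').sy)) hBD
    set O := Bb.biUnion (fun l => cE ends H (t {l})) with hO
    have hgr : ∀ i ∈ S1 ∪ lp (Λ \ Bb), ∀ l ∈ Bb, ¬ Reach ends H (t {l}) (t i) := by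
      intro i hi l hl hr
      have hi' : i ∈ S1 ∪ lp Λ := by
        rcases mem_union.1 hi with h | h
        · exact mem_union_left _ h
        · obtain ⟨l', hl', rfl⟩ := mem_lp.1 h
          exact mem_union_right _ (mem_lp.2 ⟨l', (mem_sdiff.1 hl').1, rfl⟩)
      have := hbad l hl i hi' hr
      subst this
      rcases mem_union.1 hi with h | h
      · exact Finset.disjoint_left.1 hS1d h (hlpB l hl)
      · obtain ⟨l', hl', he⟩ := mem_lp.1 h
        rw [Finset.singleton_inj] at he
        subst he
        exact (mem_sdiff.1 hl').2 hl
    have hgR : ∀ i ∈ S1 ∪ lp (Λ \ Bb), ∀ x, Reach ends H (t i) x → Reach ends (H \ O) (t i) x :=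
      fun i hi x h => reach_outs (fun l hl => hgr i hi l hl) h
    have hlpm : lp (Λ \ Bb) ⊆ lp Λ := Finset.image_subset_image sdiff_subset
    have hd' : Disjoint S1 (lp (Λ \ Bb)) := hS1d.mono_right hlpm
    obtain ⟨L, g1, g2, g3⟩ := GPglob t _ (H \ O) (U \ O) S1 (lp (Λ \ Bb)) rfl
      (sdiff_subset_sdiff hUH subset_rfl) (bd_outs hUH hUb _ _) hd' (by
      intro i hi
      refine ⟨hfe _ t _ (fun i hi j hj => hgR i (mem_union_left _ hi) _ (hleaf i hi j hj)),
        fun he => ?_⟩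
      have hS1n : ∀ j ∈ S1, ¬ Reach ends (H \ O) (t i) (t j) := by
        intro j hj hr
        exact Finset.eq_empty_iff_forall_notMem.1 he j (mem_filter.2 ⟨hj, hr⟩)
      have hi2 : i ∈ lp (Λ \ Bb) := by
        rcases mem_union.1 hi with h | h
        · exact absurd Reach.rfl' (hS1n i h)
        · exact h
      have hii : i ∈ (lp (Λ \ Bb)).filter (fun j => Reach ends (H \ O) (t i) (t j)) :=
        mem_filter.2 ⟨hi2, Reach.rfl'⟩
      obtain ⟨l, hlΛ, rfl⟩ := mem_lp.1 hi2
      rw [mem_sdiff] at hlΛ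
      have : ∃ j ∈ S1 ∪ lp Λ, Reach ends H (t {l}) (t j) ∧ j ≠ {l} := by
        by_contra hcon
        push Not at hcon
        exact hlΛ.2 (mem_filter.2 ⟨hlΛ.1, hcon⟩)
      obtain ⟨j, hj, hr, hjl⟩ := this
      rcases mem_union.1 hj with h | h
      · exact absurd (hgR _ hi _ hr) (hS1n j h)
      · obtain ⟨l', hl', rfl⟩ := mem_lp.1 h
        refine two hii (mem_filter.2 ⟨mem_lp.2 ⟨l', mem_sdiff.2 ⟨hl', ?_⟩, rfl⟩,
          hgR _ hi _ hr⟩) hjl.symm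
        intro hb
        exact hgr _ hi l' hb hr.sy)
    have hube : ub sgn (P.erase D0) = S1 := by
      rw [hS1]; unfold ub; rw [Finset.filter_erase]
    have hFF : (F \ Bb) \ (Λ \ Bb) = F \ Λ := by
      ext e
      simp only [mem_sdiff]
      constructor
      · rintro ⟨⟨h1, h2⟩, h3⟩
        exact ⟨h1, fun h => h3 ⟨h, h2⟩⟩
      · rintro ⟨h1, h2⟩
        exact ⟨⟨h1, fun h => h2 (hBΛ h)⟩, fun h => h2 h.1⟩
    have hUF : U ⊆ F \ Λ := hUH.trans sdiff_subset
    obtain ⟨𝒞, c1, c2, c3, c4⟩ := FIN (sgn := sgn) (M := siz L + 2 * (Λ \ Bb).card + U.card)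
      (F := F \ Bb) (Λ := Λ \ Bb) (H := H \ O) (Z' := U) hPe (by rwa [hFF])
      (by rw [hFF]; exact Finset.sdiff_subset.trans sdiff_subset)
      (sdiff_subset_sdiff hΛ subset_rfl) g1 g2 hd' (by rw [hube]) subset_rfl
      (fun l hl => hlu l (mem_sdiff.1 hl).1)
      (by
        intro i hi
        rw [hube] at hi
        exact ht i (hcy i (hSsub (Finset.union_subset_union subset_rfl hlpm hi))).1)
      (by
        intro q hq
        have h0 : ∀ i, 0 < cnt L i → i ∈ ub sgn P ∪ lp Λ := by
          intro i hi
          rw [g2] at hi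
          refine hSsub (Finset.union_subset_union subset_rfl hlpm ?_)
          rw [mem_union]
          by_contra h
          push Not at h
          simp only [h.1, h.2, if_false] at hi
          omega
        exact hShAll _ (h0 _ (cnt_pos hq).1) _ (h0 _ (cnt_pos hq).2) (g1 q hq).1)
      (by rw [lp_sum, hube]; omega)
    have hpH : ∀ l ∈ Bb, p l ⊆ H := fun l hl => (hsp l hl).1.trans (filter_subset _ _)
    have hASub : Bb ∪ D0 ∪ Bb.biUnion p ⊆ F := by
      refine union_subset (union_subset (hBΛ.trans hΛ)
        (((hubF D0 hD0).trans hZ).trans sdiff_subset)) ?_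
      rw [Finset.biUnion_subset]
      exact fun l hl => (hpH l hl).trans (Finset.sdiff_subset.trans sdiff_subset)
    refine ⟨𝒜 ++ 𝒞, ?_, ?_, ?_, ?_⟩
    · intro C hC
      rcases List.mem_append.1 hC with h | h
      · exact ⟨(a1 C h).1, (a1 C h).2.trans hASub⟩
      · exact ⟨(c1 C h).1, (c1 C h).2.trans sdiff_subset⟩
    · intro e he
      have hA : (∃ C ∈ 𝒜, e ∈ C) → ∃ C ∈ 𝒜 ++ 𝒞, e ∈ C :=
        fun ⟨C, h, h'⟩ => ⟨C, List.mem_append_left _ h, h'⟩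
      have hC : (∃ C ∈ 𝒞, e ∈ C) → ∃ C ∈ 𝒜 ++ 𝒞, e ∈ C :=
        fun ⟨C, h, h'⟩ => ⟨C, List.mem_append_right _ h, h'⟩
      by_cases hD : e ∈ D0
      · exact hA (a2 e hD)
      by_cases hb : e ∈ Bb
      · refine hA ?_
        have := a3 e hb
        by_contra hcon
        push Not at hcon
        rw [wd_zero hcon] at this
        omega
      · refine hC (c2 e ?_)
        simp only [mem_union, hU, mem_sdiff] at he ⊢
        tauto
    · rw [tl_app]
      have e1 := card_outs hUH Bb (fun l => t {l}) hnr
      have e2 := card_outs (subset_refl H) Bb (fun l => t {l}) hnr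
      have e3 : ∀ l, H ∩ cE ends H (t {l}) = cE ends H (t {l}) := fun l =>
        Finset.inter_eq_right.2 (filter_subset _ _)
      simp only [e3] at e2
      have e4 : 2 * ∑ l ∈ Bb, (p l).card + ∑ l ∈ Bb, (U ∩ cE ends H (t {l})).card ≤
          2 * ∑ l ∈ Bb, (cE ends H (t {l})).card := by
        rw [Finset.mul_sum, Finset.mul_sum, ← Finset.sum_add_distrib]
        exact Finset.sum_le_sum (fun l hl => (hsp l hl).2.2.2.2.2)
      have e5 := card_sdiff_add_card_eq_card hBΛ
      rw [← hO] at e1 e2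
      omega
    · intro l hl
      rw [wd_app]
      by_cases hb : l ∈ Bb
      · rw [a3 l hb, wd_zero (fun C hC h => (mem_sdiff.1 ((c1 C hC).2 h)).2 hb)]
      · rw [c4 l (mem_sdiff.2 ⟨hl, hb⟩), wd_zero]
        intro C hC h
        have hF0 : l ∉ F \ Λ := fun h => (mem_sdiff.1 h).2 hl
        rcases mem_union.1 ((a1 C hC).2 h) with h | h
        · rcases mem_union.1 h with h | h
          · exact hb h
          · exact hF0 (hZ (hubF D0 hD0 h))
        · obtain ⟨l', hl', h⟩ := mem_biUnion.1 h
          exact hF0 (sdiff_subset (hpH l' hl' h))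
end

/-! chord families -/
section
variable {ends : E → Sym2 V} {sgn : E → Bool}
lemma closed_reach {F : Finset E} {W : Finset V}
    (hW : ∀ e ∈ F, ∀ a b, ends e = s(a, b) → a ∈ W → b ∈ W) {x y : V} (h : Reach ends F x y)
    (hx : x ∈ W) : y ∈ W := by
  induction h with
  | refl => exact hx
  | tail _ h ih =>
    obtain ⟨e, he, hab⟩ := h
    exact hW e he _ _ hab ih

lemma ends_ex (ends : E → Sym2 V) (e : E) : ∃ a b, ends e = s(a, b) :=
  ⟨_, _, (Quot.out_eq (ends e)).symm⟩

lemma Pth.edge_split {u v : V} {A : Finset E} {S : Finset V} (h : Pth ends u v A S) {e : E}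
    (he : e ∈ A) : ∃ a b A1 S1 A2 S2, Pth ends u a A1 S1 ∧ ends e = s(a, b) ∧ Pth ends b v A2 S2 ∧
      A = insert e (A1 ∪ A2) ∧ S = S1 ∪ S2 ∧ Disjoint S1 S2 := by
  induction h with
  | nil v => simp at he
  | @cons u w v f A S hf hu hp ih =>
    by_cases hef : e = f
    · subst hef
      exact ⟨u, w, ∅, {u}, A, S, Pth.nil u, hf, hp, by simp, rfl, by simpa using hu⟩
    · obtain ⟨a, b, A1, S1, A2, S2, h1, h2, h3, rfl, rfl, h6⟩ :=
        ih ((mem_insert.1 he).resolve_left hef)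
      rw [mem_union, not_or] at hu
      refine ⟨a, b, insert f A1, insert u S1, A2, S2, Pth.cons hf hu.1 h1, h2, h3, ?_, ?_, ?_⟩
      · rw [Finset.insert_union, Finset.insert_comm]
      · rw [Finset.insert_union]
      · rw [Finset.disjoint_insert_left]; exact ⟨hu.2, h6⟩

/-- two sides of a removed edge are separated -/
lemma sep_side {A1 A2 : Finset E} {e : E} {S1 S2 : Finset V}
    (h1 : ∀ f ∈ A1, ∀ x ∈ ends f, x ∈ S1) (h2 : ∀ f ∈ A2, ∀ x ∈ ends f, x ∈ S2)
    (hd : Disjoint S1 S2) {n m : E} (hn : n ∈ A1) (hm : m ∈ A2)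
    (h : ∀ x ∈ ends n, ∀ y ∈ ends m, Reach ends ((insert e (A1 ∪ A2)).erase e) x y) : False := by
  obtain ⟨x, x', hx⟩ := ends_ex ends n
  obtain ⟨y, y', hy⟩ := ends_ex ends m
  have hxn : x ∈ ends n := by rw [hx]; simp
  have hym : y ∈ ends m := by rw [hy]; simp
  have := closed_reach (W := S1) (by
    intro f hf a b hab ha
    have hf' := (mem_insert.1 (mem_erase.1 hf).2).resolve_left (mem_erase.1 hf).1
    rcases mem_union.1 hf' with h | h
    · exact h1 f h b (by rw [hab]; simp)
    · exact absurd (h2 f h a (by rw [hab]; simp)) (Finset.disjoint_left.1 hd ha)) (h x hxn y hym)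
    (h1 n hn x hxn)
  exact Finset.disjoint_left.1 hd this (h2 m hm y hym)

lemma three_aux {u v : V} {A : Finset E} {S : Finset V} (h : Pth ends u v A S) {n1 n2 n3 : E}
    {a b : V} {A1 S1 A2 S2} (p1 : Pth ends u a A1 S1) (he : ends n1 = s(a, b))
    (p2 : Pth ends b v A2 S2) (hA : A = insert n1 (A1 ∪ A2)) (hS : S = S1 ∪ S2)
    (hd : Disjoint S1 S2) (h2 : n2 ∈ A2) (h3 : n3 ∈ A2) (h23 : n2 ≠ n3)
    (c2 : ∀ x ∈ ends n1, ∀ y ∈ ends n3, Reach ends (A.erase n2) x y)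
    (c3 : ∀ x ∈ ends n1, ∀ y ∈ ends n2, Reach ends (A.erase n3) x y) : False := by
  obtain ⟨c, d, B1, T1, B2, T2, q1, hq, q2, rfl, rfl, hd'⟩ := p2.edge_split h2
  have hd1 := (Finset.disjoint_union_right.1 hd).1
  have hd2 := (Finset.disjoint_union_right.1 hd).2
  rcases mem_union.1 ((mem_insert.1 h3).resolve_left h23.symm) with h | h
  · obtain ⟨c', d', B1', T1', B2', T2', q1', hq', q2', rfl, rfl, hd''⟩ := q1.edge_split h
    have hdx := (Finset.disjoint_union_left.1 hd')
    have hdy := (Finset.disjoint_union_right.1 hd1)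
    refine sep_side (ends := ends) (e := n3) (A1 := insert n1 (A1 ∪ B1')) (A2 := insert n2 (B2' ∪ B2))
      (S1 := S1 ∪ T1') (S2 := T2' ∪ T2) (n := n1) (m := n2) ?_ ?_ ?_ (by simp) (by simp) ?_
    · intro f hf x hx
      simp only [mem_insert, mem_union] at hf ⊢
      rcases hf with rfl | hf | hf
      · rw [he, Sym2.mem_iff] at hx
        rcases hx with rfl | rfl
        · exact Or.inl p1.end_mem
        · exact Or.inr q1'.start_mem
      · exact Or.inl (p1.ends_mem f hf x hx)
      · exact Or.inr (q1'.ends_mem f hf x hx)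
    · intro f hf x hx
      simp only [mem_insert, mem_union] at hf ⊢
      rcases hf with rfl | hf | hf
      · rw [hq, Sym2.mem_iff] at hx
        rcases hx with rfl | rfl
        · exact Or.inl q2'.end_mem
        · exact Or.inr q2.start_mem
      · exact Or.inl (q2'.ends_mem f hf x hx)
      · exact Or.inr (q2.ends_mem f hf x hx)
    · simp only [Finset.disjoint_union_left, Finset.disjoint_union_right]
      exact ⟨⟨hdy.2, hd''⟩, hd2, hdx.1⟩
    · convert c3 using 6
      rw [hA]; ext f; simp only [mem_insert, mem_union]; tauto
  · refine sep_side (ends := ends) (e := n2) (A1 := insert n1 (A1 ∪ B1)) (A2 := B2)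
      (S1 := S1 ∪ T1) (S2 := T2) (n := n1) (m := n3) ?_ q2.ends_mem ?_ (by simp) h ?_
    · intro f hf x hx
      simp only [mem_insert, mem_union] at hf ⊢
      rcases hf with rfl | hf | hf
      · rw [he, Sym2.mem_iff] at hx
        rcases hx with rfl | rfl
        · exact Or.inl p1.end_mem
        · exact Or.inr q1.start_mem
      · exact Or.inl (p1.ends_mem f hf x hx)
      · exact Or.inr (q1.ends_mem f hf x hx)
    · rw [Finset.disjoint_union_left]; exact ⟨hd2, hd'⟩
    · convert c2 using 6
      rw [hA]; ext f; simp only [mem_insert, mem_union]; tauto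

lemma three_pth {u v : V} {A : Finset E} {S : Finset V} (h : Pth ends u v A S) {n1 n2 n3 : E}
    (h1 : n1 ∈ A) (h2 : n2 ∈ A) (h3 : n3 ∈ A) (h12 : n1 ≠ n2) (h13 : n1 ≠ n3) (h23 : n2 ≠ n3)
    (c1 : ∀ x ∈ ends n2, ∀ y ∈ ends n3, Reach ends (A.erase n1) x y)
    (c2 : ∀ x ∈ ends n1, ∀ y ∈ ends n3, Reach ends (A.erase n2) x y)
    (c3 : ∀ x ∈ ends n1, ∀ y ∈ ends n2, Reach ends (A.erase n3) x y) : False := by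
  obtain ⟨a, b, A1, S1, A2, S2, p1, he, p2, hA, hS, hd⟩ := h.edge_split h1
  have m2 : n2 ∈ A1 ∪ A2 := (mem_insert.1 (hA ▸ h2)).resolve_left h12.symm
  have m3 : n3 ∈ A1 ∪ A2 := (mem_insert.1 (hA ▸ h3)).resolve_left h13.symm
  rcases mem_union.1 m2 with m2 | m2 <;> rcases mem_union.1 m3 with m3 | m3
  · refine three_aux (n1 := n1) h.reverse p2.reverse (by rw [he, Sym2.eq_swap]) p1.reverse
      (by rw [hA, Finset.union_comm]) (by rw [hS, Finset.union_comm]) hd.symm m2 m3 h23 c2 c3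
  · exact sep_side p1.ends_mem p2.ends_mem hd m2 m3 (hA ▸ c1)
  · exact sep_side p1.ends_mem p2.ends_mem hd m3 m2 (hA ▸ fun x hx y hy => (c1 y hy x hx).sy)
  · exact three_aux (n1 := n1) h p1 he p2 hA hS hd m2 m3 h23 c2 c3

lemma Pth.edge_reach {x y : V} {K : Finset E} {T : Finset V} (h : Pth ends x y K T) {n m : E}
    (hn : n ∈ K) (hm : m ∈ K) : ∀ z ∈ ends n, ∀ w ∈ ends m, Reach ends K z w :=
  fun z hz w hw => (h.reach z (h.ends_mem n hn z hz)).sy.tr (h.reach w (h.ends_mem m hm w hw))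

lemma CFIN {D N' : Finset E} (hD : Cyc ends D) (L : List (Finset E × Finset E))
    (hL : ∀ q ∈ L, q.2 ⊆ D ∧ Cyc ends (q.1 ∪ q.2) ∧ ng sgn (q.1 ∪ q.2) = 0 ∧
      ∃ x y T, Pth ends x y (D \ q.2) T) (hN : N' ⊆ D) (hc : ∀ e ∈ N', ∃ q ∈ L, e ∈ q.2) :
    ∃ 𝒞 : List (Finset E), (∀ C ∈ 𝒞, SC ends sgn C ∧ ∃ q ∈ L, C ⊆ q.1 ∪ D) ∧
      (∀ e ∈ N', ∃ C ∈ 𝒞, e ∈ C) ∧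
      totalLength 𝒞 ≤ 2 * D.card + (L.map (fun q => q.1.card)).sum := by
  obtain ⟨G, hG, hmin⟩ := Finset.exists_min_image
    (L.toFinset.powerset.filter (fun G => ∀ e ∈ N', ∃ q ∈ G, e ∈ q.2)) Finset.card
    ⟨L.toFinset, by simpa using fun e he => by simpa using hc e he⟩
  rw [mem_filter, Finset.mem_powerset] at hG
  obtain ⟨hGL, hGc⟩ := hG
  have hpriv : ∀ q ∈ G, ∃ n ∈ N', n ∈ q.2 ∧ ∀ q' ∈ G, q' ≠ q → n ∉ q'.2 := by
    intro q hq
    by_contra hcon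
    push Not at hcon
    have := hmin (G.erase q) (by
      rw [mem_filter, Finset.mem_powerset]
      refine ⟨(erase_subset _ _).trans hGL, fun e he => ?_⟩
      obtain ⟨q', hq', heq⟩ := hGc e he
      by_cases h : q' = q
      · subst h
        obtain ⟨q'', h1, h2, h3⟩ := hcon e he heq
        exact ⟨q'', mem_erase.2 ⟨h2, h1⟩, h3⟩
      · exact ⟨q', mem_erase.2 ⟨h, hq'⟩, heq⟩)
    rw [Finset.card_erase_of_mem hq] at this
    have := Finset.card_pos.2 ⟨q, hq⟩
    omega
  have hmul : ∀ d ∈ D, (G.filter (fun q => d ∈ q.2)).card ≤ 2 := by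
    intro d hd
    by_contra hcon
    push Not at hcon
    obtain ⟨q1, q2, q3, g1, g2, g3, h12, h13, h23⟩ := Finset.two_lt_card_iff.1 hcon
    rw [mem_filter] at g1 g2 g3
    obtain ⟨n1, hn1, m1, r1⟩ := hpriv q1 g1.1
    obtain ⟨n2, hn2, m2, r2⟩ := hpriv q2 g2.1
    obtain ⟨n3, hn3, m3, r3⟩ := hpriv q3 g3.1
    obtain ⟨a, b, hab⟩ := ends_ex ends d
    have hp := hD.path hd hab
    have hne : ∀ {n n'} {q : Finset E × Finset E}, n ∉ q.2 → n' ∈ q.2 → n ≠ n' := by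
      rintro n n' q h h' rfl; exact h h'
    have key : ∀ q ∈ G, d ∈ q.2 → ∀ n m k, n ∈ q.2 → m ∈ D → k ∈ D → m ∉ q.2 → k ∉ q.2 →
        ∀ x ∈ ends m, ∀ y ∈ ends k, Reach ends ((D.erase d).erase n) x y := by
      intro q hq hdq n m k hn hm hk hmq hkq x hx y hy
      obtain ⟨x0, y0, T, hT⟩ := (hL q (by simpa using hGL hq)).2.2.2
      refine (hT.edge_reach (mem_sdiff.2 ⟨hm, hmq⟩) (mem_sdiff.2 ⟨hk, hkq⟩)
        x hx y hy).mono ?_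
      intro f hf
      rw [mem_sdiff] at hf
      exact mem_erase.2 ⟨hne hf.2 hn, mem_erase.2 ⟨hne hf.2 hdq, hf.1⟩⟩
    refine three_pth hp (n1 := n1) (n2 := n2) (n3 := n3) ?_ ?_ ?_ ?_ ?_ ?_
      (key q1 g1.1 g1.2 n1 n2 n3 m1 (hN hn2) (hN hn3) (r2 q1 g1.1 h12) (r3 q1 g1.1 h13))
      (key q2 g2.1 g2.2 n2 n1 n3 m2 (hN hn1) (hN hn3) (r1 q2 g2.1 h12.symm) (r3 q2 g2.1 h23))
      (key q3 g3.1 g3.2 n3 n1 n2 m3 (hN hn1) (hN hn2) (r1 q3 g3.1 h13.symm) (r2 q3 g3.1 h23.symm))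
    · exact mem_erase.2 ⟨hne (r1 q2 g2.1 h12.symm) g2.2, hN hn1⟩
    · exact mem_erase.2 ⟨hne (r2 q1 g1.1 h12) g1.2, hN hn2⟩
    · exact mem_erase.2 ⟨hne (r3 q1 g1.1 h13) g1.2, hN hn3⟩
    · exact hne (r1 q2 g2.1 h12.symm) m2
    · exact hne (r1 q3 g3.1 h13.symm) m3
    · exact hne (r2 q3 g3.1 h23.symm) m3
  have hsumI : ∑ q ∈ G, q.2.card ≤ 2 * D.card := by
    have : ∀ q ∈ G, q.2.card = ∑ e ∈ D, if e ∈ q.2 then 1 else 0 := by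
      intro q hq
      rw [← Finset.card_filter, Finset.filter_mem_eq_inter,
        Finset.inter_eq_right.2 (hL q (by simpa using hGL hq)).1]
    rw [Finset.sum_congr rfl this, Finset.sum_comm]
    calc ∑ e ∈ D, ∑ q ∈ G, (if e ∈ q.2 then 1 else 0) ≤ ∑ e ∈ D, 2 := by
          refine Finset.sum_le_sum (fun e he => ?_)
          rw [← Finset.card_filter]; exact hmul e he
      _ = 2 * D.card := by simp [mul_comm]
  have hsumQ : ∑ q ∈ G, q.1.card ≤ (L.map (fun q => q.1.card)).sum := by
    rw [Finset.sum_list_map_count]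
    refine (Finset.sum_le_sum_of_subset hGL).trans (Finset.sum_le_sum (fun q hq => ?_))
    rw [smul_eq_mul]
    exact Nat.le_mul_of_pos_left _ ((@List.count_pos_iff _ instBEqOfDecidableEq inferInstance _ _).2 (List.mem_toFinset.1 hq))
  refine ⟨G.toList.map (fun q => q.1 ∪ q.2), ?_, ?_, ?_⟩
  · intro C hC
    obtain ⟨q, hq, rfl⟩ := List.mem_map.1 hC
    have hqL : q ∈ L := by simpa using hGL (Finset.mem_toList.1 hq)
    exact ⟨Or.inl ⟨(hL q hqL).2.1, (hL q hqL).2.2.1⟩, q, hqL,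
      Finset.union_subset_union subset_rfl (hL q hqL).1⟩
  · intro e he
    obtain ⟨q, hq, h⟩ := hGc e he
    exact ⟨_, List.mem_map.2 ⟨q, Finset.mem_toList.2 hq, rfl⟩, mem_union_right _ h⟩
  · unfold totalLength
    rw [List.map_map, Finset.sum_map_toList]
    calc ∑ q ∈ G, (Finset.card ∘ fun q : Finset E × Finset E => q.1 ∪ q.2) q
        ≤ ∑ q ∈ G, (q.1.card + q.2.card) := Finset.sum_le_sum (fun q _ => card_union_le _ _)
      _ ≤ _ := by rw [Finset.sum_add_distrib]; omega
end

/-! case C -/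
section
variable {ends : E → Sym2 V} {sgn : E → Bool}
lemma even2 {D A B : Finset E} (hD : Cyc ends D) (hA : A ⊆ D) (hB : B ⊆ D)
    (h : bd ends A = bd ends B) : A = B ∨ A = D \ B := by
  have hs : symmDiff A B ⊆ D := fun e he => by
    rcases mem_symmDiff.1 he with h | h
    · exact hA h.1
    · exact hB h.1
  have h0 : bd ends (symmDiff A B) = 0 := by rw [bd_symm, h, f2]
  rcases (symmDiff A B).eq_empty_or_nonempty with h1 | h1
  · left; exact symmDiff_eq_bot.1 h1
  · right
    have := hD.2.2 _ hs h1 h0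
    ext e
    have h2 : e ∈ symmDiff A B ↔ e ∈ D := by rw [this]
    rw [mem_symmDiff] at h2
    rw [mem_sdiff]
    have := @hA e
    have := @hB e
    tauto

lemma D_uniq {D A B : Finset E} (hD : UC ends sgn D) (hA : A ⊆ D) (hB : B ⊆ D)
    (h : bd ends A = bd ends B) (hn : ng sgn A = ng sgn B) : A = B := by
  rcases even2 hD.1 hA hB h with h | rfl
  · exact h
  · rw [ng_sdiff sgn hB, hD.2] at hn
    simp at hn

def ChL (ends : E → Sym2 V) (sgn : E → Bool) (D : Finset E) (L : List (Finset E × Finset E)) : Prop :=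
  ∀ q ∈ L, q.2 ⊆ D ∧ Cyc ends (q.1 ∪ q.2) ∧ ng sgn (q.1 ∪ q.2) = 0 ∧
      ∃ x y T, Pth ends x y (D \ q.2) T

lemma chord_cov {D : Finset E} (hD : UC ends sgn D) {u v : V} {A : Finset E} {S : Finset V}
    (h : Pth ends u v A S) (hu : u ∈ support ends D) (hv : v ∈ support ends D) (hd : Disjoint A D) :
    ∃ L : List (Finset E × Finset E), ChL ends sgn D L ∧ (∀ q ∈ L, q.1 ⊆ A) ∧
      (L.map (fun q => q.1.card)).sum = A.card ∧ ∃ I ⊆ D, bd ends I = bd ends A ∧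
        ng sgn I = ng sgn A ∧ ∀ e ∈ I, ∃ q ∈ L, e ∈ q.2 := by
  obtain ⟨L0, h1, h2, h3, h4⟩ := chords (sgn := sgn) h hu hv hd
  have hev : ∀ Q, ∃ I, Chord ends D Q → I ⊆ D ∧ bd ends I = bd ends Q ∧ ng sgn I = ng sgn Q ∧
      Cyc ends (Q ∪ I) ∧ ng sgn (Q ∪ I) = 0 ∧ ∃ x y T, Pth ends x y (D \ I) T := by
    intro Q
    by_cases hQ : Chord ends D Q
    · obtain ⟨I, hI⟩ := hQ.even_side hD
      exact ⟨I, fun _ => hI⟩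
    · exact ⟨∅, fun h => absurd h hQ⟩
  choose f hf using hev
  refine ⟨L0.map (fun Q => (Q, f Q)), ?_, ?_, ?_, ?_⟩
  · intro q hq
    obtain ⟨Q, hQ, rfl⟩ := List.mem_map.1 hq
    have := hf Q (h1 Q hQ).1
    exact ⟨this.1, this.2.2.2⟩
  · intro q hq
    obtain ⟨Q, hQ, rfl⟩ := List.mem_map.1 hq
    exact (h1 Q hQ).2
  · rw [List.map_map]; exact h2
  · rw [← h3, ← h4]
    have h1' : ∀ Q ∈ L0, Chord ends D Q := fun Q hQ => (h1 Q hQ).1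
    clear h1 h2 h3 h4
    induction L0 with
    | nil => exact ⟨∅, by simp, by simp [bd_empty], by simp [ng_empty], by simp⟩
    | cons Q L ih =>
      obtain ⟨I, i1, i2, i3, i4⟩ := ih (fun Q hQ => h1' Q (List.mem_cons_of_mem _ hQ))
      have hQ := hf Q (h1' Q (List.mem_cons_self))
      refine ⟨symmDiff (f Q) I, ?_, ?_, ?_, ?_⟩
      · intro e he
        rcases mem_symmDiff.1 he with h | h
        · exact hQ.1 h.1
        · exact i1 h.1
      · rw [bd_symm, hQ.2.1, i2]; simp
      · rw [ng_symm, hQ.2.2.1, i3]; simp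
      · intro e he
        rcases mem_symmDiff.1 he with h | h
        · exact ⟨(Q, f Q), by simp, h.1⟩
        · obtain ⟨q, hq, hh⟩ := i4 e h.1
          exact ⟨q, List.mem_cons_of_mem _ hq, hh⟩

lemma region {D A B : Finset E} (hD : Cyc ends D) (hA : A ⊆ D) (hB : B ⊆ D) {u w v : V}
    (hu : u ∈ support ends D) (hw : w ∈ support ends D) (hv : v ∈ support ends D)
    (bA : bd ends A = del u w) (bB : bd ends B = del w v) :
    A ∩ B = ∅ ∨ A ⊆ B ∨ B ⊆ A ∨ A ∪ B = D := by
  by_cases huw : u = w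
  · subst huw
    rcases A.eq_empty_or_nonempty with h | h
    · left; simp [h]
    · have := hD.2.2 A hA h (by rw [bA]; unfold del; exact f2 _)
      right; right; left
      rw [this]; exact hB
  · obtain ⟨A1, S, A2, T, p1, p2, hd, hDe, -, hsup⟩ := hD.arcs hu hw huw
    have : ∃ A2 S T, Pth ends u w A S ∧ Pth ends u w A2 T ∧ Disjoint A A2 ∧ D = A ∪ A2 ∧
        support ends D = S ∪ T := by
      have hA1 : A1 ⊆ D := hDe ▸ subset_union_left
      rcases even2 hD hA hA1 (by rw [bA, p1.bd_eq]) with rfl | h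
      · exact ⟨A2, S, T, p1, p2, hd, hDe, hsup⟩
      · have : A = A2 := by
          rw [h, hDe, Finset.union_sdiff_left]
          exact Finset.sdiff_eq_self_of_disjoint hd.symm
        subst this
        exact ⟨A1, T, S, p2, p1, hd.symm, by rw [hDe, Finset.union_comm], by rw [hsup, Finset.union_comm]⟩
    clear p1 p2 hd hDe hsup
    obtain ⟨A2, S, T, p1, p2, hd, hDe, hsup⟩ := this
    rw [hsup] at hv
    rcases mem_union.1 hv with hv | hv
    · obtain ⟨X, _, Y, _, _, q, hXY, hdXY, _⟩ := p1.split hv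
      have hY : Y ⊆ A := hXY ▸ subset_union_right
      rcases even2 hD hB (hY.trans hA) (by rw [bB, q.bd_eq, del_comm]) with rfl | rfl
      · exact Or.inr (Or.inr (Or.inl hY))
      · right; right; right
        ext e
        have := @hY e
        have := @hA e
        simp only [mem_union, mem_sdiff]; tauto
    · obtain ⟨X, _, Y, _, _, q, hXY, hdXY, _⟩ := p2.split hv
      have hY : Y ⊆ A2 := hXY ▸ subset_union_right
      have hYD : Y ⊆ D := hY.trans (hDe ▸ subset_union_right)
      rcases even2 hD hB hYD (by rw [bB, q.bd_eq, del_comm]) with rfl | rfl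
      · left; exact Finset.disjoint_iff_inter_eq_empty.1 (hd.mono_right hY)
      · right; left
        intro e he
        exact mem_sdiff.2 ⟨hA he, fun h => Finset.disjoint_left.1 hd he (hY h)⟩

def Lk (ends : E → Sym2 V) (sgn : E → Bool) (H D I : Finset E) (u v : V) : Prop :=
  u ∈ support ends D ∧ v ∈ support ends D ∧ Reach ends H u v ∧ I ⊆ D ∧ bd ends I = del u v ∧
    ∀ J ⊆ H, bd ends J = del u v → ng sgn J = ng sgn I

section
variable {H D : Finset E}

lemma Lk.mk' (hHD : Disjoint H D) (hD : UC ends sgn D)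
    (hbal : ∀ B ⊆ H, bd ends B = 0 → ng sgn B = 0) {u v : V} (hu : u ∈ support ends D)
    (hv : v ∈ support ends D) (hr : Reach ends H u v) : ∃ I, Lk ends sgn H D I u v := by
  obtain ⟨p, S, hp, P⟩ := Pth.of_reach hr
  obtain ⟨L, -, -, -, I, hI, h1, h2, -⟩ := chord_cov hD P hu hv (hHD.mono_left hp)
  refine ⟨I, hu, hv, hr, hI, by rw [h1, P.bd_eq], fun J hJ hb => ?_⟩
  rw [h2]
  have h0 := hbal (symmDiff J p) (fun e he => by
    rcases mem_symmDiff.1 he with h | h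
    · exact hJ h.1
    · exact hp h.1) (by rw [bd_symm, hb, P.bd_eq, f2])
  rw [ng_symm] at h0
  exact CharTwo.add_eq_zero.1 h0

lemma Lk.symm {I : Finset E} {u v : V} (h : Lk ends sgn H D I u v) : Lk ends sgn H D I v u :=
  ⟨h.2.1, h.1, h.2.2.1.sy, h.2.2.2.1, by rw [del_comm]; exact h.2.2.2.2.1, fun J hJ hb =>
    h.2.2.2.2.2 J hJ (by rw [del_comm]; exact hb)⟩

lemma Lk.trans {A B : Finset E} {u w v : V} (h : Lk ends sgn H D A u w)
    (h' : Lk ends sgn H D B w v) : Lk ends sgn H D (symmDiff A B) u v := by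
  refine ⟨h.1, h'.2.1, h.2.2.1.tr h'.2.2.1, fun e he => ?_, ?_, fun J hJ hb => ?_⟩
  · rcases mem_symmDiff.1 he with k | k
    · exact h.2.2.2.1 k.1
    · exact h'.2.2.2.1 k.1
  · rw [bd_symm, h.2.2.2.2.1, h'.2.2.2.2.1, del_add]
  · obtain ⟨p, S, hp, P⟩ := Pth.of_reach h.2.2.1
    have h1 := h.2.2.2.2.2 p hp P.bd_eq
    have h2 := h'.2.2.2.2.2 (symmDiff p J) (fun e he => by
      rcases mem_symmDiff.1 he with h | h
      · exact hp h.1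
      · exact hJ h.1) (by rw [bd_symm, hb, P.bd_eq, del_comm u w, del_add])
    rw [ng_symm, h1] at h2
    rw [ng_symm, ← h2, ← add_assoc, z2, zero_add]

lemma Lk.uniq (hD : UC ends sgn D) {A B : Finset E} {u v : V} (h : Lk ends sgn H D A u v)
    (h' : Lk ends sgn H D B u v) : A = B := by
  obtain ⟨p, S, hp, P⟩ := Pth.of_reach h.2.2.1
  exact D_uniq hD h.2.2.2.1 h'.2.2.2.1 (h.2.2.2.2.1.trans h'.2.2.2.2.1.symm)
    ((h.2.2.2.2.2 p hp P.bd_eq).symm.trans (h'.2.2.2.2.2 p hp P.bd_eq))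

/-- a list of chords realizing a linked arc -/
lemma Lk.list (hHD : Disjoint H D) (hD : UC ends sgn D) {A : Finset E} {u v : V}
    (h : Lk ends sgn H D A u v) {p : Finset E} {S : Finset V} (hp : p ⊆ H) (P : Pth ends u v p S) :
    ∃ L : List (Finset E × Finset E), ChL ends sgn D L ∧ (∀ q ∈ L, q.1 ⊆ p) ∧
      (L.map (fun q => q.1.card)).sum = p.card ∧ ∀ e ∈ A, ∃ q ∈ L, e ∈ q.2 := by
  obtain ⟨L, h1, h2, h3, I, hI, h4, h5, h6⟩ := chord_cov hD P h.1 h.2.1 (hHD.mono_left hp)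
  have : I = A := D_uniq hD hI h.2.2.2.1 (by rw [h4, P.bd_eq, h.2.2.2.2.1])
    (by rw [h5]; exact h.2.2.2.2.2 p hp P.bd_eq)
  exact ⟨L, h1, h2, h3, this ▸ h6⟩

lemma Lk.list2 (hHD : Disjoint H D) (hD : UC ends sgn D) {U : Finset E} (hU : U ⊆ H)
    (hUb : bd ends U = 0) {A : Finset E} {u v : V} (h : Lk ends sgn H D A u v) :
    ∃ L : List (Finset E × Finset E), ChL ends sgn D L ∧ (∀ q ∈ L, q.1 ⊆ H) ∧
      2 * (L.map (fun q => q.1.card)).sum + U.card ≤ 2 * H.card ∧ ∀ e ∈ A, ∃ q ∈ L, e ∈ q.2 := by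
  obtain ⟨p, S, hp, P⟩ := Pth.of_reach h.2.2.1
  obtain ⟨J, hJ, hb, hc⟩ := tj_flip hU hUb hp
  obtain ⟨p', S', hp', P'⟩ := Pth.of_reach (reach_of_bd (hb.trans P.bd_eq))
  obtain ⟨L, h1, h2, h3, h4⟩ := h.list hHD hD (hp'.trans hJ) P'
  refine ⟨L, h1, fun q hq => (h2 q hq).trans (hp'.trans hJ), ?_, h4⟩
  have := card_le_card hp'
  omega

lemma avoid_ind {d : E} (hHD : Disjoint H D) (hD : UC ends sgn D)
    (hbal : ∀ B ⊆ H, bd ends B = 0 → ng sgn B = 0)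
    (hno : ∀ A x y, Lk ends sgn H D A x y → d ∉ A) : ∀ (n : ℕ) (J : Finset E), J.card ≤ n → J ⊆ H →
    (∀ v, bd ends J v ≠ 0 → v ∈ support ends D) →
    ∃ I ⊆ D, d ∉ I ∧ bd ends I = bd ends J ∧ ng sgn I = ng sgn J := by
  intro n
  induction n with
  | zero =>
    intro J hc hJ _
    have : J = ∅ := by simpa using hc
    subst this
    exact ⟨∅, by simp, by simp, rfl, rfl⟩
  | succ n ih =>
    intro J hc hJ hs
    by_cases h0 : bd ends J = 0
    · exact ⟨∅, by simp, by simp, by rw [h0, bd_empty], by rw [hbal J hJ h0, ng_empty]⟩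
    · obtain ⟨x, hx⟩ := Function.ne_iff.1 h0
      have hx : bd ends J x ≠ 0 := hx
      obtain ⟨y, hy, hyx, hr⟩ := pair_exists (ends := ends) (J := J)
        (Finset.univ.filter (fun v => bd ends J v ≠ 0)) id (by
          funext z
          rw [Finset.sum_apply]
          simp only [id, Pi.single_apply, Finset.sum_ite_eq, mem_filter, mem_univ,
            true_and]
          rcases z2c (bd ends J z) with h | h <;> simp [h]) (i := x) (by simpa using hx)
      simp only [id, mem_filter, mem_univ, true_and] at hy hr hyx
      obtain ⟨p, S, hp, P⟩ := Pth.of_reach hr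
      obtain ⟨A, hA⟩ := Lk.mk' hHD hD hbal (hs x hx) (hs y hy) (hr.mono hJ)
      have hpne := P.nonempty_of_ne hyx.symm
      have hcard := card_sdiff_add_card_eq_card hp
      have := Finset.card_pos.2 hpne
      obtain ⟨I, i1, i2, i3, i4⟩ := ih (J \ p) (by omega) (Finset.sdiff_subset.trans hJ) (by
        intro v hv
        rw [bd_sdiff ends hp, P.bd_eq, Pi.add_apply] at hv
        by_cases h1 : bd ends J v = 0
        · rw [h1, zero_add] at hv
          by_cases hvx : v = x
          · exact hvx ▸ hs x hx
          by_cases hvy : v = y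
          · exact hvy ▸ hs y hy
          simp [del, Pi.single_apply, hvx, hvy] at hv
        · exact hs v h1)
      refine ⟨symmDiff I A, fun e he => ?_, fun he => ?_, ?_, ?_⟩
      · rcases mem_symmDiff.1 he with h | h
        · exact i1 h.1
        · exact hA.2.2.2.1 h.1
      · rcases mem_symmDiff.1 he with h | h
        · exact i2 h.1
        · exact hno _ _ _ hA h.1
      · rw [bd_symm, i3, bd_sdiff ends hp, P.bd_eq, hA.2.2.2.2.1, add_assoc, f2, add_zero]
      · rw [ng_symm, i4, ng_sdiff sgn hp, ← hA.2.2.2.2.2 p (hp.trans hJ) P.bd_eq, add_assoc, z2,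
          add_zero]

lemma linked_d {d : E} (hHD : Disjoint H D) (hD : UC ends sgn D) (hd : d ∈ D)
    (hbal : ∀ B ⊆ H, bd ends B = 0 → ng sgn B = 0) {R : Finset E} (hR : R ⊆ (H ∪ D).erase d)
    (hRu : UC ends sgn R) : ∃ A x y, Lk ends sgn H D A x y ∧ d ∈ A := by
  by_contra hcon
  push Not at hcon
  have hsd : bd ends (R \ D) = bd ends (R ∩ D) := by
    have h1 := bd_union ends (Finset.disjoint_sdiff_inter R D)
    rw [Finset.sdiff_union_inter, hRu.1.2.1] at h1
    have h2 := congrArg (· + bd ends (R ∩ D)) h1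
    simp only [zero_add, add_assoc, f2, add_zero] at h2
    exact h2.symm
  have hnn := ng_union sgn (Finset.disjoint_sdiff_inter R D)
  rw [Finset.sdiff_union_inter, hRu.2] at hnn
  obtain ⟨I, i1, i2, i3, i4⟩ := avoid_ind (d := d) hHD hD hbal hcon _ (R \ D) le_rfl (by
      intro e he
      rw [mem_sdiff] at he
      exact (mem_union.1 (mem_erase.1 (hR he.1)).2).resolve_right he.2) (by
      intro v hv
      rw [hsd] at hv
      exact support_mono inter_subset_right (support_bd hv))
  have hdR : d ∉ R ∩ D := fun h => (mem_erase.1 (hR (mem_inter.1 h).1)).1 rfl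
  rcases even2 hD.1 i1 (inter_subset_right : R ∩ D ⊆ D) (i3.trans hsd) with h | h
  · rw [← h, i4, z2] at hnn
    simp at hnn
  · rw [h, mem_sdiff] at i2
    exact i2 ⟨hd, hdR⟩
end
end

section
variable {ends : E → Sym2 V} {sgn : E → Bool}
def LL (ends : E → Sym2 V) (sgn : E → Bool) (H D : Finset E) (m : ℕ) (K : E → Prop) : Prop :=
  ∃ L : List (Finset E × Finset E), ChL ends sgn D L ∧ (∀ q ∈ L, q.1 ⊆ H) ∧
    (L.map (fun q => q.1.card)).sum ≤ m ∧ ∀ e, K e → ∃ q ∈ L, e ∈ q.2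

lemma LL.app {H D : Finset E} {m m' : ℕ} {K K' : E → Prop} (h : LL ends sgn H D m K)
    (h' : LL ends sgn H D m' K') : LL ends sgn H D (m + m') (fun e => K e ∨ K' e) := by
  obtain ⟨L, a, b, c, d⟩ := h
  obtain ⟨L', a', b', c', d'⟩ := h'
  refine ⟨L ++ L', fun q hq => ?_, fun q hq => ?_, by simp; omega, fun e he => ?_⟩
  · rcases List.mem_append.1 hq with h | h
    · exact a q h
    · exact a' q h
  · rcases List.mem_append.1 hq with h | h
    · exact b q h
    · exact b' q h
  · rcases he with h | h
    · obtain ⟨q, h1, h2⟩ := d e h; exact ⟨q, List.mem_append_left _ h1, h2⟩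
    · obtain ⟨q, h1, h2⟩ := d' e h; exact ⟨q, List.mem_append_right _ h1, h2⟩

lemma LL.mono {H D : Finset E} {m m' : ℕ} {K K' : E → Prop} (h : LL ends sgn H D m K)
    (hm : m ≤ m') (hK : ∀ e, K' e → K e) : LL ends sgn H D m' K' := by
  obtain ⟨L, a, b, c, d⟩ := h
  exact ⟨L, a, b, c.trans hm, fun e he => d e (hK e he)⟩

lemma LL.comb {ι : Type} {H D : Finset E} (s : Finset ι) (g : ι → ℕ) (K : ι → E → Prop)
    (h : ∀ i ∈ s, LL ends sgn H D (g i) (K i)) :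
    LL ends sgn H D (∑ i ∈ s, g i) (fun e => ∃ i ∈ s, K i e) := by
  induction s using Finset.induction_on with
  | empty => exact ⟨[], by simp [ChL], by simp, by simp, by simp⟩
  | insert i s hi ih =>
    rw [Finset.sum_insert hi]
    refine ((h i (by simp)).app (ih fun j hj => h j (by simp [hj]))).mono le_rfl ?_
    rintro e ⟨j, hj, he⟩
    rcases mem_insert.1 hj with rfl | hj
    · exact Or.inl he
    · exact Or.inr ⟨j, hj, he⟩

lemma LL.fin {F D U N' : Finset E} (hD : UC ends sgn D) (hDF : D ⊆ F) (hN : N' ⊆ D) {m : ℕ}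
    (hL : LL ends sgn (F \ D) D m (fun e => e ∈ N')) (hm : m + U.card ≤ 2 * (F \ D).card) :
    ∃ 𝒞 : List (Finset E), (∀ C ∈ 𝒞, SC ends sgn C ∧ C ⊆ F) ∧ (∀ e ∈ N', ∃ C ∈ 𝒞, e ∈ C) ∧
      totalLength 𝒞 + U.card ≤ 2 * F.card := by
  obtain ⟨L, a, b, c, d⟩ := hL
  obtain ⟨𝒞, h1, h2, h3⟩ := CFIN hD.1 L a hN d
  refine ⟨𝒞, fun C hC => ⟨(h1 C hC).1, ?_⟩, h2, ?_⟩
  · obtain ⟨q, hq, h⟩ := (h1 C hC).2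
    exact h.trans (union_subset ((b q hq).trans sdiff_subset) hDF)
  · have := card_sdiff_add_card_eq_card hDF
    omega

lemma class_max {H D : Finset E} (hHD : Disjoint H D) (hD : UC ends sgn D)
    (hbal : ∀ B ⊆ H, bd ends B = 0 → ng sgn B = 0)
    (hno : ∀ A B x y z w, Lk ends sgn H D A x y → Lk ends sgn H D B z w → A ∪ B ≠ D)
    {x : V} (hx : x ∈ support ends D) : ∃ M u v, Lk ends sgn H D M u v ∧ Reach ends H x u ∧
      ∀ A w z, Lk ends sgn H D A w z → Reach ends H x w → A ⊆ M := by
  obtain ⟨I0, hI0⟩ := Lk.mk' hHD hD hbal hx hx Reach.rfl'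
  let s : Finset (Finset E) := Finset.univ.filter fun M => ∃ u v, Lk ends sgn H D M u v ∧ Reach ends H x u
  have hs : s.Nonempty := ⟨I0, by simp only [s, mem_filter]; exact ⟨by simp, x, x, hI0, Reach.rfl'⟩⟩
  obtain ⟨M, hM, hmax⟩ := Finset.exists_max_image s Finset.card hs
  obtain ⟨u, v, hl, hxu⟩ := (mem_filter.1 hM).2
  have hmx : ∀ A w z, Lk ends sgn H D A w z → Reach ends H x w → A.card ≤ M.card := fun A w z h h' =>
    hmax A (mem_filter.2 ⟨by simp, w, z, h, h'⟩)
  have key : ∀ A w, Lk ends sgn H D A u w → A ⊆ M := by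
    intro A w hA
    have hxw := hxu.tr hA.2.2.1
    rcases region hD.1 hA.2.2.2.1 hl.2.2.2.1 hA.2.1 hl.1 hl.2.1 hA.symm.2.2.2.2.1 hl.2.2.2.2.1
      with h | h | h | h
    · have h1 := hmx _ _ _ (hA.symm.trans hl) hxw
      have h2 : symmDiff A M = A ∪ M := (Finset.disjoint_iff_inter_eq_empty.2 h).symmDiff_eq_sup
      rw [h2, card_union_of_disjoint (Finset.disjoint_iff_inter_eq_empty.2 h)] at h1
      have : A = ∅ := Finset.card_eq_zero.1 (by omega)
      rw [this]; simp
    · exact h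
    · exact (Finset.eq_of_subset_of_card_le h (hmx _ _ _ hA hxu)).symm.subset
    · exact absurd h (hno _ _ _ _ _ _ hA hl)
  refine ⟨M, u, v, hl, hxu, fun A w z hA hxw => ?_⟩
  obtain ⟨B, hB⟩ := Lk.mk' hHD hD hbal hl.1 hA.1 (hxu.sy.tr hxw)
  have h1 := hB.symm.trans (hB.trans hA)
  rw [Lk.uniq hD hA h1]
  intro e he
  rcases mem_symmDiff.1 he with h | h
  · exact key _ _ hB h.1
  · exact key _ _ (hB.trans hA) h.1

lemma caseC_D {F D U N' : Finset E} (hconn : ConnectedOn ends F) (hD : UC ends sgn D) (hDF : D ⊆ F)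
    (hU : U ⊆ F \ D) (hUb : bd ends U = 0) (hN : N' ⊆ D)
    (hR : ∀ d ∈ N', ∃ R ⊆ F.erase d, UC ends sgn R) :
    ∃ 𝒞 : List (Finset E), (∀ C ∈ 𝒞, SC ends sgn C ∧ C ⊆ F) ∧ (∀ e ∈ N', ∃ C ∈ 𝒞, e ∈ C) ∧
      totalLength 𝒞 + U.card ≤ 2 * F.card := by
  have hHD : Disjoint (F \ D) D := Finset.sdiff_disjoint
  have hUc := card_le_card hU
  have hFc := card_sdiff_add_card_eq_card hDF
  by_cases hbal : ∀ B ⊆ F \ D, bd ends B = 0 → ng sgn B = 0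
  · by_cases hno : ∀ A B x y z w, Lk ends sgn (F \ D) D A x y → Lk ends sgn (F \ D) D B z w → A ∪ B ≠ D
    · let cls : V → Finset V := fun x => Finset.univ.filter (Reach ends (F \ D) x)
      let g : Finset V → Finset E := fun W => (F \ D).filter fun e => ∃ w ∈ ends e, w ∈ W
      have hcl : ∀ x y, Reach ends (F \ D) x y → cls x = cls y := fun x y h => by
        ext z; simp only [cls, mem_filter, mem_univ, true_and]
        exact ⟨fun h' => h.sy.tr h', fun h' => h.tr h'⟩
      have key : ∀ W ∈ (support ends D).image cls, LL ends sgn (F \ D) D (g W).card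
          (fun e => ∃ A w z, Lk ends sgn (F \ D) D A w z ∧ w ∈ W ∧ e ∈ A) := by
        intro W hW
        obtain ⟨x, hx, rfl⟩ := Finset.mem_image.1 hW
        obtain ⟨M, u, v, hl, hxu, hmax⟩ := class_max hHD hD hbal hno hx
        obtain ⟨p, S, hp, P⟩ := Pth.of_reach hl.2.2.1
        obtain ⟨L, a, b, c, d⟩ := Lk.list hHD hD hl hp P
        refine ⟨L, a, fun q hq => (b q hq).trans hp, ?_, ?_⟩
        · rw [c]
          refine card_le_card fun e he => mem_filter.2 ⟨hp he, ?_⟩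
          obtain ⟨s, t, hst⟩ := ends_ex ends e
          have hs : s ∈ S := P.ends_mem e he s (by simp [hst])
          exact ⟨s, by simp [hst], by
            simp only [cls, mem_filter, mem_univ, true_and]
            exact hxu.tr ((P.reach s hs).mono hp)⟩
        · rintro e ⟨A, w, z, hA, hw, he⟩
          exact d e (hmax A w z hA (by simpa [cls] using hw) he)
      refine LL.fin (U := U) hD hDF hN ((LL.comb _ _ _ key).mono le_rfl ?_) ?_
      · intro d hd
        obtain ⟨R, hRs, hRu⟩ := hR d hd
        obtain ⟨A, x, y, hA, hdA⟩ := linked_d hHD hD (hN hd) hbal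
          (by rw [Finset.sdiff_union_of_subset hDF]; exact hRs) hRu
        exact ⟨cls x, Finset.mem_image_of_mem _ hA.1, A, x, y, hA, by simp [cls]; exact Reach.rfl', hdA⟩
      · have : ∑ W ∈ (support ends D).image cls, (g W).card ≤ (F \ D).card := by
          rw [← Finset.card_biUnion]
          · exact card_le_card (Finset.biUnion_subset.2 fun W _ => filter_subset _ _)
          · intro W hW W' hW' hne
            obtain ⟨x, hx, rfl⟩ := Finset.mem_image.1 hW
            obtain ⟨y, hy, rfl⟩ := Finset.mem_image.1 hW'
            refine Finset.disjoint_left.2 ?_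
            intro e he he'
            obtain ⟨hF, w, hw, h1⟩ := mem_filter.1 he
            obtain ⟨_, w', hw', h2⟩ := mem_filter.1 he'
            simp only [cls, mem_filter, mem_univ, true_and] at h1 h2
            exact hne (hcl _ _ (h1.tr ((Reach.mem hF hw hw').tr h2.sy)))
        omega
    · push Not at hno
      obtain ⟨A, B, x, y, z, w, hA, hB, hAB⟩ := hno
      obtain ⟨L, a, b, c, d⟩ := Lk.list2 hHD hD hU hUb hA
      obtain ⟨L', a', b', c', d'⟩ := Lk.list2 hHD hD hU hUb hB
      refine LL.fin (U := U) hD hDF hN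
        ((LL.app ⟨L, a, b, le_rfl, d⟩ ⟨L', a', b', le_rfl, d'⟩).mono le_rfl fun e he => ?_) ?_
      · have := hN he; rw [← hAB] at this; simpa using this
      · omega
  · push Not at hbal
    obtain ⟨B, hB, hb, hn⟩ := hbal
    obtain ⟨R, hRB, hRu⟩ := uc_exists hb ((z2c _).resolve_left hn)
    have hRF : R ⊆ F \ D := hRB.trans hB
    have hdRD : Disjoint R D := disjoint_of_subset_left hRF hHD
    have hRc := card_le_card hRF
    by_cases hs : Sh ends R D
    · obtain ⟨a, ha⟩ := hRu.1.supp_ne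
      obtain ⟨b, hb⟩ := hD.1.supp_ne
      obtain ⟨F', h1, h2, h3⟩ := BB hRu hD hdRD hs ha hb
        (hconn a (support_mono (hRF.trans sdiff_subset) ha) b (support_mono hDF hb))
      have h4 : F' ⊆ F := h3.trans (union_subset (union_subset
        (hRF.trans sdiff_subset) hDF) subset_rfl)
      refine ⟨[F'], by simpa using ⟨h1, h4⟩, fun e he => ⟨F', by simp, h2 (by simp [hN he])⟩, ?_⟩
      have := card_le_card h4
      simp [totalLength]; omega
    · unfold Sh at hs
      push Not at hs
      obtain ⟨x, y, hx, hx', hy, hy', hxy⟩ := hs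
      obtain ⟨A, S, B, T, pA, pB, hAB, hR', -, -⟩ := hRu.1.arcs hx hy hxy
      obtain ⟨L, a, b, c, I, hI, hI1, hI2, d⟩ := chord_cov hD pA hx' hy'
        (disjoint_of_subset_left (by rw [hR']; simp) hdRD)
      obtain ⟨L', a', b', c', I', hI', hI1', hI2', d'⟩ := chord_cov hD pB hx' hy'
        (disjoint_of_subset_left (by rw [hR']; simp) hdRD)
      have hII : symmDiff I I' = D := by
        refine hD.1.2.2 _ ?_ ?_ ?_
        · intro e he
          rcases mem_symmDiff.1 he with h | h
          · exact hI h.1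
          · exact hI' h.1
        · rw [Finset.nonempty_iff_ne_empty]
          intro h0
          have := ng_symm sgn I I'
          rw [h0, hI2, hI2', ← ng_union sgn hAB, ← hR', hRu.2] at this
          simp at this
        · rw [bd_symm, hI1, hI1', ← bd_union ends hAB, ← hR', hRu.1.2.1]
      have hc : R.card = A.card + B.card := by rw [hR', card_union_of_disjoint hAB]
      refine LL.fin (U := U) hD hDF hN ((LL.app ⟨L, a, fun q hq => (b q hq).trans ?_, c.le, d⟩
        ⟨L', a', fun q hq => (b' q hq).trans ?_, c'.le, d'⟩).mono le_rfl fun e he => ?_) (by omega)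
      · refine Finset.Subset.trans ?_ hRF; rw [hR']; simp
      · refine Finset.Subset.trans ?_ hRF; rw [hR']; simp
      · have := hN he
        rw [← hII] at this
        rcases mem_symmDiff.1 this with h | h
        · exact Or.inl h.1
        · exact Or.inr h.1

lemma caseC {F Z N D : Finset E} {P : Finset (Finset E)} (hconn : ConnectedOn ends F) (hZ : Z ⊆ F)
    (hP : IsDec ends Z P) (hub : ub sgn P = {D}) (hN : N ⊆ Z)
    (hR : ∀ d ∈ N, ∃ R ⊆ F.erase d, UC ends sgn R) : Cov ends sgn F N ∅ := by
  have hDP : D ∈ ub sgn P := by rw [hub]; simp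
  have hDP' := (mem_filter.1 hDP)
  have hDZ : D ⊆ Z := by
    rw [← hP.2.2]; exact subset_biUnion_of_mem id hDP'.1
  obtain ⟨h1, h2⟩ := dec_bal (sgn := sgn) hP
  obtain ⟨𝒞, h3, h4, h5⟩ := caseC_D (U := Z \ D) (N' := N ∩ D) hconn ⟨hP.1 D hDP'.1, hDP'.2⟩ (hDZ.trans hZ)
    (sdiff_subset_sdiff hZ subset_rfl) (hP.erase hDP'.1).even inter_subset_right
    (fun d hd => hR d (mem_inter.1 hd).1)
  refine ⟨𝒞 ++ (P \ ub sgn P).toList, fun C hC => ?_, fun e he => ?_, ?_, by simp⟩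
  · rcases List.mem_append.1 hC with h | h
    · exact h3 C h
    · exact ⟨(h1 C h).1, (h1 C h).2.trans hZ⟩
  · by_cases heD : e ∈ D
    · obtain ⟨C, hC, h⟩ := h4 e (mem_inter.2 ⟨he, heD⟩)
      exact ⟨C, List.mem_append_left _ hC, h⟩
    · have := hN he
      rw [← hP.2.2] at this
      obtain ⟨C, hC, h⟩ := mem_biUnion.1 this
      refine ⟨C, List.mem_append_right _ ?_, h⟩
      rw [Finset.mem_toList, mem_sdiff, hub, mem_singleton]
      exact ⟨hC, fun h' => heD (h' ▸ h)⟩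
  · rw [tl_app]
    rw [hub, Finset.sum_singleton, ← hub] at h2
    have := card_sdiff_add_card_eq_card hDZ
    omega
end

section
variable {ends : E → Sym2 V} {sgn : E → Bool}
lemma core {F Z Λ N : Finset E} (hconn : ConnectedOn ends F) (hZ : Z ⊆ F) (hb : bd ends Z = 0)
    (hΛ : Λ ⊆ N) (hN : N ⊆ Z) (hlp : ∀ l ∈ Λ, (∃ a, ends l = s(a, a)) ∧ sgn l = true)
    (hR : ∀ d ∈ N, ∃ R ⊆ F.erase d, UC ends sgn R) : Cov ends sgn F N Λ := by
  have hΛF : Λ ⊆ F := hΛ.trans (hN.trans hZ)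
  have hΛb : bd ends Λ = 0 := Finset.sum_eq_zero fun l hl => by
    obtain ⟨a, ha⟩ := (hlp l hl).1
    rw [ha, einc_mk, del_self]
  have hZ' : Z \ Λ ⊆ F \ Λ := sdiff_subset_sdiff hZ subset_rfl
  have hb' : bd ends (Z \ Λ) = 0 := by rw [bd_sdiff ends (hΛ.trans hN), hb, hΛb, add_zero]
  have hsub : N ⊆ Z \ Λ ∪ Λ := hN.trans (by simp)
  have hdone : Cov ends sgn F (Z \ Λ ∪ Λ) Λ → Cov ends sgn F N Λ := by
    rintro ⟨𝒞, h1, h2, h3⟩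
    exact ⟨𝒞, h1, fun e he => h2 e (hsub he), h3⟩
  rcases z2c (ng sgn (Z \ Λ)) with hn | hn
  · exact hdone (caseE hconn hΛF hlp hZ' hb' hn fun l hl => hR l (hΛ hl))
  · obtain ⟨P0, hP0⟩ := dec_exists hb'
    have hodd : ∀ P, IsDec ends (Z \ Λ) P → Odd (ub sgn P).card := fun P hP => by
      have := hP.parity (sgn := sgn)
      rw [hn] at this
      exact ZMod.natCast_eq_one_iff_odd.1 this.symm
    obtain ⟨P, hP, h1, h2⟩ := sigma_min (sgn := sgn) 1 ⟨P0, hP0, (hodd P0 hP0).pos⟩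
    have ho := hodd P hP
    by_cases hc : Λ.Nonempty ∨ 1 < (ub sgn P).card
    · refine hdone (caseO hconn hΛF hlp hZ' hP ho ?_ hc)
      by_cases h3 : 1 + 2 ≤ (ub sgn P).card
      · exact h2 h3
      · have : (ub sgn P).card = 1 := by obtain ⟨k, hk⟩ := ho; omega
        obtain ⟨D, hD⟩ := Finset.card_eq_one.1 this
        intro A hA B hB hne
        rw [hD, mem_singleton] at hA hB
        exact absurd (hA.trans hB.symm) hne
    · rw [not_or, Finset.not_nonempty_iff_eq_empty] at hc
      obtain ⟨rfl, hc⟩ := hc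
      obtain ⟨D, hD⟩ := Finset.card_eq_one.1 (show (ub sgn P).card = 1 by have := ho.pos; omega)
      exact caseC hconn hZ (by simpa using hP) hD hN hR
end

section
variable {ends ends' : E → Sym2 V} {sgn sgn' : E → Bool}
def Ag (ends ends' : E → Sym2 V) (sgn sgn' : E → Bool) (A : Finset E) : Prop :=
  ∀ e ∈ A, ends e = ends' e ∧ sgn e = sgn' e

lemma Ag.mono {A B : Finset E} (h : Ag ends ends' sgn sgn' A) (hB : B ⊆ A) :
    Ag ends ends' sgn sgn' B := fun e he => h e (hB he)

lemma Ag.sy {A : Finset E} (h : Ag ends ends' sgn sgn' A) : Ag ends' ends sgn' sgn A :=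
  fun e he => ⟨(h e he).1.symm, (h e he).2.symm⟩

lemma Ag.bd {A : Finset E} (h : Ag ends ends' sgn sgn' A) : bd ends A = bd ends' A :=
  Finset.sum_congr rfl fun e he => by rw [(h e he).1]

lemma Ag.ng {A : Finset E} (h : Ag ends ends' sgn sgn' A) : ng sgn A = ng sgn' A :=
  Finset.sum_congr rfl fun e he => by rw [(h e he).2]

lemma Ag.supp {A : Finset E} (h : Ag ends ends' sgn sgn' A) : support ends A = support ends' A := by
  ext x
  rw [mem_support, mem_support]
  exact ⟨fun ⟨e, he, hx⟩ => ⟨e, he, (h e he).1 ▸ hx⟩, fun ⟨e, he, hx⟩ => ⟨e, he, (h e he).1.symm ▸ hx⟩⟩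

lemma Ag.cyc {A : Finset E} (h : Ag ends ends' sgn sgn' A) (hc : Cyc ends A) : Cyc ends' A :=
  ⟨hc.1, h.bd ▸ hc.2.1, fun B hB hn hb => hc.2.2 B hB hn ((h.mono hB).bd.trans hb)⟩

lemma Ag.uc {A : Finset E} (h : Ag ends ends' sgn sgn' A) (hc : UC ends sgn A) : UC ends' sgn' A :=
  ⟨h.cyc hc.1, h.ng ▸ hc.2⟩

lemma Ag.pth {A : Finset E} {S : Finset V} {u v : V} (h : Ag ends ends' sgn sgn' A)
    (hp : Pth ends u v A S) : Pth ends' u v A S := by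
  induction hp with
  | nil v => exact Pth.nil v
  | cons he hu hp ih =>
    exact Pth.cons ((h _ (mem_insert_self _ _)).1 ▸ he) hu
      (ih (h.mono (subset_insert _ _)))

lemma Ag.reach {A : Finset E} {u v : V} (h : Ag ends ends' sgn sgn' A)
    (hp : Reach ends A u v) : Reach ends' A u v := by
  obtain ⟨B, S, hB, P⟩ := Pth.of_reach hp
  exact (((h.mono hB).pth P).reach v P.end_mem).mono hB

lemma Ag.sc {A : Finset E} (h : Ag ends ends' sgn sgn' A) (hc : SC ends sgn A) : SC ends' sgn' A := by
  rcases hc with ⟨h1, h2⟩ | ⟨C₁, C₂, P, u, v, S, hb, rfl⟩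
  · exact Or.inl ⟨h.cyc h1, h.ng ▸ h2⟩
  · have g1 := h.mono (B := C₁) fun e he => by simp [he]
    have g2 := h.mono (B := C₂) fun e he => by simp [he]
    have g3 := h.mono (B := P) fun e he => by simp [he]
    refine Or.inr ⟨C₁, C₂, P, u, v, S, ⟨g1.uc hb.c1, g2.uc hb.c2, hb.dj, g3.pth hb.pt, ?_, ?_, ?_, ?_, ?_⟩, rfl⟩
    · rw [← g1.supp]; exact hb.hu
    · rw [← g2.supp]; exact hb.hv
    · rw [← g1.supp]; exact hb.s1
    · rw [← g2.supp]; exact hb.s2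
    · rw [← g1.supp, ← g2.supp]; exact hb.s3

def Lol (ends : E → Sym2 V) (sgn : E → Bool) (a : V) (X : Finset E) : Prop :=
  ∃ C P v S, UC ends sgn C ∧ Pth ends a v P S ∧ v ∈ support ends C ∧
    (∀ x ∈ S, x ∈ support ends C → x = v) ∧ X = C ∪ P

lemma lol_of {b : E} {a : V} {H X : Finset E} (hb : ends' b = s(a, a)) (hs : sgn' b = true)
    (hH : Ag ends' ends sgn' sgn H) (hbH : b ∉ H) (hX : SC ends' sgn' X) (hXH : X ⊆ insert b H)
    (hbX : b ∈ X) : Lol ends sgn a (X.erase b) ∧ X.erase b ⊆ H := by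
  have hsub : X.erase b ⊆ H := fun e he =>
    (mem_insert.1 (hXH (mem_of_mem_erase he))).resolve_left (ne_of_mem_erase he)
  refine ⟨?_, hsub⟩
  obtain ⟨C, P, v, S, hB, rfl⟩ := hX.at_loop hbX hb hs
  have hbC : b ∉ C := Finset.disjoint_singleton_left.1 hB.dj
  have hbP : b ∉ P := fun h => hB.pt.notloop b h a a hb rfl
  have he : ({b} ∪ C ∪ P).erase b = C ∪ P := by
    ext e; simp only [mem_erase, mem_union, mem_singleton]
    constructor
    · tauto
    · intro h; refine ⟨?_, by tauto⟩
      rintro rfl; tauto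
  rw [he] at hsub ⊢
  have g1 := hH.mono (Finset.subset_union_left.trans hsub)
  have g2 := hH.mono (Finset.subset_union_right.trans hsub)
  exact ⟨C, P, v, S, g1.uc hB.c2, g2.pth hB.pt, g1.supp ▸ hB.hv, g1.supp ▸ hB.s2, rfl⟩

lemma lol_join {b : E} {a c : V} {H K X Y : Finset E} (hb : ends b = s(a, c))
    (hv : ∀ x, (x = a ∨ x ∈ support ends H) → (x = c ∨ x ∈ support ends K) → False)
    (hX : Lol ends sgn a X) (hXH : X ⊆ H) (hY : Lol ends sgn c Y) (hYK : Y ⊆ K) :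
    SC ends sgn (insert b (X ∪ Y)) := by
  obtain ⟨C, P, u, S, h1, h2, h3, h4, rfl⟩ := hX
  obtain ⟨C', P', v, S', h1', h2', h3', h4', rfl⟩ := hY
  have hC := support_mono (ends := ends) (Finset.subset_union_left.trans hXH)
  have hP := support_mono (ends := ends) (Finset.subset_union_right.trans hXH)
  have hC' := support_mono (ends := ends) (Finset.subset_union_left.trans hYK)
  have hP' := support_mono (ends := ends) (Finset.subset_union_right.trans hYK)
  have hS : ∀ x ∈ S, x = a ∨ x ∈ support ends H := fun x hx => by
    rw [h2.subset_supp] at hx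
    rcases mem_insert.1 hx with h | h
    · exact Or.inl h
    · exact Or.inr (hP h)
  have hS' : ∀ x ∈ S', x = c ∨ x ∈ support ends K := fun x hx => by
    rw [h2'.subset_supp] at hx
    rcases mem_insert.1 hx with h | h
    · exact Or.inl h
    · exact Or.inr (hP' h)
  have haS' : a ∉ S' := fun h => hv a (Or.inl rfl) (hS' a h)
  have hq := Pth.cons hb haS' h2'
  have hp := h2.reverse.concat hq (by
    intro x hx hx'
    rcases mem_insert.1 hx' with h | h
    · exact h
    · exact (hv x (hS x hx) (hS' x h)).elim)
  refine Or.inr ⟨C, C', _, u, v, _, ⟨h1, h1', ?_, hp, h3, h3', ?_, ?_, ?_⟩, ?_⟩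
  · rw [Finset.disjoint_left]
    intro e he he'
    obtain ⟨x, y, hxy⟩ := ends_ex ends e
    exact hv x (Or.inr (hC (mem_support.2 ⟨e, he, by simp [hxy]⟩)))
      (Or.inr (hC' (mem_support.2 ⟨e, he', by simp [hxy]⟩)))
  · intro x hx hxC
    rcases mem_union.1 hx with h | h
    · exact h4 x h hxC
    · rcases mem_insert.1 h with rfl | h
      · exact h4 _ h2.start_mem hxC
      · exact (hv x (Or.inr (hC hxC)) (hS' x h)).elim
  · intro x hx hxC
    rcases mem_union.1 hx with h | h
    · exact (hv x (hS x h) (Or.inr (hC' hxC))).elim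
    · rcases mem_insert.1 h with rfl | h
      · exact (hv _ (Or.inl rfl) (Or.inr (hC' hxC))).elim
      · exact h4' x h hxC
  · intro x hx hx'
    exact (hv x (Or.inr (hC hx)) (Or.inr (hC' hx'))).elim
  · ext e; simp only [mem_insert, mem_union]; tauto

def HC (ends : E → Sym2 V) (sgn : E → Bool) (a : V) (H N Λ : Finset E) : Prop :=
  ∃ 𝒟 X Y, (∀ C ∈ 𝒟, SC ends sgn C ∧ C ⊆ H) ∧ Lol ends sgn a X ∧ Lol ends sgn a Y ∧ X ⊆ H ∧ Y ⊆ H ∧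
    (∀ e ∈ N, e ∈ H → (∃ C ∈ 𝒟, e ∈ C) ∨ e ∈ X ∨ e ∈ Y) ∧
    totalLength 𝒟 + X.card + Y.card ≤ 2 * H.card ∧
    ∀ l ∈ Λ, l ∈ H → widthAt 𝒟 l + (if l ∈ X then 1 else 0) + (if l ∈ Y then 1 else 0) = 2

lemma half_of {b : E} {a : V} {H N Λ : Finset E} (hb : ends' b = s(a, a)) (hs : sgn' b = true)
    (hH : Ag ends' ends sgn' sgn H) (hbH : b ∉ H) (hΛ : b ∈ Λ)
    (h : Cov ends' sgn' (insert b H) N Λ) : HC ends sgn a H N Λ := by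
  obtain ⟨𝒞, h1, h2, h3, h4⟩ := h
  obtain ⟨X, Y, hXY⟩ := List.length_eq_two.1 (h4 b hΛ)
  have hp : List.Perm ([X, Y] ++ 𝒞.filter (fun C => !decide (b ∈ C))) 𝒞 := by
    rw [← hXY]; exact List.filter_append_perm _ _
  have hX := List.mem_filter.1 (show X ∈ 𝒞.filter (fun C => decide (b ∈ C)) by rw [hXY]; simp)
  have hY := List.mem_filter.1 (show Y ∈ 𝒞.filter (fun C => decide (b ∈ C)) by rw [hXY]; simp)
  have hbX : b ∈ X := by simpa using hX.2
  have hbY : b ∈ Y := by simpa using hY.2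
  obtain ⟨lX, sX⟩ := lol_of hb hs hH hbH (h1 X hX.1).1 (h1 X hX.1).2 hbX
  obtain ⟨lY, sY⟩ := lol_of hb hs hH hbH (h1 Y hY.1).1 (h1 Y hY.1).2 hbY
  refine ⟨𝒞.filter (fun C => !decide (b ∈ C)), X.erase b, Y.erase b, ?_, lX, lY, sX, sY, ?_, ?_, ?_⟩
  · intro C hC
    obtain ⟨hC, hbC⟩ := List.mem_filter.1 hC
    have hbC : b ∉ C := by simpa using hbC
    have : C ⊆ H := fun e he => (mem_insert.1 ((h1 C hC).2 he)).resolve_left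
      (fun h => hbC (h ▸ he))
    exact ⟨(hH.mono this).sc (h1 C hC).1, this⟩
  · intro e he heH
    have hne : e ≠ b := fun h => hbH (h ▸ heH)
    obtain ⟨C, hC, heC⟩ := h2 e he
    rcases List.mem_append.1 (hp.mem_iff.2 hC) with h | h
    · right
      simp only [List.mem_cons, List.not_mem_nil, or_false] at h
      rcases h with rfl | rfl
      · exact Or.inl (mem_erase.2 ⟨hne, heC⟩)
      · exact Or.inr (mem_erase.2 ⟨hne, heC⟩)
    · exact Or.inl ⟨C, h, heC⟩
  · have e1 : totalLength 𝒞 = totalLength ([X, Y] ++ 𝒞.filter (fun C => !decide (b ∈ C))) :=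
      ((hp.map Finset.card).sum_eq).symm
    rw [tl_app, tl_cons, tl_cons] at e1
    have e2 : totalLength ([] : List (Finset E)) = 0 := rfl
    have e3 := Finset.card_erase_add_one hbX
    have e4 := Finset.card_erase_add_one hbY
    rw [card_insert_of_notMem hbH] at h3
    omega
  · intro l hl hlH
    have hne : l ≠ b := fun h => hbH (h ▸ hlH)
    have e1 : widthAt 𝒞 l = widthAt ([X, Y] ++ 𝒞.filter (fun C => !decide (b ∈ C))) l :=
      ((hp.filter _).length_eq).symm
    rw [wd_app, wd_cons, wd_cons, h4 l hl] at e1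
    have e2 : widthAt ([] : List (Finset E)) l = 0 := rfl
    simp only [mem_erase, hne, ne_eq, not_false_eq_true, true_and]
    omega

lemma glue {b : E} {a c : V} {F H K N Λ : Finset E} (hb : ends b = s(a, c))
    (hF : F = insert b (H ∪ K)) (hbH : b ∉ H) (hbK : b ∉ K) (hbΛ : b ∉ Λ)
    (hv : ∀ x, (x = a ∨ x ∈ support ends H) → (x = c ∨ x ∈ support ends K) → False)
    (hN : N ⊆ F) (hΛ : Λ ⊆ F)
    (h : HC ends sgn a H N Λ) (h' : HC ends sgn c K N Λ) : Cov ends sgn F N Λ := by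
  obtain ⟨𝒟, X, Y, h1, h2, h3, h4, h5, h6, h7, h8⟩ := h
  obtain ⟨𝒟', X', Y', h1', h2', h3', h4', h5', h6', h7', h8'⟩ := h'
  have hd : Disjoint H K := by
    rw [Finset.disjoint_left]
    intro e he he'
    obtain ⟨x, y, hxy⟩ := ends_ex ends e
    exact hv x (Or.inr (mem_support.2 ⟨e, he, by simp [hxy]⟩))
      (Or.inr (mem_support.2 ⟨e, he', by simp [hxy]⟩))
  have hHF : H ⊆ F := by rw [hF]; intro e he; simp [he]
  have hKF : K ⊆ F := by rw [hF]; intro e he; simp [he]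
  have hbF : b ∈ F := by rw [hF]; simp
  have w0 : ∀ (L : List (Finset E)) (A B : Finset E), Disjoint A B → (∀ C ∈ L, SC ends sgn C ∧ C ⊆ A) →
      ∀ l ∈ B, widthAt L l = 0 := fun L A B hAB hL l hl => by
    unfold widthAt
    rw [List.length_eq_zero_iff, List.filter_eq_nil_iff]
    intro C hC
    simpa using fun h => Finset.disjoint_left.1 hAB ((hL C hC).2 h) hl
  have e2 : ∀ l, widthAt ([] : List (Finset E)) l = 0 := fun _ => rfl
  have hu : ∀ A B : Finset E, A ⊆ H → B ⊆ K → insert b (A ∪ B) ⊆ F := fun A B hA hB =>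
    insert_subset hbF (union_subset (hA.trans hHF) (hB.trans hKF))
  refine ⟨𝒟 ++ (𝒟' ++ [insert b (X ∪ X'), insert b (Y ∪ Y')]), ?_, ?_, ?_, ?_⟩
  · intro C hC
    simp only [List.mem_append, List.mem_cons, List.not_mem_nil, or_false] at hC
    rcases hC with h | h | rfl | rfl
    · exact ⟨(h1 C h).1, (h1 C h).2.trans hHF⟩
    · exact ⟨(h1' C h).1, (h1' C h).2.trans hKF⟩
    · exact ⟨lol_join hb hv h2 h4 h2' h4', hu _ _ h4 h4'⟩
    · exact ⟨lol_join hb hv h3 h5 h3' h5', hu _ _ h5 h5'⟩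
  · intro e he
    have heF := hN he
    rw [hF, mem_insert, mem_union] at heF
    rcases heF with rfl | h | h
    · exact ⟨insert e (X ∪ X'), by simp, by simp⟩
    · rcases h6 e he h with ⟨C, hC, h⟩ | h | h
      · exact ⟨C, by simp [hC], h⟩
      · exact ⟨insert b (X ∪ X'), by simp, by simp [h]⟩
      · exact ⟨insert b (Y ∪ Y'), by simp, by simp [h]⟩
    · rcases h6' e he h with ⟨C, hC, h⟩ | h | h
      · exact ⟨C, by simp [hC], h⟩
      · exact ⟨insert b (X ∪ X'), by simp, by simp [h]⟩
      · exact ⟨insert b (Y ∪ Y'), by simp, by simp [h]⟩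
  · have c0 : F.card = H.card + K.card + 1 := by
      rw [hF, card_insert_of_notMem (by simp [hbH, hbK]), card_union_of_disjoint hd]
    have c1 := (Finset.card_insert_le b (X ∪ X')).trans (Nat.succ_le_succ (card_union_le X X'))
    have c2 := (Finset.card_insert_le b (Y ∪ Y')).trans (Nat.succ_le_succ (card_union_le Y Y'))
    have c3 : totalLength ([] : List (Finset E)) = 0 := rfl
    rw [tl_app, tl_app, tl_cons, tl_cons]
    omega
  · intro l hl
    have hlF := hΛ hl
    have hlb : l ≠ b := fun h => hbΛ (h ▸ hl)
    rw [wd_app, wd_app, wd_cons, wd_cons, e2]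
    simp only [mem_insert, hlb, false_or, mem_union]
    rw [hF, mem_insert, mem_union] at hlF
    rcases hlF.resolve_left hlb with h | h
    · have z1 := w0 _ _ _ hd.symm h1' l h
      have z2 : l ∉ X' := fun h' => Finset.disjoint_left.1 hd h (h4' h')
      have z3 : l ∉ Y' := fun h' => Finset.disjoint_left.1 hd h (h5' h')
      have := h8 l hl h
      simp only [z2, z3, or_false]; omega
    · have z1 := w0 _ _ _ hd h1 l h
      have z2 : l ∉ X := fun h' => Finset.disjoint_left.1 hd (h4 h') h
      have z3 : l ∉ Y := fun h' => Finset.disjoint_left.1 hd (h5 h') h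
      have := h8' l hl h
      simp only [z2, z3, false_or]; omega
end

section
variable {ends : E → Sym2 V} {sgn : E → Bool}
def Un (ends : E → Sym2 V) (sgn : E → Bool) (F : Finset E) (a : V) : Prop :=
  ∃ C ⊆ F, UC ends sgn C ∧ ∃ w ∈ support ends C, Reach ends F a w

def Brg (ends : E → Sym2 V) (sgn : E → Bool) (F : Finset E) (e : E) : Prop :=
  e ∈ F ∧ ∀ a c, ends e = s(a, c) → ¬ Reach ends (F.erase e) a c ∧ Un ends sgn (F.erase e) a

structure Inp (ends : E → Sym2 V) (sgn : E → Bool) (F Z Λ N : Finset E) : Prop where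
  hconn : ConnectedOn ends F
  hZ : Z ⊆ F
  hb : bd ends Z = 0
  hΛ : Λ ⊆ N
  hN : N ⊆ Z
  hlp : ∀ l ∈ Λ, (∃ a, ends l = s(a, a)) ∧ sgn l = true
  hR : ∀ d ∈ N, ∃ R ⊆ F.erase d, UC ends sgn R

lemma cyc_comp {F C : Finset E} {a w : V} (hC : C ⊆ F) (h : Cyc ends C) (hw : w ∈ support ends C)
    (hr : Reach ends F a w) : C ⊆ cE ends F a := by
  intro e he
  obtain ⟨x, y, hxy⟩ := ends_ex ends e
  refine mem_filter.2 ⟨hC he, x, by simp [hxy], hr.tr ((h.reach hw ?_).mono hC)⟩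
  exact mem_support.2 ⟨e, he, by simp [hxy]⟩

lemma Inp.side {F Z Λ N : Finset E} (h : Inp ends sgn F Z Λ N) {b : E} {a c : V}
    (hb : ends b = s(a, c)) (hbr : Brg ends sgn F b)
    (ih : ∀ (ends' : E → Sym2 V) (sgn' : E → Bool) (F' Z' Λ' N' : Finset E), F'.card < F.card →
      Inp ends' sgn' F' Z' Λ' N' →
      Cov ends' sgn' F' (N' ∪ Finset.univ.filter (Brg ends' sgn' F')) Λ') :
    HC ends sgn a (cE ends (F.erase b) a) (N ∪ Finset.univ.filter (Brg ends sgn F)) Λ := by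
  set H := cE ends (F.erase b) a with hH
  have hHF : H ⊆ F.erase b := filter_subset _ _
  have hbH : b ∉ H := fun h => notMem_erase b F (hHF h)
  obtain ⟨hbF, hbr'⟩ := hbr
  obtain ⟨hnr, C1, hC1, hU1, w1, hw1, hr1⟩ := hbr' a c hb
  obtain ⟨-, C2, hC2, hU2, w2, hw2, hr2⟩ := hbr' c a (by rw [hb, Sym2.eq_swap])
  set ends' := Function.update ends b s(a, a) with he'
  set sgn' := Function.update sgn b true with hs'
  have eb : ends' b = s(a, a) := by simp [he']
  have sb : sgn' b = true := by simp [hs']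
  have ag : Ag ends ends' sgn sgn' (F.erase b) := fun e he => by
    have := ne_of_mem_erase he
    simp [he', hs', this]
  have agH := ag.mono hHF
  have hbZ : b ∉ Z := fun hz => hnr ((reach_even_erase h.hb hz hb).mono (Finset.erase_subset_erase _ h.hZ))
  have hZe : Z ⊆ F.erase b := fun e he => mem_erase.2 ⟨fun h => hbZ (h ▸ he), h.hZ he⟩
  have ra : ∀ x ∈ support ends' (insert b H), Reach ends' (insert b H) a x := by
    intro x hx
    obtain ⟨e, he, hx⟩ := mem_support.1 hx
    rcases mem_insert.1 he with rfl | he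
    · rw [eb, Sym2.mem_iff, or_self] at hx; rw [hx]; exact Reach.rfl'
    · rw [← (agH e he).1] at hx
      exact (agH.reach (reach_cE (cE_reach he hx))).mono (subset_insert _ _)
  have hinp : Inp ends' sgn' (insert b H) (insert b (Z ∩ H)) (insert b (Λ ∩ H)) (insert b (N ∩ H)) := by
    refine ⟨fun x hx y hy => (ra x hx).sy.tr (ra y hy), ?_, ?_, ?_, ?_, ?_, ?_⟩
    · exact Finset.insert_subset_insert _ inter_subset_right
    · rw [bd_insert ends' (by simp [hbH]), eb, einc_mk, del_self, zero_add,
        ← (agH.mono inter_subset_right).bd]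
      exact bd_cE hZe h.hb a
    · exact Finset.insert_subset_insert _ (Finset.inter_subset_inter_right h.hΛ)
    · exact Finset.insert_subset_insert _ (Finset.inter_subset_inter_right h.hN)
    · intro l hl
      rcases mem_insert.1 hl with rfl | hl
      · exact ⟨⟨a, eb⟩, sb⟩
      · obtain ⟨h1, h2⟩ := mem_inter.1 hl
        rw [← (agH l h2).1, ← (agH l h2).2]
        exact h.hlp l h1
    · intro d hd
      rcases mem_insert.1 hd with rfl | hd
      · rw [Finset.erase_insert hbH]
        exact ⟨C1, cyc_comp hC1 hU1.1 hw1 hr1, (ag.mono hC1).uc hU1⟩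
      · refine ⟨{b}, ?_, uc_loop eb sb⟩
        rw [Finset.singleton_subset_iff, mem_erase]
        exact ⟨fun h => hbH (h ▸ (mem_inter.1 hd).2), mem_insert_self _ _⟩
  have hlt : (insert b H).card < F.card := by
    apply card_lt_card
    rw [Finset.ssubset_iff_of_subset (insert_subset hbF (hHF.trans (erase_subset _ _)))]
    obtain ⟨e, he, hwe⟩ := mem_support.1 hw2
    refine ⟨e, mem_of_mem_erase (hC2 he), fun h => ?_⟩
    rcases mem_insert.1 h with h | h
    · exact ne_of_mem_erase (hC2 he) h
    · exact hnr ((cE_reach h hwe).tr hr2.sy)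
  have hres := half_of eb sb agH.sy hbH (mem_insert_self _ _) (ih _ _ _ _ _ _ hlt hinp)
  have hbrT : ∀ e ∈ H, Brg ends sgn F e → Brg ends' sgn' (insert b H) e := by
    intro e heH hB
    have heb : e ≠ b := fun h => hbH (h ▸ heH)
    refine ⟨mem_insert_of_mem heH, fun x y hxy => ?_⟩
    rw [← (agH e heH).1] at hxy
    obtain ⟨n1, C, hC, hU, w, hw, hr⟩ := hB.2 x y hxy
    have hsub : H.erase e ⊆ (insert b H).erase e := Finset.erase_subset_erase _ (subset_insert _ _)
    have agE : Ag ends ends' sgn sgn' (H.erase e) := agH.mono (erase_subset _ _)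
    constructor
    · intro hc
      apply n1
      have : ∀ z, Reach ends' ((insert b H).erase e) x z → Reach ends (H.erase e) x z := by
        intro z hz
        induction hz with
        | refl => exact Reach.rfl'
        | @tail p q _ hs ih =>
          obtain ⟨f, hf, hpq⟩ := hs
          obtain ⟨hfe, hf⟩ := mem_erase.1 hf
          rcases mem_insert.1 hf with rfl | hf
          · rw [eb, Sym2.eq_iff] at hpq
            have : p = q := by rcases hpq with ⟨h, h'⟩ | ⟨h, h'⟩ <;> rw [← h, ← h']
            exact this ▸ ih
          · rw [← (agH f hf).1] at hpq
            exact ih.tr (Reach.edge (mem_erase.2 ⟨hfe, hf⟩) hpq)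
      exact (this y hc).mono (Finset.erase_subset_erase _ (hHF.trans (erase_subset _ _)))
    · let ρ : V → V := fun z => if Reach ends (F.erase b) a z then z else a
      have hxr : Reach ends (F.erase b) a x := cE_reach heH (by simp [hxy])
      have key : ∀ z, Reach ends (F.erase e) x z → Reach ends' ((insert b H).erase e) x (ρ z) := by
        intro z hz
        induction hz with
        | refl => simp only [ρ, hxr, if_true]; exact Reach.rfl'
        | @tail p q _ hs ih =>
          obtain ⟨f, hf, hpq⟩ := hs
          obtain ⟨hfe, hf⟩ := mem_erase.1 hf
          by_cases hfb : f = b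
          · subst hfb
            rw [hb, Sym2.eq_iff] at hpq
            have h1 : ρ a = a := by simp [ρ]
            have h2 : ρ c = a := by simp [ρ, hnr]
            have : ρ p = ρ q := by
              rcases hpq with ⟨h, h'⟩ | ⟨h, h'⟩ <;> rw [← h, ← h', h1, h2]
            exact this ▸ ih
          · have hfF : f ∈ F.erase b := mem_erase.2 ⟨hfb, hf⟩
            have hpq' := Reach.edge hfF hpq
            by_cases hp : Reach ends (F.erase b) a p
            · have hq := hp.tr hpq'
              simp only [ρ, hp, hq, if_true] at ih ⊢
              have hfH : f ∈ H := mem_filter.2 ⟨hfF, p, by simp [hpq], hp⟩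
              refine ih.tr (Reach.edge (mem_erase.2 ⟨hfe, mem_insert_of_mem hfH⟩) ?_)
              rw [← (agH f hfH).1]; exact hpq
            · have hq : ¬ Reach ends (F.erase b) a q := fun h => hp (h.tr hpq'.sy)
              simp only [ρ, hp, hq, if_false] at ih ⊢
              exact ih
      have hk := key w hr
      have hbC : b ∉ C := fun hc => hnr ((reach_even_erase hU.1.2.1 hc hb).mono
        (Finset.erase_subset_erase _ (hC.trans (erase_subset _ _))))
      have hCF : C ⊆ F.erase b := fun f hf => mem_erase.2
        ⟨fun h => hbC (h ▸ hf), mem_of_mem_erase (hC hf)⟩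
      by_cases hw' : Reach ends (F.erase b) a w
      · have hCH := cyc_comp hCF hU.1 hw hw'
        simp only [ρ, hw', if_true] at hk
        refine ⟨C, fun f hf => mem_erase.2 ⟨ne_of_mem_erase (hC hf),
          mem_insert_of_mem (hCH hf)⟩, (ag.mono hCF).uc hU, w, ?_, hk⟩
        rw [← (ag.mono hCF).supp]; exact hw
      · simp only [ρ, hw', if_false] at hk
        refine ⟨{b}, ?_, uc_loop eb sb, a, ?_, hk⟩
        · rw [Finset.singleton_subset_iff, mem_erase]
          exact ⟨heb.symm, mem_insert_self _ _⟩
        · exact mem_support.2 ⟨b, by simp, by simp [eb]⟩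
  obtain ⟨𝒟, X, Y, h1, h2, h3, h4, h5, h6, h7, h8⟩ := hres
  refine ⟨𝒟, X, Y, h1, h2, h3, h4, h5, fun e he heH => h6 e ?_ heH, h7, fun l hl hlH => h8 l ?_ hlH⟩
  · rcases mem_union.1 he with he | he
    · simp [he, heH]
    · have := hbrT e heH (mem_filter.1 he).2
      simp [this]
  · simp [hl, hlH]

theorem Inp.main {ends : E → Sym2 V} {sgn : E → Bool} {F Z Λ N : Finset E} (h : Inp ends sgn F Z Λ N) :
    Cov ends sgn F (N ∪ Finset.univ.filter (Brg ends sgn F)) Λ := by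
  induction hn : F.card using Nat.strong_induction_on generalizing ends sgn F Z Λ N with
  | _ n ih =>
    subst hn
    have ih' : ∀ (ends' : E → Sym2 V) (sgn' : E → Bool) (F' Z' Λ' N' : Finset E), F'.card < F.card →
      Inp ends' sgn' F' Z' Λ' N' →
      Cov ends' sgn' F' (N' ∪ Finset.univ.filter (Brg ends' sgn' F')) Λ' :=
      fun ends' sgn' F' Z' Λ' N' hlt hi => ih _ hlt hi rfl
    by_cases hex : ∃ b, Brg ends sgn F b
    · obtain ⟨b, hbr⟩ := hex
      obtain ⟨a, c, hb⟩ := ends_ex ends b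
      have hb' : ends b = s(c, a) := by rw [hb, Sym2.eq_swap]
      have hnr := (hbr.2 a c hb).1
      have s1 := h.side hb hbr ih'
      have s2 := h.side hb' hbr ih'
      have hin : ∀ x, cE ends (F.erase b) x ⊆ F.erase b := fun x => filter_subset _ _
      have sup : ∀ d x, (x = d ∨ x ∈ support ends (cE ends (F.erase b) d)) → Reach ends (F.erase b) d x := by
        rintro d x (rfl | hx)
        · exact Reach.rfl'
        · obtain ⟨e, he, hx⟩ := mem_support.1 hx
          exact cE_reach he hx
      refine glue hb ?_ (fun h => notMem_erase b F (hin _ h))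
        (fun h => notMem_erase b F (hin _ h)) ?_
        (fun x h1 h2 => hnr ((sup a x h1).tr (sup c x h2).sy)) ?_
        (h.hΛ.trans (h.hN.trans h.hZ)) s1 s2
      · apply Finset.Subset.antisymm
        · intro e he
          by_cases heb : e = b
          · simp [heb]
          · have heF := mem_erase.2 ⟨heb, he⟩
            obtain ⟨x, y, hxy⟩ := ends_ex ends e
            have hr : Reach ends F a x := h.hconn a (mem_support.2 ⟨b, hbr.1, by simp [hb]⟩) x
              (mem_support.2 ⟨e, he, by simp [hxy]⟩)
            have key : Reach ends (F.erase b) a x ∨ Reach ends (F.erase b) c x := by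
              clear hxy
              induction hr with
              | refl => exact Or.inl Reach.rfl'
              | @tail p q _ hs ih =>
                obtain ⟨f, hf, hpq⟩ := hs
                by_cases hfb : f = b
                · rw [hfb, hb, Sym2.eq_iff] at hpq
                  rcases hpq with ⟨h, h'⟩ | ⟨h, h'⟩
                  · rw [← h']; exact Or.inr Reach.rfl'
                  · rw [← h]; exact Or.inl Reach.rfl'
                · have := Reach.edge (mem_erase.2 ⟨hfb, hf⟩) hpq
                  exact ih.imp (fun h => h.tr this) (fun h => h.tr this)
            rw [mem_insert, mem_union]
            exact Or.inr (key.imp (fun h => mem_filter.2 ⟨heF, x, by simp [hxy], h⟩)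
              (fun h => mem_filter.2 ⟨heF, x, by simp [hxy], h⟩))
        · exact insert_subset hbr.1 (union_subset
            ((hin _).trans (erase_subset _ _)) ((hin _).trans (erase_subset _ _)))
      · intro hl
        obtain ⟨d, hd⟩ := (h.hlp b hl).1
        exact (hbr.2 d d hd).1 Reach.rfl'
      · refine union_subset (h.hN.trans h.hZ) fun e he => (mem_filter.1 he).2.1
    · have : Finset.univ.filter (Brg ends sgn F) = ∅ := by
        rw [Finset.filter_eq_empty_iff]; exact fun e _ he => hex ⟨e, he⟩
      rw [this, Finset.union_empty]
      exact core h.hconn h.hZ h.hb h.hΛ h.hN h.hlp h.hR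
end

section
variable {ends : E → Sym2 V} {sgn : E → Bool}
lemma tree_join {T : Finset E} (hT : ∀ u v, Reach ends T u v) (A : Finset E) :
    ∃ J ⊆ T, bd ends J = bd ends A := by
  induction A using Finset.induction_on with
  | empty => exact ⟨∅, by simp, rfl⟩
  | insert e A he ih =>
    obtain ⟨J, hJ, hb⟩ := ih
    obtain ⟨a, b, hab⟩ := ends_ex ends e
    obtain ⟨B, S, hB, P⟩ := Pth.of_reach (hT a b)
    refine ⟨symmDiff B J, fun f hf => ?_, ?_⟩
    · rcases mem_symmDiff.1 hf with h | h
      · exact hB h.1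
      · exact hJ h.1
    · rw [bd_symm, bd_insert ends he, hb, P.bd_eq, hab, einc_mk]

lemma un_of {F C : Finset E} {a w : V} (hC : C ⊆ F) (h : IsUnbalancedCircuit ends sgn C)
    (hw : w ∈ support ends C) (hr : Reach ends F a w) : Un ends sgn F a := by
  obtain ⟨⟨_, hc, hd⟩, ho⟩ := h
  have hb : bd ends C = 0 := by
    funext v
    by_contra hv
    have := hd v (support_bd hv)
    rw [← degree_parity, this] at hv
    exact hv (show ((2 : ℕ) : ZMod 2) = 0 by decide)
  obtain ⟨C', hC', hU⟩ := uc_exists hb ((ng_odd sgn C).2 ho)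
  obtain ⟨w', hw'⟩ := hU.1.supp_ne
  exact ⟨C', hC'.trans hC, hU, w', hw', hr.tr ((hc w hw w' (support_mono hC' hw')).mono hC)⟩
end

theorem main18 {V E : Type} [Fintype V] [Fintype E] [DecidableEq V] [DecidableEq E]
    (ends : E → Sym2 V) (sgn : E → Bool)
    (hconn : Connected ends)
    (hT : IsSpanningTree ends (Finset.univ.filter fun e => sgn e = false))
    (hX2 : 2 ≤ negCount sgn) :
    ∃ 𝒞 : List (Finset E),
      (∀ C ∈ 𝒞, IsSignedCircuit ends sgn C) ∧
      (∀ e : E,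
        (sgn e = true ∨ SeparatesUnbalanced ends sgn univ e ∨
          ∃ t : E, sgn t = true ∧ IsTwoEdgeCut ends univ e t) →
        ∃ C ∈ 𝒞, e ∈ C) ∧
      totalLength 𝒞 ≤ 2 * Fintype.card E ∧
      (∀ e : E, IsLoop ends e → sgn e = true → widthAt 𝒞 e = 2) := by
  set T := Finset.univ.filter fun e => sgn e = false with hTd
  set X := Finset.univ.filter fun e => sgn e = true with hXd
  have mX : ∀ e, e ∈ X ↔ sgn e = true := by simp [hXd]
  have mT : ∀ e, e ∈ T → sgn e = false := by simp [hTd]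
  obtain ⟨J, hJ, hJb⟩ := tree_join hT.1 X
  let S := Finset.univ.filter fun e => ∃ t : E, sgn t = true ∧ IsTwoEdgeCut ends univ e t
  let Λ := Finset.univ.filter fun e => IsLoop ends e ∧ sgn e = true
  have hZb : bd ends (X ∪ J) = 0 := by
    rw [bd_union ends, hJb, f2]
    rw [Finset.disjoint_left]
    intro e he he'
    have h1 := (mX e).1 he
    have h2 := mT e (hJ he')
    rw [h1] at h2; simp at h2
  have hfund : ∀ x ∈ X, ∃ K ⊆ T, bd ends (insert x K) = 0 ∧ ng sgn (insert x K) = 1 := by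
    intro x hx
    obtain ⟨K, hK, hb⟩ := tree_join hT.1 {x}
    have hxK : x ∉ K := fun h => by
      have := mT x (hK h)
      rw [(mX x).1 hx] at this; simp at this
    refine ⟨K, hK, ?_, ?_⟩
    · rw [bd_insert ends hxK, hb, bd_single, f2]
    · rw [ng_insert sgn hxK, (mX x).1 hx]
      have : ng sgn K = 0 := Finset.sum_eq_zero fun e he => by simp [mT e (hK he)]
      simp [this]
  have hother : ∀ d, ∃ x ∈ X, x ≠ d := fun d => Finset.exists_mem_ne hX2 d
  have hinp : Inp ends sgn univ (X ∪ J) Λ (X ∪ S) := by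
    refine ⟨fun u _ v _ => hconn u v, Finset.subset_univ _, hZb, ?_, ?_, ?_, ?_⟩
    · intro e he
      exact mem_union_left _ ((mX e).2 (mem_filter.1 he).2.2)
    · refine union_subset subset_union_left fun e he => ?_
      obtain ⟨t, ht, hcut⟩ := (mem_filter.1 he).2
      by_contra hne
      obtain ⟨a, b, hab⟩ := ends_ex ends t
      have htZ : t ∈ X ∪ J := mem_union_left _ ((mX t).2 ht)
      refine hcut.2.2.2.2.2.2 a b hab ((reach_even_erase hZb htZ hab).mono fun f hf => ?_)
      obtain ⟨h1, h2⟩ := mem_erase.1 hf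
      simp only [mem_erase, mem_univ, and_true]
      exact ⟨h1, fun h => hne (h ▸ h2)⟩
    · intro l hl
      obtain ⟨h1, h2⟩ := (mem_filter.1 hl).2
      obtain ⟨a, b, hab⟩ := ends_ex ends l
      unfold IsLoop at h1
      rw [hab, Sym2.mk_isDiag_iff] at h1
      exact ⟨⟨a, by rw [hab, h1]⟩, h2⟩
    · intro d hd
      have key : ∃ x ∈ X, ∃ K ⊆ T, bd ends (insert x K) = 0 ∧ ng sgn (insert x K) = 1 ∧
          d ∉ insert x K := by
        by_cases hdX : d ∈ X
        · obtain ⟨x, hx, hxd⟩ := hother d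
          obtain ⟨K, hK, h1, h2⟩ := hfund x hx
          refine ⟨x, hx, K, hK, h1, h2, fun h => ?_⟩
          rcases mem_insert.1 h with h | h
          · exact hxd h.symm
          · have := mT d (hK h)
            rw [(mX d).1 hdX] at this; simp at this
        · obtain ⟨t, ht, hcut⟩ := (mem_filter.1 ((mem_union.1 hd).resolve_left hdX)).2
          obtain ⟨x, hx, hxt⟩ := hother t
          obtain ⟨K, hK, h1, h2⟩ := hfund x hx
          refine ⟨x, hx, K, hK, h1, h2, fun h => ?_⟩
          obtain ⟨a, b, hab⟩ := ends_ex ends d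
          refine hcut.2.2.2.2.2.1 a b hab ((reach_even_erase h1 h hab).mono fun f hf => ?_)
          obtain ⟨h3, h4⟩ := mem_erase.1 hf
          simp only [mem_erase, mem_univ, and_true]
          refine ⟨fun hft => ?_, h3⟩
          rw [hft] at h4
          rcases mem_insert.1 h4 with h | h
          · exact hxt h.symm
          · have := mT t (hK h)
            rw [ht] at this; simp at this
      obtain ⟨x, hx, K, hK, h1, h2, h3⟩ := key
      obtain ⟨R, hR, hU⟩ := uc_exists h1 h2
      exact ⟨R, fun f hf => mem_erase.2 ⟨fun h => h3 (h ▸ hR hf), mem_univ _⟩, hU⟩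
  obtain ⟨𝒞, h1, h2, h3, h4⟩ := hinp.main
  refine ⟨𝒞, fun C hC => (h1 C hC).1.isSigned, fun e he => h2 e ?_, h3, fun e he hs => h4 e ?_⟩
  · simp only [mem_union]
    rcases he with h | h | h
    · exact Or.inl (Or.inl ((mX e).2 h))
    · refine Or.inr (mem_filter.2 ⟨mem_univ _, h.1.1, fun a c hac => ⟨h.1.2 a c hac, ?_⟩⟩)
      obtain ⟨⟨C, hC, hU, w, hw, hr⟩, -⟩ := h.2 a c hac
      exact un_of hC hU hw hr
    · exact Or.inl (Or.inr (mem_filter.2 ⟨mem_univ _, h⟩))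
  · exact mem_filter.2 ⟨mem_univ _, he, hs⟩

/-- If the positive edges of a connected signed graph `G'` form a
spanning tree and `|X'| ≥ 2`, then `X' ∪ B' ∪ S'` can be covered by signed
circuits of total length at most `2·|E(G')|` covering every negative loop
exactly twice. -/
theorem statement18 {V E : Type} [Fintype V] [Fintype E] [DecidableEq V] [DecidableEq E]
    (ends : E → Sym2 V) (sgn : E → Bool)
    (hconn : Connected ends)
    (hT : IsSpanningTree ends (Finset.univ.filter fun e => sgn e = false))
    (hX2 : 2 ≤ negCount sgn) :
    ∃ 𝒞 : List (Finset E),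
      (∀ C ∈ 𝒞, IsSignedCircuit ends sgn C) ∧
      (∀ e : E,
        (sgn e = true ∨ SeparatesUnbalanced ends sgn Finset.univ e ∨
          ∃ t : E, sgn t = true ∧ IsTwoEdgeCut ends Finset.univ e t) →
        ∃ C ∈ 𝒞, e ∈ C) ∧
      totalLength 𝒞 ≤ 2 * Fintype.card E ∧
      (∀ e : E, IsLoop ends e → sgn e = true → widthAt 𝒞 e = 2) := by
  exact main18 ends sgn hconn hT hX2

end SignedCircuitCover
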